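/- Let Ω be an open ball or annulus centered at the origin in ℝ^N, N ≥ 2, and let U = (u_1,…,u_m) ∈ C^{3,α}(Ω̄;ℝ^m) (m ≥ 2) be a classical solution of −Δu_i = f_i(|x|,U) in Ω, u_i = 0 on ∂Ω (i = 1,…,m), whose Morse index satisfies μ(U) ≤ N. Assume: (i) the system is fully coupled along U in Ω(e) for every direction e ∈ S^{N−1}; (ii) for all i,j,k the derivative (∂f_i/∂u_j)(|x|,u_1,…,u_m) is nondecreasing in each variable u_k; (iii) if m ≥ 3, then for every i one has f_i(|x|,u_1,…,u_m) = Σ_{k≠i} g_{ik}(|x|,u_i,u_k) with g_{ik} ∈ C^{1,α}([0,∞)×ℝ²). Then U is foliated Schwarz symmetric, and if U is not radial then each component of U is strictly decreasing in the angular variable θ ∈ (0,π). -/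

import Mathlib

open MeasureTheory Real Set
open scoped RealInnerProductSpace ENNReal

noncomputable section

/-- Euclidean space `ℝ^N`. -/
abbrev EuclN (N : ℕ) := EuclideanSpace ℝ (Fin N)

/-- The Laplacian of a scalar function on `ℝ^N`. -/
def lap {N : ℕ} (u : EuclN N → ℝ) (x : EuclN N) : ℝ :=
  ∑ i : Fin N, iteratedFDeriv ℝ 2 u x ![EuclideanSpace.single i 1, EuclideanSpace.single i 1]

/-- Partial derivative `∂f/∂u_j` of `f(r, u)` with respect to the `j`-th `u`-variable. -/
def pd {m : ℕ} (f : ℝ → (Fin m → ℝ) → ℝ) (j : Fin m) (r : ℝ) (s : Fin m → ℝ) : ℝ :=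
  fderiv ℝ (f r) s (Pi.single j 1)

/-- `Ψ ∈ C^1_c(Ω'; ℝ^m)`. -/
def IsTestFun {N m : ℕ} (Ω' : Set (EuclN N)) (Ψ : Fin m → EuclN N → ℝ) : Prop :=
  ∀ i, ContDiff ℝ 1 (Ψ i) ∧ HasCompactSupport (Ψ i) ∧ tsupport (Ψ i) ⊆ Ω'

/-- The quadratic form `Q_U(Ψ; Ω')` of the linearized operator at a solution `U`. -/
def Qform {N m : ℕ} (f : Fin m → ℝ → (Fin m → ℝ) → ℝ) (U : Fin m → EuclN N → ℝ)
    (Ω' : Set (EuclN N)) (Ψ : Fin m → EuclN N → ℝ) : ℝ :=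
  ∫ x in Ω', ((∑ i, ‖gradient (Ψ i) x‖ ^ 2) -
    ∑ i, ∑ j, pd (f i) j ‖x‖ (fun k => U k x) * Ψ i x * Ψ j x)

/-- There is a `k`-dimensional subspace of `C^1_c(Ω'; ℝ^m)` on which `Q_U(·; Ω')`
is negative definite. -/
def NegDefFamily {N m : ℕ} (f : Fin m → ℝ → (Fin m → ℝ) → ℝ) (U : Fin m → EuclN N → ℝ)
    (Ω' : Set (EuclN N)) (k : ℕ) : Prop :=
  ∃ Ψ : Fin k → Fin m → EuclN N → ℝ,
    (∀ l, IsTestFun Ω' (Ψ l)) ∧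
    ∀ c : Fin k → ℝ, c ≠ 0 → Qform f U Ω' (fun i x => ∑ l, c l * Ψ l i x) < 0

/-- The semilinear system is cooperative (weakly coupled) in `Ω'`. -/
def CoopAlong {N m : ℕ} (f : Fin m → ℝ → (Fin m → ℝ) → ℝ) (Ω' : Set (EuclN N)) : Prop :=
  ∀ i j, i ≠ j → ∀ x ∈ Ω', ∀ s : Fin m → ℝ, 0 ≤ pd (f i) j ‖x‖ s

/-- The semilinear system is fully coupled along the solution `U` in `Ω'`. -/
def FullyCoupledAlong {N m : ℕ} (f : Fin m → ℝ → (Fin m → ℝ) → ℝ)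
    (U : Fin m → EuclN N → ℝ) (Ω' : Set (EuclN N)) : Prop :=
  CoopAlong f Ω' ∧
  ∀ I J : Finset (Fin m), I.Nonempty → J.Nonempty → Disjoint I J → I ∪ J = Finset.univ →
    ∃ i₀ ∈ I, ∃ j₀ ∈ J,
      0 < volume {x ∈ Ω' | 0 < pd (f i₀) j₀ ‖x‖ (fun k => U k x)}

/-- `Ω` is an open ball or annulus centered at the origin. -/
def IsBallOrAnnulus {N : ℕ} (Ω : Set (EuclN N)) : Prop :=
  (∃ R : ℝ, 0 < R ∧ Ω = Metric.ball (0 : EuclN N) R) ∨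
  (∃ r R : ℝ, 0 < r ∧ r < R ∧ Ω = {x : EuclN N | r < ‖x‖ ∧ ‖x‖ < R})

/-- The half-domain `Ω(e) = {x ∈ Ω : x·e > 0}`. -/
def halfDom {N : ℕ} (Ω : Set (EuclN N)) (e : EuclN N) : Set (EuclN N) :=
  {x ∈ Ω | 0 < ⟪x, e⟫}

/-- Reflection through the hyperplane `T(e) = {x : x·e = 0}`. -/
def reflPt {N : ℕ} (e x : EuclN N) : EuclN N := x - (2 * ⟪x, e⟫) • e

/-- `U` is foliated Schwarz symmetric on `Ω` with respect to the axis `p`. -/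
def FoliatedSchwarzWith {N m : ℕ} (Ω : Set (EuclN N)) (U : Fin m → EuclN N → ℝ)
    (p : EuclN N) : Prop :=
  ‖p‖ = 1 ∧ ∀ i, ∀ x ∈ Ω, ∀ y ∈ Ω, ‖x‖ = ‖y‖ → ⟪y, p⟫ ≤ ⟪x, p⟫ → U i y ≤ U i x

/-- `U` is foliated Schwarz symmetric on `Ω`. -/
def FoliatedSchwarz {N m : ℕ} (Ω : Set (EuclN N)) (U : Fin m → EuclN N → ℝ) : Prop :=
  ∃ p : EuclN N, FoliatedSchwarzWith Ω U p

/-- `U` is radial on `Ω`. -/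
def IsRadial {N m : ℕ} (Ω : Set (EuclN N)) (U : Fin m → EuclN N → ℝ) : Prop :=
  ∀ i, ∀ x ∈ Ω, ∀ y ∈ Ω, ‖x‖ = ‖y‖ → U i x = U i y

/-- `U` is a classical solution of `-Δu_i = f_i(|x|, U)` in `Ω`, `u_i = 0` on `∂Ω`. -/
def IsSolution {N m : ℕ} (Ω : Set (EuclN N)) (f : Fin m → ℝ → (Fin m → ℝ) → ℝ)
    (U : Fin m → EuclN N → ℝ) : Prop :=
  (∀ i, ∀ x ∈ Ω, -lap (U i) x = f i ‖x‖ (fun k => U k x)) ∧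
  (∀ i, ∀ x ∈ frontier Ω, U i x = 0)

/-- The bilinear form of the linear system `-ΔU + C(x) U`. -/
def BformL {N m : ℕ} (Ω' : Set (EuclN N)) (C : Fin m → Fin m → EuclN N → ℝ)
    (V Φ : Fin m → EuclN N → ℝ) : ℝ :=
  ∫ x in Ω', ((∑ i, ⟪gradient (V i) x, gradient (Φ i) x⟫) +
    ∑ i, ∑ j, C i j x * V i x * Φ j x)

/-- `-ΔU + D U ≥ 0` weakly in `Ω'`. -/
def WeakSuperSol {N m : ℕ} (Ω' : Set (EuclN N)) (D : Fin m → Fin m → EuclN N → ℝ)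
    (U : Fin m → EuclN N → ℝ) : Prop :=
  ∀ Ψ : Fin m → EuclN N → ℝ, IsTestFun Ω' Ψ → (∀ i x, 0 ≤ Ψ i x) →
    0 ≤ BformL Ω' D U Ψ

/-- `-ΔU + D U ≤ 0` weakly in `Ω'`. -/
def WeakSubSol {N m : ℕ} (Ω' : Set (EuclN N)) (D : Fin m → Fin m → EuclN N → ℝ)
    (U : Fin m → EuclN N → ℝ) : Prop :=
  ∀ Ψ : Fin m → EuclN N → ℝ, IsTestFun Ω' Ψ → (∀ i x, 0 ≤ Ψ i x) →
    BformL Ω' D U Ψ ≤ 0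

/-- The linear system with matrix `D` is cooperative in `Ω`: `d_ij ≤ 0` a.e. for `i ≠ j`. -/
def LinCoop {N m : ℕ} (Ω : Set (EuclN N)) (D : Fin m → Fin m → EuclN N → ℝ) : Prop :=
  ∀ i j, i ≠ j → ∀ᵐ x ∂(volume : Measure (EuclN N)), x ∈ Ω → D i j x ≤ 0

/-- The linear system with matrix `D` is fully coupled in `Ω`. -/
def LinFullyCoupled {N m : ℕ} (Ω : Set (EuclN N)) (D : Fin m → Fin m → EuclN N → ℝ) : Prop :=
  LinCoop Ω D ∧
  ∀ I J : Finset (Fin m), I.Nonempty → J.Nonempty → Disjoint I J → I ∪ J = Finset.univ →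
    ∃ i₀ ∈ I, ∃ j₀ ∈ J, 0 < volume {x ∈ Ω | D i₀ j₀ x < 0}

/-- First symmetric eigenvalue on `Ω'`: the infimum of the Rayleigh quotient of the
symmetric matrix `C` over nontrivial test functions. -/
def lamOneSym {N m : ℕ} (Ω' : Set (EuclN N)) (C : Fin m → Fin m → EuclN N → ℝ) : ℝ :=
  sInf {r : ℝ | ∃ Ψ : Fin m → EuclN N → ℝ, IsTestFun Ω' Ψ ∧ (∃ i x, Ψ i x ≠ 0) ∧
    r = BformL Ω' C Ψ Ψ / ∫ x in Ω', ∑ i, (Ψ i x) ^ 2}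

end


/-! ### Borsuk-Ulam -/
namespace BU
variable {E : Type*} [NormedAddCommGroup E] [NormedSpace ℝ E]

abbrev Ch (E : Type*) := List E →₀ ZMod 2

noncomputable def ext (f : List E → Ch E) : Ch E →ₗ[ZMod 2] Ch E := Finsupp.linearCombination _ f

noncomputable def sg (l : List E) : Ch E := Finsupp.single l 1

lemma ext_sg (f : List E → Ch E) (l : List E) : ext f (sg l) = f l := by simp [ext, sg]

noncomputable def cone (b : E) : Ch E →ₗ[ZMod 2] Ch E := ext (fun l => sg (b :: l))

noncomputable def bd : List E → Ch E
  | [] => 0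
  | b :: l => sg l + cone b (bd l)

noncomputable def D : Ch E →ₗ[ZMod 2] Ch E := ext bd
noncomputable def tau : Ch E →ₗ[ZMod 2] Ch E := ext (fun l => sg (l.map (fun v => -v)))
open Classical in
noncomputable def pr (q : E → Prop) : Ch E →ₗ[ZMod 2] Ch E :=
  ext (fun l => if ∃ v ∈ l, q v then sg l else 0)

lemma two (x : Ch E) : x + x = 0 := by
  ext l; exact CharTwo.add_self_eq_zero (x l)

lemma hom_ext {A B : Ch E →ₗ[ZMod 2] Ch E} (h : ∀ l, A (sg l) = B (sg l)) : A = B := by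
  apply Finsupp.lhom_ext'
  intro l
  ext
  exact DFunLike.congr_fun (h l) _

lemma supp_ind (S : Set (List E)) (p : Ch E → Prop) (h0 : p 0) (ha : ∀ x y, p x → p y → p (x + y))
    (hs : ∀ l ∈ S, p (sg l)) : ∀ x ∈ Finsupp.supported (ZMod 2) (ZMod 2) S, p x := by
  intro x hx
  rw [Finsupp.supported_eq_span_single] at hx
  induction hx using Submodule.span_induction with
  | mem x h => obtain ⟨l, hl, rfl⟩ := h; exact hs l hl
  | zero => exact h0
  | add x y _ _ h1 h2 => exact ha x y h1 h2
  | smul a x _ h =>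
    fin_cases a
    · change p ((0 : ZMod 2) • x); simpa using h0
    · change p ((1 : ZMod 2) • x); simpa using h

lemma sg_mem {S : Set (List E)} {l : List E} (h : l ∈ S) :
    sg l ∈ Finsupp.supported (ZMod 2) (ZMod 2) S := Finsupp.single_mem_supported _ _ h

lemma map_supp {S T : Set (List E)} {A : Ch E →ₗ[ZMod 2] Ch E}
    (h : ∀ l ∈ S, A (sg l) ∈ Finsupp.supported (ZMod 2) (ZMod 2) T) :
    ∀ x ∈ Finsupp.supported (ZMod 2) (ZMod 2) S, A x ∈ Finsupp.supported (ZMod 2) (ZMod 2) T := by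
  apply supp_ind S (fun x => A x ∈ Finsupp.supported (ZMod 2) (ZMod 2) T)
  · simp
  · intro x y hx hy; rw [map_add]; exact add_mem hx hy
  · exact h

lemma eq_on_supp {S : Set (List E)} {A B : Ch E →ₗ[ZMod 2] Ch E}
    (h : ∀ l ∈ S, A (sg l) = B (sg l)) :
    ∀ x ∈ Finsupp.supported (ZMod 2) (ZMod 2) S, A x = B x := by
  apply supp_ind S (fun x => A x = B x)
  · simp
  · intro x y hx hy; rw [map_add, map_add, hx, hy]
  · exact h

lemma cone_sg (b : E) (l : List E) : cone b (sg l) = sg (b :: l) := ext_sg _ _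
lemma D_sg (l : List E) : D (sg l) = bd l := ext_sg _ _
lemma tau_sg (l : List E) : tau (sg l) = sg (l.map (fun v => -v)) := ext_sg _ _

lemma D_cone (b : E) (x : Ch E) : D (cone b x) = x + cone b (D x) := by
  have : D ∘ₗ cone b = LinearMap.id + cone b ∘ₗ D := by
    apply hom_ext; intro l
    simp [cone_sg, D_sg, bd]
  simpa using LinearMap.congr_fun this x

lemma D_bd (l : List E) : D (bd l) = 0 := by
  induction l with
  | nil => simp [bd]
  | cons b l ih => rw [bd, map_add, D_cone, ih, D_sg, map_zero, add_zero, two]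

lemma D_D (x : Ch E) : D (D x) = 0 := by
  have : D ∘ₗ D = (0 : Ch E →ₗ[ZMod 2] Ch E) := hom_ext (fun l => by simp [D_sg, D_bd])
  simpa using LinearMap.congr_fun this x

lemma tau_cone (b : E) (x : Ch E) : tau (cone b x) = cone (-b) (tau x) := by
  have : tau ∘ₗ cone b = cone (-b) ∘ₗ tau := by
    apply hom_ext; intro l; simp [cone_sg, tau_sg]
  simpa using LinearMap.congr_fun this x

lemma tau_bd (l : List E) : tau (bd l) = bd (l.map (fun v => -v)) := by
  induction l with
  | nil => simp [bd]
  | cons b l ih => simp [bd, tau_cone, ih, tau_sg]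

lemma tau_D (x : Ch E) : tau (D x) = D (tau x) := by
  have : tau ∘ₗ D = D ∘ₗ (tau (E := E)) := by
    apply hom_ext; intro l; simp [D_sg, tau_sg, tau_bd]
  simpa using LinearMap.congr_fun this x

lemma tau_tau (x : Ch E) : tau (tau x) = x := by
  have : tau ∘ₗ tau = (LinearMap.id : Ch E →ₗ[ZMod 2] Ch E) := by
    apply hom_ext; intro l; simp [tau_sg]
  simpa using LinearMap.congr_fun this x

lemma bd_supp (l : List E) : bd l ∈ Finsupp.supported (ZMod 2) (ZMod 2)
    {l' : List E | l'.Sublist l ∧ l'.length + 1 = l.length} := by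
  induction l with
  | nil => simp [bd]
  | cons b l ih =>
    rw [bd]
    refine add_mem (sg_mem ⟨List.sublist_cons_self _ _, by simp⟩) ?_
    refine map_supp (fun l' hl' => ?_) _ ih
    rw [cone_sg]
    exact sg_mem ⟨hl'.1.cons_cons b, by simpa using hl'.2⟩

lemma pr_sg_pos (q : E → Prop) (l : List E) (h : ∃ v ∈ l, q v) : pr q (sg l) = sg l := by
  rw [pr, ext_sg, if_pos h]
lemma pr_sg_neg (q : E → Prop) (l : List E) (h : ¬ ∃ v ∈ l, q v) : pr q (sg l) = 0 := by
  rw [pr, ext_sg, if_neg h]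

lemma pr_D_pr (q : E → Prop) (x : Ch E) : pr q (D (pr q x)) = pr q (D x) := by
  have : pr q ∘ₗ D ∘ₗ pr q = pr q ∘ₗ D := by
    apply hom_ext; intro l
    by_cases h : ∃ v ∈ l, q v
    · simp [pr_sg_pos q l h]
    · have h1 : ∀ x ∈ Finsupp.supported (ZMod 2) (ZMod 2)
          {l' : List E | l'.Sublist l ∧ l'.length + 1 = l.length},
          pr q x = (0 : Ch E →ₗ[ZMod 2] Ch E) x := by
        apply eq_on_supp
        intro l' hl'
        rw [pr_sg_neg]; · rfl
        rintro ⟨v, hv, hq⟩; exact h ⟨v, hl'.1.subset hv, hq⟩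
      have h2 := h1 _ (bd_supp l)
      simp [pr_sg_neg q l h, D_sg, h2]
  simpa using LinearMap.congr_fun this x

lemma pr_tau (q : E → Prop) (x : Ch E) : pr q (tau x) = tau (pr (fun v => q (-v)) x) := by
  have : pr q ∘ₗ tau = tau ∘ₗ pr (fun v => q (-v)) := by
    apply hom_ext; intro l
    by_cases h : ∃ v ∈ l, q (-v)
    · simp only [LinearMap.comp_apply]
      rw [pr_sg_pos (fun v => q (-v)) l h, tau_sg, pr_sg_pos]
      obtain ⟨v, hv, hq⟩ := h
      exact ⟨-v, List.mem_map.2 ⟨v, hv, rfl⟩, hq⟩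
    · simp only [LinearMap.comp_apply]
      rw [pr_sg_neg (fun v => q (-v)) l h, tau_sg, pr_sg_neg, map_zero]
      rintro ⟨v, hv, hq⟩
      obtain ⟨w, hw, rfl⟩ := List.mem_map.1 hv
      exact h ⟨w, hw, hq⟩
  simpa using LinearMap.congr_fun this x

lemma pr_apply (q : E → Prop) (x : Ch E) (l : List E) (h : ∃ v ∈ l, q v) : (pr q x) l = x l := by
  induction x using Finsupp.induction_linear with
  | zero => simp
  | add x y hx hy => simp [map_add, hx, hy]
  | single l' a =>
    have : (Finsupp.single l' a : Ch E) = a • sg l' := by simp [sg]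
    rw [this, map_smul]
    by_cases h' : ∃ v ∈ l', q v
    · rw [pr_sg_pos q l' h']
    · rw [pr_sg_neg q l' h']
      have : l' ≠ l := by rintro rfl; exact h' h
      simp [sg, Finsupp.single_apply, this]

def len (S : Set (List E)) (k : ℕ) : Set (List E) := {l | l ∈ S ∧ l.length = k}

/-- Tower of hemispheres. -/
def Tower (S : Set (List E)) (n : ℕ) : Prop := ∃ h : ℕ → Ch E,
  (∀ k ≤ n, h k ∈ Finsupp.supported (ZMod 2) (ZMod 2) (len S (k+1))) ∧
  (∀ k < n, D (h (k+1)) = h k + tau (h k)) ∧ D (h 0) = sg []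

def SubCl (S : Set (List E)) : Prop := (∀ l ∈ S, ∀ l' : List E, l'.Sublist l → l' ∈ S) ∧
  ∀ l ∈ S, l.map (fun v => -v) ∈ S

lemma Tower.step {S : Set (List E)} (hS : SubCl S) {n : ℕ} (hT : Tower S (n+1)) (q : E → Prop)
    (hq : ∀ l ∈ S, ∀ v ∈ l, ∀ w ∈ l, q v → ¬ q (-w)) :
    Tower {l | l ∈ S ∧ ∀ v ∈ l, ¬ q v ∧ ¬ q (-v)} n := by
  obtain ⟨h, h1, h2, h3⟩ := hT
  set m : E → Prop := fun v => q (-v) with hm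
  have mm : ∀ x : Ch E, pr m (tau x) = tau (pr q x) := by
    intro x; rw [pr_tau]; simp [hm]
  have pm : ∀ k, ∀ x ∈ Finsupp.supported (ZMod 2) (ZMod 2) (len S k), pr m (pr q x) = 0 := by
    intro k
    have := eq_on_supp (S := len S k) (A := pr m ∘ₗ pr q) (B := 0) (by
      intro l hl
      by_cases h : ∃ v ∈ l, q v
      · rw [LinearMap.comp_apply, pr_sg_pos q l h, pr_sg_neg]; · rfl
        rintro ⟨w, hw, hqw⟩
        obtain ⟨v, hv, hqv⟩ := h
        exact hq l hl.1 v hv w hw hqv hqw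
      · rw [LinearMap.comp_apply, pr_sg_neg q l h]; simp)
    simpa using this
  have mp : ∀ k, ∀ x ∈ Finsupp.supported (ZMod 2) (ZMod 2) (len S k), pr q (pr m x) = 0 := by
    intro k
    have := eq_on_supp (S := len S k) (A := pr q ∘ₗ pr m) (B := 0) (by
      intro l hl
      by_cases h : ∃ v ∈ l, m v
      · rw [LinearMap.comp_apply, pr_sg_pos m l h, pr_sg_neg]; · rfl
        rintro ⟨w, hw, hqw⟩
        obtain ⟨v, hv, hqv⟩ := h
        exact hq l hl.1 w hw v hv hqw hqv
      · rw [LinearMap.comp_apply, pr_sg_neg m l h]; simp)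
    simpa using this
  have pp : ∀ x : Ch E, pr q (pr q x) = pr q x := by
    intro x
    have : pr q ∘ₗ pr q = pr q := by
      apply hom_ext; intro l
      by_cases h : ∃ v ∈ l, q v
      · simp [pr_sg_pos q l h]
      · simp [pr_sg_neg q l h]
    simpa using LinearMap.congr_fun this x
  have sp : ∀ k, ∀ x ∈ Finsupp.supported (ZMod 2) (ZMod 2) (len S k),
      pr q x ∈ Finsupp.supported (ZMod 2) (ZMod 2) (len S k) := by
    intro k; apply map_supp; intro l hl
    by_cases h : ∃ v ∈ l, q v
    · rw [pr_sg_pos q l h]; exact sg_mem hl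
    · rw [pr_sg_neg q l h]; simp
  have st : ∀ k, ∀ x ∈ Finsupp.supported (ZMod 2) (ZMod 2) (len S k),
      tau x ∈ Finsupp.supported (ZMod 2) (ZMod 2) (len S k) := by
    intro k; apply map_supp; intro l hl
    rw [tau_sg]; exact sg_mem ⟨hS.2 l hl.1, by simpa using hl.2⟩
  have sd : ∀ k, ∀ x ∈ Finsupp.supported (ZMod 2) (ZMod 2) (len S (k+1)),
      D x ∈ Finsupp.supported (ZMod 2) (ZMod 2) (len S k) := by
    intro k; apply map_supp; intro l hl
    rw [D_sg]
    refine Finsupp.supported_mono ?_ (bd_supp l)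
    rintro l' ⟨h1, h2⟩
    exact ⟨hS.1 l hl.1 l' h1, by have := hl.2; omega⟩
  refine ⟨fun k => D (pr q (h (k+1))) + (pr q (h k) + tau (pr q (h k))) + tau (h k), ?_, ?_, ?_⟩
  · intro k hk
    have a0 := h1 k (by omega)
    have a1 := h1 (k+1) (by omega)
    set x := D (pr q (h (k+1))) + (pr q (h k) + tau (pr q (h k))) + tau (h k) with hx
    have hxS : x ∈ Finsupp.supported (ZMod 2) (ZMod 2) (len S (k+1)) :=
      add_mem (add_mem (sd _ _ (sp _ _ a1)) (add_mem (sp _ _ a0) (st _ _ (sp _ _ a0)))) (st _ _ a0)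
    have e1 : pr q x = 0 := by
      rw [hx, map_add, map_add, map_add, pr_D_pr, h2 k (by omega), map_add, pp, pr_tau q (pr q (h k)),
        pm _ _ a0, map_zero, add_zero]
      have := two (pr q (h k)); have := two (pr q (tau (h k)))
      grind
    have e2 : pr m x = 0 := by
      rw [hx, map_add, map_add, map_add, ← pr_D_pr, pm _ _ a1, pm _ _ a0, mm, mm, pp]
      simp [two]
    rw [Finsupp.mem_supported]
    intro l hl
    have hl' : x l ≠ 0 := Finsupp.mem_support_iff.1 hl
    have hlS := (Finsupp.mem_supported _ _).1 hxS hl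
    refine ⟨⟨hlS.1, fun v hv => ⟨fun hqv => hl' ?_, fun hqv => hl' ?_⟩⟩, hlS.2⟩
    · rw [← pr_apply q x l ⟨v, hv, hqv⟩, e1]; rfl
    · rw [← pr_apply m x l ⟨v, hv, hqv⟩, e2]; rfl
  · intro k hk
    have a := h2 k (by omega)
    simp only [map_add, D_D, ← tau_D, a, tau_tau, h2 (k+1) (by omega)]
    have := two (pr q (h k)); have := two (tau (pr q (h k)))
    grind
  · have a0 := sd 0 _ (sp _ _ (h1 0 (by omega)))
    have a1 : tau (D (pr q (h 0))) = D (pr q (h 0)) := by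
      refine eq_on_supp (S := len S 0) (A := tau) (B := LinearMap.id) ?_ _ a0
      intro l hl
      have : l = [] := List.length_eq_zero_iff.1 hl.2
      subst this; rw [tau_sg]; rfl
    simp only [map_add, D_D, ← tau_D, a1, h3, tau_sg, two, List.map_nil, zero_add]

end BU

namespace BU
variable {E : Type*} [NormedAddCommGroup E] [NormedSpace ℝ E]

noncomputable def bary (l : List E) : E := (l.length : ℝ)⁻¹ • l.sum

noncomputable def sdA : ℕ → (Ch E →ₗ[ZMod 2] Ch E)
  | 0 => LinearMap.id
  | n + 1 => ext (fun l => cone (bary l) (sdA n (bd l)))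

lemma sdA_succ (n : ℕ) (l : List E) : sdA (n+1) (sg l) = cone (bary l) (sdA n (bd l)) := by
  rw [sdA, ext_sg]

lemma bary_neg (l : List E) : bary (l.map (fun v => -v)) = - bary l := by
  have : (l.map (fun v => -v)).sum = - l.sum := by
    induction l with
    | nil => simp
    | cons a l ih => simp [ih, add_comm]
  simp [bary, this]

lemma tau_sdA (n : ℕ) (x : Ch E) : tau (sdA n x) = sdA n (tau x) := by
  induction n generalizing x with
  | zero => rfl
  | succ n ih =>
    have : tau ∘ₗ sdA (n+1) = sdA (n+1) ∘ₗ (tau (E := E)) := by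
      apply hom_ext; intro l
      simp only [LinearMap.comp_apply]
      rw [sdA_succ, tau_cone, ih, tau_sg, sdA_succ, bary_neg, tau_bd]
    simpa using LinearMap.congr_fun this x

lemma D_sdA (n : ℕ) : ∀ x ∈ Finsupp.supported (ZMod 2) (ZMod 2) {l : List E | l.length = n + 1},
    D (sdA (n+1) x) = sdA n (D x) := by
  induction n with
  | zero =>
    intro x hx
    rw [← LinearMap.comp_apply, ← LinearMap.comp_apply]
    refine eq_on_supp ?_ x hx
    intro l hl
    obtain ⟨v, rfl⟩ := List.length_eq_one_iff.1 hl
    simp [ext_sg, D_cone, D_sg, bd, sdA]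
  | succ n ih =>
    intro x hx
    rw [← LinearMap.comp_apply, ← LinearMap.comp_apply]
    refine eq_on_supp ?_ x hx
    intro l hl
    simp only [LinearMap.comp_apply]
    rw [sdA_succ, D_cone, ih, D_bd, D_sg]
    · simp
    · refine Finsupp.supported_mono ?_ (bd_supp l)
      rintro l' ⟨_, h2⟩
      simp only [mem_setOf_eq] at hl ⊢; omega

lemma bary_dist (l : List E) {r : ℝ} (hr : 0 ≤ r) {n : ℕ} (hl : l.length ≤ n + 1)
    (h : ∀ v ∈ l, ∀ w ∈ l, dist v w ≤ r) (w : E) (hw : w ∈ l) :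
    dist w (bary l) ≤ (n / (n + 1) : ℝ) * r := by
  classical
  have hL : 0 < l.length := List.length_pos_of_mem hw
  have hL' : (0:ℝ) < l.length := by exact_mod_cast hL
  have key : ∀ l' : List E, (∀ v ∈ l', dist v w ≤ r) →
      ‖l'.sum - (l'.length : ℝ) • w‖ ≤ l'.length * r := by
    intro l'
    induction l' with
    | nil => simp
    | cons a l' ih =>
      intro h
      have h1 := ih (fun v hv => h v (by simp [hv]))
      have h2 := h a (by simp)
      have : (a :: l').sum - ((a :: l').length : ℝ) • w = (a - w) + (l'.sum - (l'.length : ℝ) • w) := by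
        simp [add_smul]; abel
      rw [this]
      refine (norm_add_le _ _).trans ?_
      rw [dist_eq_norm] at h2
      simp; nlinarith
  have hp := List.perm_cons_erase hw
  have h1 := key (l.erase w) (fun v hv => h v (List.mem_of_mem_erase hv) w hw)
  have hlen : ((l.erase w).length : ℝ) = l.length - 1 := by
    rw [List.length_erase_of_mem hw, Nat.cast_sub hL]; simp
  have hs : l.sum = w + (l.erase w).sum := by rw [hp.sum_eq]; simp
  have h3 : bary l - w = (l.length : ℝ)⁻¹ • ((l.erase w).sum - ((l.erase w).length : ℝ) • w) := by
    rw [bary, hs, hlen]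
    have : w = (l.length : ℝ)⁻¹ • ((l.length : ℝ) • w) := by
      rw [smul_smul, inv_mul_cancel₀ hL'.ne', one_smul]
    rw [sub_smul, one_smul, smul_sub, smul_sub, ← this, smul_add]; abel
  rw [dist_comm, dist_eq_norm, h3, norm_smul, norm_inv, Real.norm_of_nonneg hL'.le]
  rw [hlen] at h1 ⊢
  have hl' : (l.length : ℝ) ≤ n + 1 := by exact_mod_cast hl
  calc _ ≤ (l.length : ℝ)⁻¹ * ((l.length - 1) * r) := by gcongr
    _ = ((l.length - 1) / l.length) * r := by field_simp
    _ ≤ _ := by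
      gcongr ?_ * r
      rw [div_le_div_iff₀ hL' (by positivity)]
      nlinarith

def pw (r : ℝ) (l : List E) : Prop := ∀ v ∈ l, ∀ w ∈ l, dist v w ≤ r

lemma sdA_supp {r : ℝ} (hr : 0 ≤ r) {n : ℕ} : ∀ (L : ℕ), L ≤ n + 1 → ∀ l : List E, l.length = L →
    pw r l → sdA L (sg l) ∈ Finsupp.supported (ZMod 2) (ZMod 2)
      {l' : List E | l'.length = L ∧ (∀ v ∈ l', v ∈ convexHull ℝ {w | w ∈ l}) ∧
        pw ((n / (n + 1) : ℝ) * r) l'} := by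
  intro L
  induction L with
  | zero =>
    intro _ l hl _
    have : l = [] := List.length_eq_zero_iff.1 hl
    subst this
    exact sg_mem ⟨rfl, by simp, by simp [pw]⟩
  | succ L ih =>
    intro hL l hl hpw
    rw [sdA_succ]
    have h1 : sdA L (bd l) ∈ Finsupp.supported (ZMod 2) (ZMod 2)
      {l' : List E | l'.length = L ∧ (∀ v ∈ l', v ∈ convexHull ℝ {w | w ∈ l}) ∧
        pw ((n / (n + 1) : ℝ) * r) l'} := by
      refine map_supp ?_ _ (bd_supp l)
      rintro l' ⟨h1, h2⟩
      refine Finsupp.supported_mono ?_ (ih (by omega) l' (by omega)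
        (fun v hv w hw => hpw v (h1.subset hv) w (h1.subset hw)))
      rintro l'' ⟨a1, a2, a3⟩
      exact ⟨a1, fun v hv => convexHull_mono (fun w hw => h1.subset hw) (a2 v hv), a3⟩
    refine map_supp ?_ _ h1
    rintro l' ⟨a1, a2, a3⟩
    rw [cone_sg]
    apply sg_mem
    have hne : 0 < l.length := by omega
    have hb : bary l ∈ convexHull ℝ {w | w ∈ l} := by
      have key : ∀ l' : List E, (∀ v ∈ l', v ∈ l) → 0 < l'.length →
          bary l' ∈ convexHull ℝ {w | w ∈ l} := by
        intro l' hl' h0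
        have : bary l' = ∑ i : Fin l'.length, (l'.length : ℝ)⁻¹ • l'[i] := by
          rw [bary, ← Finset.smul_sum]; congr 1
          exact (Fin.sum_univ_getElem l').symm
        rw [this]
        apply (convex_convexHull ℝ _).sum_mem
        · intros; positivity
        · simp; field_simp
        · intro i _
          exact subset_convexHull ℝ _ (hl' _ (List.getElem_mem _))
      exact key l (fun v hv => hv) hne
    have hd : ∀ v ∈ convexHull ℝ {w | w ∈ l}, dist v (bary l) ≤ (n / (n + 1) : ℝ) * r := by
      intro v hv
      have : convexHull ℝ {w | w ∈ l} ⊆ Metric.closedBall (bary l) ((n / (n + 1) : ℝ) * r) :=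
        convexHull_min (fun w hw => bary_dist l hr (by omega) hpw w hw) (convex_closedBall _ _)
      exact this hv
    refine ⟨by simp [a1], ?_, ?_⟩
    · intro v hv
      rcases List.mem_cons.1 hv with rfl | hv
      · exact hb
      · exact a2 v hv
    · intro v hv w hw
      rcases List.mem_cons.1 hv with rfl | hv
      · rw [dist_comm]
        rcases List.mem_cons.1 hw with rfl | hw
        · exact hd _ hb
        · exact hd _ (a2 w hw)
      · rcases List.mem_cons.1 hw with rfl | hw
        · exact hd _ (a2 v hv)
        · exact a3 v hv w hw

def Sset (C : Set (Set E)) (r : ℝ) : Set (List E) := {l | (∃ c ∈ C, ∀ v ∈ l, v ∈ c) ∧ pw r l}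

lemma Tower.sub {C : Set (Set E)} (hC : ∀ c ∈ C, Convex ℝ c) {r : ℝ} (hr : 0 ≤ r) {n : ℕ}
    (h : Tower (Sset C r) n) : Tower (Sset C ((n / (n + 1) : ℝ) * r)) n := by
  obtain ⟨h, h1, h2, h3⟩ := h
  have hlen : ∀ k ≤ n, h k ∈ Finsupp.supported (ZMod 2) (ZMod 2) {l : List E | l.length = k + 1} :=
    fun k hk => Finsupp.supported_mono (fun l hl => hl.2) (h1 k hk)
  refine ⟨fun k => sdA (k+1) (h k), ?_, ?_, ?_⟩
  · intro k hk
    refine map_supp ?_ _ (h1 k hk)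
    rintro l ⟨⟨⟨c, hc, hcl⟩, hpw⟩, hlk⟩
    refine Finsupp.supported_mono ?_ (sdA_supp hr (n := n) (k+1) (by omega) l hlk hpw)
    rintro l' ⟨a1, a2, a3⟩
    exact ⟨⟨⟨c, hc, fun v hv => convexHull_min hcl (hC c hc) (a2 v hv)⟩, a3⟩, a1⟩
  · intro k hk
    change D (sdA (k+1+1) (h (k+1))) = _
    rw [D_sdA _ _ (hlen _ (by omega)), h2 k hk, map_add, tau_sdA]
  · change D (sdA (0+1) (h 0)) = _
    rw [D_sdA _ _ (hlen _ (by omega)), h3]; rfl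

noncomputable def eb (n k : ℕ) : Fin (n+1) → ℝ := fun i => if i.val = k then 1 else 0

noncomputable def h0 (n : ℕ) : ℕ → Ch (Fin (n+1) → ℝ)
  | 0 => sg [eb n 0]
  | k + 1 => cone (eb n (k+1)) (h0 n k + tau (h0 n k))

def Cs (n : ℕ) : Set (Set (Fin (n+1) → ℝ)) :=
  {c | ∃ s : Fin (n+1) → ℝ, (∀ i, |s i| ≤ 1) ∧ c = {v | ∑ i, s i * v i = 1 ∧ ‖v‖ ≤ 1}}

lemma h0_tower (n : ℕ) : Tower (Sset (Cs n) 2) n := by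
  have hD : ∀ k, D (h0 n (k+1)) = h0 n k + tau (h0 n k) := by
    intro k
    induction k with
    | zero =>
      change D (cone _ _) = _
      rw [D_cone, map_add, ← tau_D]
      simp only [h0, D_sg, bd, map_zero, add_zero, tau_sg, List.map_nil, two]
    | succ k ih =>
      rw [h0, D_cone, map_add, ← tau_D, ih, map_add tau, tau_tau, add_comm (tau (h0 n k)), two]
      simp
  refine ⟨h0 n, ?_, fun k _ => hD k, by simp [h0, D_sg, bd]⟩
  have key : ∀ k, h0 n k ∈ Finsupp.supported (ZMod 2) (ZMod 2)
      {l | l.length = k + 1 ∧ ∃ σ : ℕ → ℝ, (∀ j, |σ j| = 1) ∧ ∀ v ∈ l, ∃ j ≤ k, v = σ j • eb n j} := by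
    intro k
    induction k with
    | zero =>
      exact sg_mem ⟨rfl, fun _ => 1, by simp, fun v hv => ⟨0, le_rfl, by simpa using hv⟩⟩
    | succ k ih =>
      rw [h0]
      have ih' : h0 n k + tau (h0 n k) ∈ Finsupp.supported (ZMod 2) (ZMod 2)
        {l | l.length = k + 1 ∧ ∃ σ : ℕ → ℝ, (∀ j, |σ j| = 1) ∧ ∀ v ∈ l, ∃ j ≤ k, v = σ j • eb n j} := by
        refine add_mem ih (map_supp ?_ _ ih)
        rintro l ⟨h1, σ, h2, h3⟩
        rw [tau_sg]
        refine sg_mem ⟨by simp [h1], fun j => - σ j, by simp [h2], ?_⟩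
        intro v hv
        obtain ⟨w, hw, rfl⟩ := List.mem_map.1 hv
        obtain ⟨j, hj, rfl⟩ := h3 w hw
        exact ⟨j, hj, by simp⟩
      refine map_supp ?_ _ ih'
      rintro l ⟨h1, σ, h2, h3⟩
      rw [cone_sg]
      refine sg_mem ⟨by simp [h1], fun j => if j = k + 1 then 1 else σ j, ?_, ?_⟩
      · intro j; dsimp only; split_ifs <;> simp [h2]
      · intro v hv
        rcases List.mem_cons.1 hv with rfl | hv
        · exact ⟨k+1, le_rfl, by simp⟩
        · obtain ⟨j, hj, rfl⟩ := h3 v hv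
          exact ⟨j, by omega, by dsimp only; rw [if_neg (by omega)]⟩
  intro k hk
  refine Finsupp.supported_mono ?_ (key k)
  rintro l ⟨h1, σ, h2, h3⟩
  have hn : ∀ v ∈ l, ‖v‖ ≤ 1 := by
    intro v hv
    obtain ⟨j, hj, rfl⟩ := h3 v hv
    rw [norm_smul, Real.norm_eq_abs, h2, one_mul, pi_norm_le_iff_of_nonneg zero_le_one]
    intro i; simp only [eb]; split_ifs <;> simp
  refine ⟨⟨⟨_, ⟨fun i => σ i, fun i => (h2 i).le, rfl⟩, fun v hv => ⟨?_, hn v hv⟩⟩, ?_⟩, h1⟩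
  · obtain ⟨j, hj, rfl⟩ := h3 v hv
    have hs : σ j * σ j = 1 := by rw [← abs_mul_abs_self, h2]; simp
    rw [Finset.sum_eq_single (⟨j, by omega⟩ : Fin (n+1))]
    · simp [eb, hs]
    · intro b _ hb
      have : b.val ≠ j := fun h => hb (Fin.ext h)
      simp [eb, this]
    · simp
  · intro v hv w hw
    have := dist_le_norm_add_norm v w
    linarith [hn v hv, hn w hw]

lemma fine_tower (n : ℕ) {ε : ℝ} (hε : 0 < ε) : ∃ r, 0 ≤ r ∧ r < ε ∧ Tower (Sset (Cs n) r) n := by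
  have hC : ∀ c ∈ Cs n, Convex ℝ c := by
    rintro c ⟨s, hs, rfl⟩
    intro x hx y hy a b ha hb hab
    refine ⟨?_, ?_⟩
    · have : ∑ i, s i * (a • x + b • y) i = a * ∑ i, s i * x i + b * ∑ i, s i * y i := by
        rw [Finset.mul_sum, Finset.mul_sum, ← Finset.sum_add_distrib]
        refine Finset.sum_congr rfl fun i _ => ?_
        simp; ring
      rw [this, hx.1, hy.1]; linarith
    · refine (norm_add_le _ _).trans ?_
      rw [norm_smul, norm_smul, Real.norm_of_nonneg ha, Real.norm_of_nonneg hb]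
      nlinarith [hx.2, hy.2]
  have hk : (0:ℝ) ≤ n / (n + 1) := by positivity
  have h : ∀ j : ℕ, Tower (Sset (Cs n) ((n / (n + 1) : ℝ) ^ j * 2)) n := by
    intro j
    induction j with
    | zero => simpa using h0_tower n
    | succ j ih =>
      have := Tower.sub hC (by positivity) ih
      rwa [← mul_assoc, ← pow_succ'] at this
  obtain ⟨j, hj⟩ := exists_pow_lt_of_lt_one (show 0 < ε / 2 by positivity)
    (show (n / (n + 1) : ℝ) < 1 by rw [div_lt_one (by positivity)]; linarith)
  exact ⟨_, by positivity, by linarith, h j⟩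

theorem borsuk_ulam {n : ℕ} (g : (Fin (n+1) → ℝ) → (Fin n → ℝ)) (hg : Continuous g)
    (hodd : ∀ x, g (-x) = - g x) : ∃ x, ‖x‖ = 1 ∧ g x = 0 := by
  by_contra hcon
  push Not at hcon
  set M : Set (Fin (n+1) → ℝ) := {v | ‖v‖ ≤ 1 ∧ 1 ≤ ∑ i, |v i|} with hM
  have hMc : IsCompact M := by
    have : M = Metric.closedBall 0 1 ∩ {v | 1 ≤ ∑ i, |v i|} := by ext v; simp [hM]
    rw [this]
    exact (isCompact_closedBall _ _).inter_right (isClosed_le continuous_const (by fun_prop))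
  have hM0 : ∀ v ∈ M, v ≠ 0 := by
    rintro v ⟨_, h⟩ rfl; simp at h; linarith
  set g' : (Fin (n+1) → ℝ) → (Fin n → ℝ) := fun v => g (‖v‖⁻¹ • v) with hg'
  have hc' : ContinuousOn g' M := by
    refine hg.comp_continuousOn (ContinuousOn.smul (ContinuousOn.inv₀ continuous_norm.continuousOn ?_)
      continuousOn_id)
    intro v hv; exact norm_ne_zero_iff.2 (hM0 v hv)
  have hodd' : ∀ v, g' (-v) = - g' v := by intro v; simp [hg', hodd]
  have hpos : ∀ v ∈ M, 0 < ‖g' v‖ := by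
    intro v hv
    rw [norm_pos_iff]
    apply hcon
    rw [norm_smul, norm_inv, norm_norm, inv_mul_cancel₀ (norm_ne_zero_iff.2 (hM0 v hv))]
  have hMne : M.Nonempty := ⟨fun _ => 1, by
    rw [pi_norm_le_iff_of_nonneg zero_le_one]; simp, by simp⟩
  obtain ⟨v0, hv0, hmin⟩ := hMc.exists_isMinOn hMne hc'.norm
  set c := ‖g' v0‖ with hc
  have hcpos : 0 < c := hpos v0 hv0
  obtain ⟨δ, hδ, hun⟩ := Metric.uniformContinuousOn_iff.1 (hMc.uniformContinuousOn_of_continuous hc') c hcpos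
  obtain ⟨r, hr, hrδ, hT⟩ := fine_tower n hδ
  have hSM : ∀ l ∈ Sset (Cs n) r, ∀ v ∈ l, v ∈ M := by
    rintro l ⟨⟨_, ⟨s, hs, rfl⟩, hl⟩, _⟩ v hv
    obtain ⟨h1, h2⟩ := hl v hv
    refine ⟨h2, ?_⟩
    rw [← h1]
    refine Finset.sum_le_sum fun i _ => (le_abs_self _).trans ?_
    rw [abs_mul]
    exact mul_le_of_le_one_left (abs_nonneg _) (hs i)
  set S : ℕ → Set (List (Fin (n+1) → ℝ)) := fun j =>
    {l | l ∈ Sset (Cs n) r ∧ ∀ v ∈ l, ∀ i : Fin n, i.val < j → ¬ (c ≤ g' v i) ∧ ¬ (c ≤ g' (-v) i)} with hS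
  have hSub : ∀ j, SubCl (S j) := by
    intro j
    refine ⟨?_, ?_⟩
    · rintro l ⟨⟨⟨cc, hcc, hl⟩, hp⟩, h2⟩ l' hl'
      exact ⟨⟨⟨cc, hcc, fun v hv => hl v (hl'.subset hv)⟩,
        fun v hv w hw => hp v (hl'.subset hv) w (hl'.subset hw)⟩, fun v hv => h2 v (hl'.subset hv)⟩
    · rintro l ⟨⟨⟨_, ⟨s, hs, rfl⟩, hl⟩, hp⟩, h2⟩
      refine ⟨⟨⟨_, ⟨-s, by simpa using hs, rfl⟩, ?_⟩, ?_⟩, ?_⟩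
      · intro v hv
        obtain ⟨w, hw, rfl⟩ := List.mem_map.1 hv
        simpa using hl w hw
      · intro v hv v' hv'
        obtain ⟨w, hw, rfl⟩ := List.mem_map.1 hv
        obtain ⟨w', hw', rfl⟩ := List.mem_map.1 hv'
        rw [dist_neg_neg]; exact hp w hw w' hw'
      · intro v hv i hi
        obtain ⟨w, hw, rfl⟩ := List.mem_map.1 hv
        rw [neg_neg]
        exact (h2 w hw i hi).symm
  have hTj : ∀ j ≤ n, Tower (S j) (n - j) := by
    intro j
    induction j with
    | zero =>
      intro _
      have : S 0 = Sset (Cs n) r := by ext l; simp [hS]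
      rw [this]; exact hT
    | succ j ih =>
      intro hj
      have h1 := ih (by omega)
      rw [show n - j = (n - (j+1)) + 1 by omega] at h1
      have := h1.step (hSub j) (fun v => c ≤ g' v ⟨j, by omega⟩) (by
        intro l hl v hv w hw hq hq'
        have hd := hun v (hSM l hl.1 v hv) w (hSM l hl.1 w hw) (lt_of_le_of_lt (hl.1.2 v hv w hw) hrδ)
        have := (dist_le_pi_dist (g' v) (g' w) ⟨j, by omega⟩).trans_lt hd
        rw [hodd'] at hq'
        simp only [Pi.neg_apply] at hq'
        rw [Real.dist_eq, abs_lt] at this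
        linarith)
      convert this using 1
      ext l
      simp only [hS, mem_setOf_eq]
      constructor
      · rintro ⟨a, b⟩
        exact ⟨⟨a, fun v hv i hi => b v hv i (by omega)⟩, fun v hv => b v hv ⟨j, by omega⟩ (by simp)⟩
      · rintro ⟨⟨a, b⟩, d⟩
        refine ⟨a, fun v hv i hi => ?_⟩
        rcases Nat.lt_succ_iff_lt_or_eq.1 hi with h | h
        · exact b v hv i h
        · have : i = ⟨j, by omega⟩ := Fin.ext h
          rw [this]; exact d v hv
  have hfin := hTj n le_rfl
  obtain ⟨h, h1, -, h3⟩ := hfin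
  have hz : h 0 ∈ Finsupp.supported (ZMod 2) (ZMod 2) (∅ : Set (List (Fin (n+1) → ℝ))) := by
    refine Finsupp.supported_mono ?_ (h1 0 (by omega))
    rintro l ⟨⟨hl, hl2⟩, hlen⟩
    exfalso
    obtain ⟨v, rfl⟩ := List.length_eq_one_iff.1 hlen
    have hvM := hSM _ hl v (by simp)
    have : c ≤ ‖g' v‖ := hmin hvM
    have hlt : ‖g' v‖ < c := by
      rw [pi_norm_lt_iff hcpos]
      intro i
      have := hl2 v (by simp) i i.2
      rw [hodd'] at this
      simp only [Pi.neg_apply, not_le] at this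
      rw [Real.norm_eq_abs, abs_lt]; constructor <;> linarith [this.1, this.2]
    linarith
  rw [Finsupp.supported_empty, Submodule.mem_bot] at hz
  rw [hz, map_zero] at h3
  have := DFunLike.congr_fun h3 []
  simp [sg] at this

end BU

/-! ### Laplacian calculus -/
namespace LapC
variable {N : ℕ}
open Laplacian InnerProductSpace Filter Topology

noncomputable abbrev eb (i : Fin N) : EuclN N := EuclideanSpace.single i 1

lemma lap_eq_laplacian (u : EuclN N → ℝ) (x : EuclN N) : lap u x = Δ u x := by
  rw [laplacian_eq_iteratedFDeriv_orthonormalBasis u (EuclideanSpace.basisFun (Fin N) ℝ)]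
  simp [lap]

lemma lap_eq (u : EuclN N → ℝ) (x : EuclN N) :
    lap u x = ∑ i, fderiv ℝ (fderiv ℝ u) x (eb i) (eb i) := by
  simp [lap, iteratedFDeriv_two_apply]

lemma fderiv_fderiv_apply {u : EuclN N → ℝ} {x : EuclN N} (hu : ContDiffAt ℝ 2 u x) (v w : EuclN N) :
    fderiv ℝ (fun y => fderiv ℝ u y v) x w = fderiv ℝ (fderiv ℝ u) x w v := by
  have : DifferentiableAt ℝ (fderiv ℝ u) x := (hu.fderiv_right (m := 1) (by norm_num)).differentiableAt (by simp)
  rw [fderiv_clm_apply this (differentiableAt_const v)]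
  simp

lemma lap_congr {u v : EuclN N → ℝ} {x : EuclN N} (h : u =ᶠ[𝓝 x] v) : lap u x = lap v x := by
  rw [lap_eq_laplacian, lap_eq_laplacian, (laplacian_congr_nhds h).eq_of_nhds]

lemma lap_add {u v : EuclN N → ℝ} {x : EuclN N} (hu : ContDiffAt ℝ 2 u x) (hv : ContDiffAt ℝ 2 v x) :
    lap (fun y => u y + v y) x = lap u x + lap v x := by
  simp only [lap_eq_laplacian]; exact hu.laplacian_add hv

lemma lap_sub {u v : EuclN N → ℝ} {x : EuclN N} (hu : ContDiffAt ℝ 2 u x) (hv : ContDiffAt ℝ 2 v x) :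
    lap (fun y => u y - v y) x = lap u x - lap v x := by
  simp only [lap_eq_laplacian]; exact hu.laplacian_sub hv

lemma lap_smul {u : EuclN N → ℝ} {x : EuclN N} (c : ℝ) (hu : ContDiffAt ℝ 2 u x) :
    lap (fun y => c * u y) x = c * lap u x := by
  simp only [lap_eq_laplacian]; exact laplacian_smul c hu

lemma lap_neg (u : EuclN N → ℝ) (x : EuclN N) :
    lap (fun y => - u y) x = - lap u x := by
  simp only [lap_eq_laplacian]; exact congrFun (laplacian_neg (f := u)) x

lemma lap_const (c : ℝ) (x : EuclN N) : lap (fun _ => c) x = 0 := by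
  simp only [lap_eq_laplacian, laplacian_const]; rfl

lemma lap_comp_isometry (u : EuclN N → ℝ) (s : EuclN N ≃ₗᵢ[ℝ] EuclN N) (x : EuclN N) :
    lap (fun y => u (s y)) x = lap u (s x) := by
  rw [lap_eq_laplacian, lap_eq_laplacian]
  rw [laplacian_eq_iteratedFDeriv_orthonormalBasis u ((EuclideanSpace.basisFun (Fin N) ℝ).map s),
    laplacian_eq_iteratedFDeriv_orthonormalBasis _ (EuclideanSpace.basisFun (Fin N) ℝ)]
  have := s.toContinuousLinearEquiv.iteratedFDerivWithin_comp_right (x := x) u uniqueDiffOn_univ (mem_univ _) 2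
  simp only [preimage_univ, iteratedFDerivWithin_univ] at this
  refine Finset.sum_congr rfl fun i _ => ?_
  change iteratedFDeriv ℝ 2 (u ∘ s.toContinuousLinearEquiv) x _ = _
  rw [this, ContinuousMultilinearMap.compContinuousLinearMap_apply]
  have h2 : (fun i_1 : Fin 2 => s.toContinuousLinearEquiv.toContinuousLinearMap (![(EuclideanSpace.basisFun (Fin N) ℝ) i, (EuclideanSpace.basisFun (Fin N) ℝ) i] i_1)) = ![((EuclideanSpace.basisFun (Fin N) ℝ).map s) i, ((EuclideanSpace.basisFun (Fin N) ℝ).map s) i] := by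
    ext k; fin_cases k <;> simp
  exact congrArg _ h2

lemma second_deriv_line {u : EuclN N → ℝ} {x : EuclN N} (hu : ContDiffAt ℝ 2 u x) (v : EuclN N) :
    deriv (fun t : ℝ => u (x + t • v)) =ᶠ[𝓝 0] (fun t => fderiv ℝ u (x + t • v) v) ∧
    deriv (deriv (fun t : ℝ => u (x + t • v))) 0 = fderiv ℝ (fderiv ℝ u) x v v := by
  have hl : ∀ t : ℝ, HasDerivAt (fun t : ℝ => x + t • v) v t := fun t => by
    simpa using ((hasDerivAt_id t).smul_const v).const_add x
  have hev : ∀ᶠ y in 𝓝 x, ContDiffAt ℝ 2 u y := hu.eventually (by simp)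
  have hc : Filter.Tendsto (fun t : ℝ => x + t • v) (𝓝 0) (𝓝 x) := by
    have := (hl 0).continuousAt.tendsto
    simpa using this
  have h1 : deriv (fun t : ℝ => u (x + t • v)) =ᶠ[𝓝 0] (fun t => fderiv ℝ u (x + t • v) v) := by
    filter_upwards [hc.eventually hev] with t ht
    exact ((ht.differentiableAt (by simp)).hasFDerivAt.comp_hasDerivAt t (hl t)).deriv
  refine ⟨h1, ?_⟩
  rw [h1.deriv_eq]
  have : DifferentiableAt ℝ (fderiv ℝ u) x := (hu.fderiv_right (m := 1) (by norm_num)).differentiableAt (by simp)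
  have h2 : HasDerivAt (fun t : ℝ => fderiv ℝ u (x + t • v)) (fderiv ℝ (fderiv ℝ u) x v) 0 := by
    have h3 : HasFDerivAt (fderiv ℝ u) (fderiv ℝ (fderiv ℝ u) x) (x + (0:ℝ) • v) := by
      simpa using this.hasFDerivAt
    exact h3.comp_hasDerivAt 0 (hl 0)
  simpa using (h2.clm_apply (hasDerivAt_const 0 v)).deriv

lemma lap_nonneg_of_isLocalMin {u : EuclN N → ℝ} {x : EuclN N} (hu : ContDiffAt ℝ 2 u x)
    (hmin : IsLocalMin u x) : 0 ≤ lap u x := by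
  rw [lap_eq]
  refine Finset.sum_nonneg fun i _ => ?_
  set v : EuclN N := eb i with hv
  by_contra hneg
  push Not at hneg
  set c := fderiv ℝ (fderiv ℝ u) x v v with hc
  obtain ⟨h1, h2⟩ := second_deriv_line hu v
  set g : ℝ → ℝ := fun t => u (x + t • v) with hg
  have hcont : Filter.Tendsto (fun t : ℝ => x + t • v) (𝓝 0) (𝓝 x) := by
    have : Continuous (fun t : ℝ => x + t • v) := by fun_prop
    simpa using this.tendsto 0
  have hgmin : IsLocalMin g 0 := by
    have h3 : ∀ᶠ t : ℝ in 𝓝 0, u x ≤ u (x + t • v) := hcont.eventually hmin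
    filter_upwards [h3] with t ht; simpa [hg] using ht
  have hg0 : deriv g 0 = 0 := hgmin.deriv_eq_zero
  have hdd : DifferentiableAt ℝ (deriv g) 0 := by
    by_contra h; rw [deriv_zero_of_not_differentiableAt h] at h2; linarith
  have hgd : ∀ᶠ t in 𝓝 (0:ℝ), DifferentiableAt ℝ g t := by
    have hev : ∀ᶠ y in 𝓝 x, ContDiffAt ℝ 2 u y := hu.eventually (by simp)
    filter_upwards [hcont.eventually hev] with t ht
    exact (ht.differentiableAt (by simp)).comp t (by fun_prop)
  set h : ℝ → ℝ := fun t => g t + (-c/4) * t^2 with hh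
  have hdh : deriv h =ᶠ[𝓝 0] fun t => deriv g t + (-c/2) * t := by
    filter_upwards [hgd] with t ht
    have := ht.hasDerivAt.fun_add ((hasDerivAt_pow 2 t).const_mul (-c/4))
    rw [hh, this.deriv]; simp; ring
  have hddh : deriv (deriv h) 0 = c / 2 := by
    rw [hdh.deriv_eq]
    have := (hdd.hasDerivAt.add ((hasDerivAt_id (0:ℝ)).const_mul (-c/2))).deriv
    rw [h2] at this
    refine Eq.trans this ?_; ring
  have hmax : IsLocalMax h 0 := by
    apply isLocalMax_of_deriv_deriv_neg
    · rw [hddh]; linarith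
    · rw [hdh.eq_of_nhds, hg0]; simp
    · have := hgd.self_of_nhds.continuousAt
      exact this.add (by fun_prop)
  have := (hmax.and hgmin)
  obtain ⟨ε, hε, hb⟩ := Metric.eventually_nhds_iff.1 this
  have := hb (y := ε/2) (by rw [Real.dist_eq, sub_zero, abs_of_pos (by positivity)]; linarith)
  obtain ⟨a1, a2⟩ := this
  simp only [hh] at a1
  have : 0 < (-c/4) * (ε/2)^2 := by apply mul_pos; linarith; positivity
  norm_num at a1; norm_num at this; linarith

lemma lap_exp {g : EuclN N → ℝ} (hg : ContDiff ℝ 2 g) (x : EuclN N) :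
    lap (fun y => Real.exp (g y)) x = Real.exp (g x) * (∑ i, (fderiv ℝ g x (eb i))^2 + lap g x) := by
  have hE : ContDiff ℝ 2 (fun y => Real.exp (g y)) := hg.exp
  have hd : Differentiable ℝ g := hg.differentiable (by simp)
  rw [lap_eq, lap_eq, ← Finset.sum_add_distrib, Finset.mul_sum]
  refine Finset.sum_congr rfl fun i _ => ?_
  rw [← fderiv_fderiv_apply hE.contDiffAt, ← fderiv_fderiv_apply hg.contDiffAt]
  have h1 : (fun y => fderiv ℝ (fun y => Real.exp (g y)) y (eb i)) =
      fun y => Real.exp (g y) * fderiv ℝ g y (eb i) := by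
    ext y; rw [fderiv_exp (hd y)]; simp
  have hd2 : DifferentiableAt ℝ (fun y => fderiv ℝ g y (eb i)) x :=
    ((hg.fderiv_right (m := 1) (by norm_num)).clm_apply contDiff_const).differentiable (by simp) x
  rw [h1, fderiv_fun_mul (hd x).exp hd2, fderiv_exp (hd x)]
  simp; ring

lemma sum_inner_eb_sq (y : EuclN N) : ∑ i, ⟪y, eb i⟫^2 = ‖y‖^2 := by
  rw [EuclideanSpace.norm_sq_eq]
  refine Finset.sum_congr rfl fun i _ => ?_
  simp [EuclideanSpace.inner_single_right]

lemma lap_exp_sq (k : ℝ) (y x : EuclN N) :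
    lap (fun z => Real.exp (k * ‖z - y‖^2)) x =
      Real.exp (k * ‖x - y‖^2) * (4 * k^2 * ‖x - y‖^2 + 2 * k * N) := by
  have hg : ContDiff ℝ 2 (fun z : EuclN N => k * ‖z - y‖^2) := by
    apply contDiff_const.mul
    exact (contDiff_id.sub contDiff_const).norm_sq ℝ
  have hf : ∀ z v : EuclN N, fderiv ℝ (fun z : EuclN N => k * ‖z - y‖^2) z v = 2 * k * ⟪z - y, v⟫ := by
    intro z v
    have h1 : HasFDerivAt (fun z : EuclN N => z - y) (ContinuousLinearMap.id ℝ _) z :=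
      (hasFDerivAt_id z).sub_const y
    have := (h1.norm_sq.const_mul k).fderiv
    rw [this]; simp [inner_sub_left]; ring
  rw [lap_exp hg, lap_eq]
  congr 2
  · simp_rw [hf]
    simp_rw [mul_pow]; rw [← Finset.mul_sum, sum_inner_eb_sq]; ring
  · have : ∀ i : Fin N, fderiv ℝ (fderiv ℝ (fun z : EuclN N => k * ‖z - y‖^2)) x (eb i) (eb i) = 2 * k := by
      intro i
      rw [← fderiv_fderiv_apply hg.contDiffAt]
      simp_rw [hf]
      have h1 : HasFDerivAt (fun z : EuclN N => 2 * k * ⟪z - y, eb i⟫)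
          ((2 * k) • (innerSL ℝ (eb i))) x := by
        have : HasFDerivAt (fun z : EuclN N => ⟪z - y, eb i⟫) (innerSL ℝ (eb i)) x := by
          have h2 : (fun z : EuclN N => ⟪z - y, eb i⟫) = fun z => innerSL ℝ (eb i) z - ⟪y, eb i⟫ := by
            ext z; rw [inner_sub_left, innerSL_apply_apply, real_inner_comm]
          rw [h2]
          exact (innerSL ℝ (eb i)).hasFDerivAt.sub_const _
        exact this.const_mul (2 * k)
      rw [h1.fderiv]; simp
    simp [this]; ring

lemma lap_exp_inner (k : ℝ) (e x : EuclN N) (he : ‖e‖ = 1) :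
    lap (fun z => Real.exp (k * ⟪z, e⟫)) x = Real.exp (k * ⟪x, e⟫) * k^2 := by
  have hg : ContDiff ℝ 2 (fun z : EuclN N => k * ⟪z, e⟫) :=
    contDiff_const.mul (contDiff_id.inner ℝ contDiff_const)
  have hf : ∀ z v : EuclN N, fderiv ℝ (fun z : EuclN N => k * ⟪z, e⟫) z v = k * ⟪e, v⟫ := by
    intro z v
    have h2 : (fun z : EuclN N => ⟪z, e⟫) = fun z => innerSL ℝ e z := by
      ext z; rw [innerSL_apply_apply, real_inner_comm]
    have : HasFDerivAt (fun z : EuclN N => ⟪z, e⟫) (innerSL ℝ e) z := by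
      rw [h2]; exact (innerSL ℝ e).hasFDerivAt
    rw [(this.const_mul k).fderiv]; simp
  rw [lap_exp hg, lap_eq]
  have : ∀ i : Fin N, fderiv ℝ (fderiv ℝ (fun z : EuclN N => k * ⟪z, e⟫)) x (eb i) (eb i) = 0 := by
    intro i
    rw [← fderiv_fderiv_apply hg.contDiffAt]
    simp_rw [hf]; simp
  simp_rw [this, hf, mul_pow]
  rw [← Finset.mul_sum, sum_inner_eb_sq, he]; simp

/-- integration by parts -/
lemma inner_grad_eq {u v : EuclN N → ℝ} (x : EuclN N) :
    ⟪gradient u x, gradient v x⟫ = ∑ i, fderiv ℝ u x (eb i) * fderiv ℝ v x (eb i) := by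
  rw [← (EuclideanSpace.basisFun (Fin N) ℝ).sum_inner_mul_inner]
  refine Finset.sum_congr rfl fun i _ => ?_
  rw [real_inner_comm (gradient v x) (EuclideanSpace.basisFun (Fin N) ℝ i)]
  simp [gradient, InnerProductSpace.toDual_symm_apply]


lemma ibp {O : Set (EuclN N)} (hO : IsOpen O) {V φ : EuclN N → ℝ} (hV : ContDiffOn ℝ 2 V O)
    (hφ : ContDiff ℝ 1 φ) (hc : HasCompactSupport φ) (hs : tsupport φ ⊆ O) :
    ∫ x, ⟪gradient V x, gradient φ x⟫ = ∫ x, (- lap V x) * φ x := by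
  have hVat : ∀ x ∈ O, ContDiffAt ℝ 2 V x := fun x hx => hV.contDiffAt (hO.mem_nhds hx)
  have hdV : ContDiffOn ℝ 1 (fderiv ℝ V) O := fun x hx =>
    ((hVat x hx).fderiv_right (m := 1) (by norm_num)).contDiffWithinAt
  have hddV : ContinuousOn (fderiv ℝ (fderiv ℝ V)) O := fun x hx =>
    (((hVat x hx).fderiv_right (m := 1) (by norm_num)).fderiv_right (m := 0) (by norm_num)).continuousAt.continuousWithinAt
  -- integrability helper
  have hint : ∀ F : EuclN N → ℝ, ContinuousOn F O → ∀ ψ : EuclN N → ℝ, Continuous ψ →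
      tsupport ψ ⊆ tsupport φ → Integrable (fun x => F x * ψ x) := by
    intro F hF ψ hψ hsup
    have hcψ : HasCompactSupport ψ := IsCompact.of_isClosed_subset hc (isClosed_tsupport _) hsup
    have hcont : Continuous (fun x => F x * ψ x) := by
      rw [continuous_iff_continuousAt]
      intro x
      by_cases hx : x ∈ tsupport ψ
      · exact ((hF.continuousAt (hO.mem_nhds (hs (hsup hx)))).mul hψ.continuousAt)
      · have : (fun x => F x * ψ x) =ᶠ[𝓝 x] fun _ => 0 := by
          filter_upwards [(isClosed_tsupport ψ).isOpen_compl.mem_nhds hx] with y hy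
          rw [image_eq_zero_of_notMem_tsupport hy, mul_zero]
        exact continuousAt_const.congr this.symm
    exact hcont.integrable_of_hasCompactSupport hcψ.mul_left
  have hφd : Differentiable ℝ φ := hφ.differentiable (by simp)
  have hφc : ∀ v : EuclN N, Continuous fun x => fderiv ℝ φ x v := fun v =>
    (hφ.continuous_fderiv (by simp)).clm_apply continuous_const
  have key : ∀ i : Fin N, ∫ x, fderiv ℝ V x (eb i) * fderiv ℝ φ x (eb i) =
      - ∫ x, fderiv ℝ (fun y => fderiv ℝ V y (eb i)) x (eb i) * φ x := by
    intro i
    have hF : ContinuousOn (fun x => fderiv ℝ V x (eb i)) O :=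
      hdV.continuousOn.clm_apply continuousOn_const
    have hF2 : ContinuousOn (fun x => fderiv ℝ (fun y => fderiv ℝ V y (eb i)) x (eb i)) O := by
      have h2 : ContinuousOn (fun x => fderiv ℝ (fderiv ℝ V) x (eb i) (eb i)) O :=
        (hddV.clm_apply continuousOn_const).clm_apply continuousOn_const
      exact h2.congr fun x hx => fderiv_fderiv_apply (hVat x hx) _ _
    apply integral_mul_fderiv_eq_neg_fderiv_mul_of_integrable
    · exact hint _ hF2 _ hφ.continuous le_rfl
    · exact hint _ hF _ (hφc _) (tsupport_fderiv_apply_subset ℝ _)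
    · exact hint _ hF _ hφ.continuous le_rfl
    · intro x hx
      exact (((hVat x (hs hx)).fderiv_right (m := 1) (by norm_num)).clm_apply contDiffAt_const).differentiableAt (by simp)
    · intro x _; exact hφd x
  have hi2 : ∀ i : Fin N, Integrable fun x => fderiv ℝ (fderiv ℝ V) x (eb i) (eb i) * φ x := fun i =>
    hint _ ((hddV.clm_apply continuousOn_const).clm_apply continuousOn_const) _ hφ.continuous le_rfl
  simp_rw [inner_grad_eq]
  rw [integral_finset_sum]
  · simp_rw [key, lap_eq, neg_mul, Finset.sum_mul]
    rw [integral_neg, integral_finset_sum _ (fun i _ => hi2 i), Finset.sum_neg_distrib]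
    congr 1
    refine Finset.sum_congr rfl fun i _ => integral_congr_ae (ae_of_all _ fun x => ?_)
    by_cases hx : x ∈ tsupport φ
    · simp only; rw [fderiv_fderiv_apply (hVat x (hs hx))]
    · simp [image_eq_zero_of_notMem_tsupport hx]
  · intro i _
    exact hint _ (hdV.continuousOn.clm_apply continuousOn_const) _ (hφc _) (tsupport_fderiv_apply_subset ℝ _)


/-- reflection as an isometry -/
noncomputable def sig (e : EuclN N) (he : ‖e‖ = 1) : EuclN N ≃ₗᵢ[ℝ] EuclN N where
  toFun x := reflPt e x
  invFun x := reflPt e x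
  map_add' x y := by simp only [reflPt, inner_add_left]; module
  map_smul' c x := by simp only [reflPt, inner_smul_left, RingHom.id_apply]; simp; module
  left_inv x := by
    simp only [reflPt, inner_sub_left, inner_smul_left, real_inner_self_eq_norm_sq, he]; simp; module
  right_inv x := by
    simp only [reflPt, inner_sub_left, inner_smul_left, real_inner_self_eq_norm_sq, he]; simp; module
  norm_map' x := by
    change ‖reflPt e x‖ = ‖x‖
    rw [← sq_eq_sq₀ (norm_nonneg _) (norm_nonneg _), reflPt, norm_sub_sq_real, norm_smul, he,
      inner_smul_right, mul_one, Real.norm_eq_abs, sq_abs]; ring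

lemma sig_apply (e : EuclN N) (he : ‖e‖ = 1) (x) : sig e he x = reflPt e x := rfl

lemma norm_refl {e : EuclN N} (he : ‖e‖ = 1) (x) : ‖reflPt e x‖ = ‖x‖ := (sig e he).norm_map x
lemma refl_refl {e : EuclN N} (he : ‖e‖ = 1) (x) : reflPt e (reflPt e x) = x := (sig e he).left_inv x
lemma inner_refl {e : EuclN N} (he : ‖e‖ = 1) (x) : ⟪reflPt e x, e⟫ = - ⟪x, e⟫ := by
  simp only [reflPt, inner_sub_left, inner_smul_left, real_inner_self_eq_norm_sq, he]; simp; ring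
lemma refl_neg (e : EuclN N) (x) : reflPt (-e) x = reflPt e x := by simp [reflPt]

lemma lap_refl (u : EuclN N → ℝ) {e : EuclN N} (he : ‖e‖ = 1) (x : EuclN N) :
    lap (fun y => u (reflPt e y)) x = lap u (reflPt e x) := lap_comp_isometry u (sig e he) x

/-- angular field -/
noncomputable def ang (e b : EuclN N) : EuclN N →L[ℝ] EuclN N :=
  (innerSL ℝ e).smulRight b - (innerSL ℝ b).smulRight e

lemma ang_apply (e b x : EuclN N) : ang e b x = ⟪e, x⟫ • b - ⟪b, x⟫ • e := by simp [ang]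

lemma sum_smul_eb (y : EuclN N) : ∑ i, ⟪y, eb i⟫ • eb i = y := by
  have := (EuclideanSpace.basisFun (Fin N) ℝ).sum_repr' y
  simp only [EuclideanSpace.basisFun_apply] at this
  conv_rhs => rw [← this]
  exact Finset.sum_congr rfl fun i _ => by rw [real_inner_comm]

lemma lap_ang {u : EuclN N → ℝ} {x : EuclN N} (hu : ContDiffAt ℝ 3 u x) (e b : EuclN N) :
    lap (fun y => fderiv ℝ u y (ang e b y)) x = fderiv ℝ (lap u) x (ang e b x) := by
  set A := ang e b with hA
  have hu1 : ContDiffAt ℝ 2 (fderiv ℝ u) x := hu.fderiv_right (by norm_num)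
  have hu2 : ContDiffAt ℝ 1 (fderiv ℝ (fderiv ℝ u)) x := hu1.fderiv_right (by norm_num)
  have hV : ContDiffAt ℝ 2 (fun y => fderiv ℝ u y (A y)) x := hu1.clm_apply A.contDiff.contDiffAt
  have ev3 : ∀ᶠ y in 𝓝 x, ContDiffAt ℝ 3 u y := hu.eventually (by simp)
  have dA : ∀ y, HasFDerivAt A A y := fun y => A.hasFDerivAt
  have hd1 : ∀ v, (fun y => fderiv ℝ (fun y => fderiv ℝ u y (A y)) y v) =ᶠ[𝓝 x]
      fun y => fderiv ℝ u y (A v) + fderiv ℝ (fderiv ℝ u) y v (A y) := by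
    intro v
    filter_upwards [ev3] with y hy
    have : DifferentiableAt ℝ (fderiv ℝ u) y := (hy.fderiv_right (m := 2) (by norm_num)).differentiableAt (by simp)
    rw [(this.hasFDerivAt.clm_apply (dA y)).fderiv]; simp
  set T := fderiv ℝ (fderiv ℝ (fderiv ℝ u)) x with hT
  have hd1' : DifferentiableAt ℝ (fderiv ℝ u) x := hu1.differentiableAt (by simp)
  have hd2' : DifferentiableAt ℝ (fderiv ℝ (fderiv ℝ u)) x := hu2.differentiableAt (by simp)
  have hd2 : ∀ v, fderiv ℝ (fun y => fderiv ℝ (fun y => fderiv ℝ u y (A y)) y v) x v =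
      2 * fderiv ℝ (fderiv ℝ u) x v (A v) + T v v (A x) := by
    intro v
    rw [(hd1 v).fderiv_eq]
    have h1 := hd1'.hasFDerivAt.clm_apply (hasFDerivAt_const (A v) x)
    have h2 := (hd2'.hasFDerivAt.clm_apply (hasFDerivAt_const v x)).clm_apply (dA x)
    rw [(h1.fun_add h2).fderiv]
    simp; ring
  have sym2 : ∀ᶠ y in 𝓝 x, ∀ v w, fderiv ℝ (fderiv ℝ u) y v w = fderiv ℝ (fderiv ℝ u) y w v := by
    filter_upwards [ev3] with y hy v w
    exact (hy.isSymmSndFDerivAt (by simp; norm_num)) v w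
  have symA : ∀ v w, T v w = T w v := fun v w => (hu1.isSymmSndFDerivAt (by simp)) v w
  have hT3 : ∀ a v w, fderiv ℝ (fun y => fderiv ℝ (fderiv ℝ u) y v w) x a = T a v w := by
    intro a v w
    have h2 := (hd2'.hasFDerivAt.clm_apply (hasFDerivAt_const v x)).clm_apply (hasFDerivAt_const w x)
    rw [h2.fderiv]; simp [hT]
  have symB : ∀ a v w, T a v w = T a w v := by
    intro a v w
    rw [← hT3, ← hT3]
    have : (fun y => fderiv ℝ (fderiv ℝ u) y v w) =ᶠ[𝓝 x] fun y => fderiv ℝ (fderiv ℝ u) y w v := by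
      filter_upwards [sym2] with y hy using hy v w
    rw [this.fderiv_eq]
  have hlap : fderiv ℝ (lap u) x (A x) = ∑ i, T (A x) (eb i) (eb i) := by
    have : lap u = fun y => ∑ i, fderiv ℝ (fderiv ℝ u) y (eb i) (eb i) := by ext y; exact lap_eq u y
    rw [this, fderiv_fun_sum]
    · simp [hT3]
    · intro i _
      exact (hd2'.clm_apply (differentiableAt_const _)).clm_apply (differentiableAt_const _)
  rw [hlap, lap_eq]
  have h0 : ∑ i, fderiv ℝ (fderiv ℝ u) x (eb i) (A (eb i)) = 0 := by
    have : ∀ i : Fin N, fderiv ℝ (fderiv ℝ u) x (eb i) (A (eb i)) =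
      fderiv ℝ (fderiv ℝ u) x (⟪e, eb i⟫ • eb i) b - fderiv ℝ (fderiv ℝ u) x (⟪b, eb i⟫ • eb i) e := by
      intro i; simp only [hA, ang_apply, map_sub, map_smul, ContinuousLinearMap.smul_apply]
    simp_rw [this]
    rw [Finset.sum_sub_distrib, ← ContinuousLinearMap.sum_apply, ← ContinuousLinearMap.sum_apply,
      ← map_sum, ← map_sum, sum_smul_eb, sum_smul_eb, sym2.self_of_nhds, sub_self]
  have : ∀ i : Fin N, fderiv ℝ (fderiv ℝ (fun y => fderiv ℝ u y (A y))) x (eb i) (eb i) =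
      2 * fderiv ℝ (fderiv ℝ u) x (eb i) (A (eb i)) + T (A x) (eb i) (eb i) := by
    intro i
    rw [← fderiv_fderiv_apply hV, hd2, symB, symA]
  simp_rw [this]
  rw [Finset.sum_add_distrib, ← Finset.mul_sum, h0]; simp

end LapC

/-! ### Maximum principles -/
namespace MP
variable {N : ℕ}
open Filter Topology LapC

lemma hopf {O : Set (EuclN N)} (hO : IsOpen O) (hc : IsPreconnected O) {w : EuclN N → ℝ}
    (hw : ContDiffOn ℝ 2 w O) {L : ℝ} (hL : 0 ≤ L) (hlap : ∀ x ∈ O, 0 < w x → lap w x ≤ L * w x)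
    (hpos : ∃ y ∈ O, 0 < w y) (hneg : ∃ z ∈ O, w z ≤ 0) :
    ∃ x₀ ∈ O, w x₀ = 0 ∧ fderiv ℝ w x₀ ≠ 0 := by
  set P : Set (EuclN N) := O ∩ {x | 0 < w x} with hP
  have hPo : IsOpen P := hw.continuousOn.isOpen_inter_preimage hO isOpen_Ioi
  obtain ⟨x1, hx1O, hx1c, hx1P⟩ : ∃ x1 ∈ O, x1 ∈ closure P ∧ x1 ∉ P := by
    by_contra hcon
    push Not at hcon
    have : O ⊆ P := hc.subset_of_closure_inter_subset hPo
      (by obtain ⟨y, hy, h⟩ := hpos; exact ⟨y, hy, hy, h⟩) (fun x hx => hcon x hx.2 hx.1)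
    obtain ⟨z, hz, h⟩ := hneg
    exact absurd (this hz).2 (not_lt.2 h)
  obtain ⟨r, hr, hball⟩ := Metric.isOpen_iff.1 hO x1 hx1O
  obtain ⟨y, hyP, hy⟩ := Metric.mem_closure_iff.1 hx1c (r/3) (by positivity)
  set Z := Metric.closedBall x1 (2*r/3) ∩ {x | w x ≤ 0} with hZ
  have hcb : Metric.closedBall x1 (2*r/3) ⊆ O := (Metric.closedBall_subset_ball (by linarith)).trans hball
  have hZc : IsCompact Z := by
    apply (isCompact_closedBall x1 (2*r/3)).of_isClosed_subset _ inter_subset_left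
    exact (hw.continuousOn.mono hcb).preimage_isClosed_of_isClosed Metric.isClosed_closedBall isClosed_Iic
  have hx1w : w x1 ≤ 0 := by
    by_contra h; exact hx1P ⟨hx1O, not_le.1 h⟩
  have hx1Z : x1 ∈ Z := ⟨Metric.mem_closedBall_self (by positivity), hx1w⟩
  obtain ⟨x0, hx0Z, hmin⟩ := hZc.exists_isMinOn ⟨x1, hx1Z⟩
    (f := fun z => dist z y) (by fun_prop)
  set ρ := dist x0 y with hρ
  have hρr : ρ < r/3 := lt_of_le_of_lt (hmin hx1Z) hy
  have hyZ : y ∉ Z := fun h => absurd (show w y ≤ 0 from h.2) (not_le.2 hyP.2)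
  have hρ0 : 0 < ρ := dist_pos.2 (fun h => hyZ (h ▸ hx0Z))
  have hsub : Metric.closedBall y ρ ⊆ Metric.closedBall x1 (2*r/3) := by
    intro z hz
    have h1 := Metric.mem_closedBall.1 hz
    have := dist_triangle z y x1
    rw [dist_comm y x1] at this
    exact Metric.mem_closedBall.2 (by linarith)
  have hwpos : ∀ z, dist z y < ρ → 0 < w z := by
    intro z hz
    by_contra h
    have : z ∈ Z := ⟨hsub (Metric.mem_closedBall.2 hz.le), not_lt.1 h⟩
    exact absurd (hmin this) (not_le.2 hz)
  have hx0O : x0 ∈ O := hcb hx0Z.1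
  have hwnn : ∀ z ∈ Metric.closedBall y ρ, 0 ≤ w z := by
    intro z hz
    have hz2 : z ∈ closure (Metric.ball y ρ) := by rwa [closure_ball y hρ0.ne']
    have hcz : ContinuousWithinAt w (Metric.ball y ρ) z :=
      ((hw.continuousOn.continuousAt (hO.mem_nhds (hcb (hsub hz))))).continuousWithinAt
    have := hcz.mem_closure (t := Ici 0) hz2 (fun t ht => (hwpos t ht).le)
    simpa using this
  have hw0 : w x0 = 0 := le_antisymm hx0Z.2 (hwnn x0 (Metric.mem_closedBall.2 le_rfl))
  refine ⟨x0, hx0O, hw0, ?_⟩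
  intro hD
  -- barrier
  obtain ⟨k, hk0, hk⟩ : ∃ k : ℝ, 0 < k ∧ L < k^2 * ρ^2 - 2 * k * N := by
    refine ⟨(L + 1 + 2 * N) / ρ^2 + 1, by positivity, ?_⟩
    have h1 : ((L + 1 + 2 * N) / ρ^2 + 1)^2 * ρ^2 - 2 * ((L + 1 + 2 * N) / ρ^2 + 1) * N
      = ((L + 1 + 2 * N) / ρ^2 + 1) * (L + 1 + ρ^2) := by field_simp; ring
    rw [h1]
    have : 0 ≤ (L + 1 + 2 * N) / ρ^2 := by positivity
    nlinarith [sq_nonneg ρ]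
  set h : EuclN N → ℝ := fun x => Real.exp (-k * ‖x - y‖^2) - Real.exp (-k * ρ^2) with hh
  have hE : ContDiff ℝ 2 (fun x : EuclN N => Real.exp (-k * ‖x - y‖^2)) := by
    apply ContDiff.exp; apply contDiff_const.mul
    exact (contDiff_id.sub contDiff_const).norm_sq ℝ
  have hhC : ContDiff ℝ 2 h := hE.sub contDiff_const
  have hhlap : ∀ x, ρ/2 ≤ ‖x - y‖ → L * h x < lap h x := by
    intro x hx
    have h1 : lap h x = Real.exp (-k * ‖x - y‖^2) * (4 * (-k)^2 * ‖x - y‖^2 + 2 * (-k) * N) := by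
      rw [hh, lap_sub hE.contDiffAt contDiffAt_const, lap_exp_sq, lap_const, sub_zero]
    rw [h1]
    have h2 : L < 4 * (-k)^2 * ‖x - y‖^2 + 2 * (-k) * N := by
      have : ρ^2 ≤ 4 * ‖x-y‖^2 := by nlinarith
      nlinarith [mul_le_mul_of_nonneg_left this (sq_nonneg k)]
    have h3 : h x ≤ Real.exp (-k * ‖x - y‖^2) := by simp only [hh]; linarith [Real.exp_pos (-k * ρ^2)]
    have := mul_lt_mul_of_pos_left h2 (Real.exp_pos (-k * ‖x - y‖^2))
    nlinarith [mul_le_mul_of_nonneg_left h3 hL]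
  have hh1 : ∀ x, h x ≤ 1 := by
    intro x
    have : Real.exp (-k * ‖x - y‖^2) ≤ 1 := Real.exp_le_one_iff.2 (by nlinarith [sq_nonneg ‖x-y‖])
    simp only [hh]; linarith [Real.exp_pos (-k * ρ^2)]
  have hcont : ContinuousOn w (Metric.closedBall y ρ) := hw.continuousOn.mono (hsub.trans hcb)
  -- inner bound
  obtain ⟨ε, hε, hεc⟩ : ∃ ε > 0, ∀ x ∈ Metric.closedBall y (ρ/2), ε < w x := by
    have hne : (Metric.closedBall y (ρ/2)).Nonempty := ⟨y, Metric.mem_closedBall_self (by positivity)⟩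
    obtain ⟨z, hz, hzm⟩ := (isCompact_closedBall y (ρ/2)).exists_isMinOn hne
      (hcont.mono (Metric.closedBall_subset_closedBall (by linarith)))
    have h1 : 0 < w z := hwpos z (by have := Metric.mem_closedBall.1 hz; linarith)
    exact ⟨w z / 2, by positivity, fun x hx => by have : w z ≤ w x := hzm hx; linarith⟩
  have hv : ∀ x ∈ Metric.closedBall y ρ, ρ/2 ≤ ‖x - y‖ → ε * h x ≤ w x := by
    set K := Metric.closedBall y ρ ∩ {x | ρ/2 ≤ ‖x - y‖} with hK
    have hKc : IsCompact K := (isCompact_closedBall y ρ).inter_right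
      (isClosed_le continuous_const (by fun_prop))
    by_contra hcon
    push Not at hcon
    obtain ⟨z, hz1, hz2, hz3⟩ := hcon
    obtain ⟨x, hxK, hxm⟩ := hKc.exists_isMinOn ⟨z, hz1, hz2⟩ (f := fun x => w x - ε * h x)
      ((hcont.mono inter_subset_left).sub (continuousOn_const.mul hhC.continuous.continuousOn))
    have hvx : w x - ε * h x < 0 := lt_of_le_of_lt (hxm (⟨hz1, hz2⟩ : z ∈ K)) (by linarith)
    have hne1 : ρ/2 < ‖x - y‖ := by
      refine lt_of_le_of_ne hxK.2 fun heq => ?_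
      have := hεc x (by rw [Metric.mem_closedBall, dist_eq_norm, heq])
      nlinarith [hh1 x]
    have hne2 : ‖x - y‖ < ρ := by
      refine lt_of_le_of_ne (by simpa [dist_eq_norm] using hxK.1) fun heq => ?_
      have h1 := hwnn x hxK.1
      simp only [hh, heq] at hvx
      simp at hvx; linarith
    have hxO : x ∈ O := hcb (hsub hxK.1)
    have hloc : IsLocalMin (fun x => w x - ε * h x) x := by
      have : K ∈ 𝓝 x := by
        have hop : IsOpen {x : EuclN N | ρ/2 < ‖x - y‖ ∧ ‖x - y‖ < ρ} :=
          (isOpen_lt continuous_const (by fun_prop : Continuous fun x : EuclN N => ‖x - y‖)).inter (isOpen_lt (by fun_prop : Continuous fun x : EuclN N => ‖x - y‖) continuous_const)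
        refine Filter.mem_of_superset (hop.mem_nhds ⟨hne1, hne2⟩) ?_
        rintro t ⟨h1, h2⟩
        exact ⟨by rw [Metric.mem_closedBall, dist_eq_norm]; exact h2.le, h1.le⟩
      exact hxm.isLocalMin this
    have hwx := hw.contDiffAt (hO.mem_nhds hxO)
    have hεh : ContDiffAt ℝ 2 (fun x => ε * h x) x := (contDiff_const.mul hhC).contDiffAt
    have h1 := lap_nonneg_of_isLocalMin (hwx.sub hεh) hloc
    rw [lap_sub hwx hεh, lap_smul ε hhC.contDiffAt] at h1
    have h2 := hlap x hxO (hwpos x (by rw [dist_eq_norm]; exact hne2))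
    have h3 := hhlap x hne1.le
    nlinarith [mul_lt_mul_of_pos_left h3 hε]
  -- derivative along segment
  set γ : ℝ → EuclN N := fun t => x0 + t • (y - x0) with hγ
  have hγd : HasDerivAt γ (y - x0) 0 := by
    have := ((hasDerivAt_id (0:ℝ)).smul_const (y - x0)).const_add x0
    rw [one_smul] at this; exact this
  have hγn : ∀ t, 0 ≤ t → t ≤ 1 → ‖γ t - y‖ = (1 - t) * ρ := by
    intro t h0 h1
    have : γ t - y = (1 - t) • (x0 - y) := by simp only [hγ]; module
    rw [this, norm_smul, Real.norm_of_nonneg (by linarith), hρ, dist_eq_norm]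
  have hwd : HasDerivAt (fun t => w (γ t)) 0 0 := by
    have h1 : HasFDerivAt w (fderiv ℝ w x0) (γ 0) := by
      have : γ 0 = x0 := by simp [hγ]
      rw [this]
      exact ((hw.contDiffAt (hO.mem_nhds hx0O)).differentiableAt (by simp)).hasFDerivAt
    have := h1.comp_hasDerivAt 0 hγd
    rwa [hD, ContinuousLinearMap.zero_apply] at this
  have hbd : HasDerivAt (fun t : ℝ => ε * (Real.exp (-k * ((1 - t) * ρ)^2) - Real.exp (-k * ρ^2)))
      (ε * (Real.exp (-k * ρ^2) * (2 * k * ρ^2))) 0 := by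
    have h1 : HasDerivAt (fun t : ℝ => -k * ((1 - t) * ρ)^2) (2 * k * ρ^2) 0 := by
      have := ((((hasDerivAt_id (0:ℝ)).const_sub 1).mul_const ρ).pow 2).const_mul (-k)
      refine (this.congr_deriv ?_)
      simp; ring
    have := ((h1.exp.sub_const (Real.exp (-k * ρ^2))).const_mul ε)
    simpa using this
  have hdiff := hwd.sub hbd
  have hlim := hdiff.tendsto_slope_zero_right
  have : (0:ℝ) ≤ 0 - (ε * (Real.exp (-k * ρ^2) * (2 * k * ρ^2))) := by
    refine ge_of_tendsto hlim ?_
    have h12 : Ioo (0:ℝ) (1/2) ∈ 𝓝[>] (0:ℝ) := Ioo_mem_nhdsGT (by norm_num)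
    filter_upwards [h12] with t ht
    have hn := hγn t ht.1.le (by linarith [ht.2])
    have h1 := hv (γ t) (by rw [Metric.mem_closedBall, dist_eq_norm, hn]; nlinarith [ht.1])
      (by rw [hn]; nlinarith [ht.2])
    simp only [hh, hn] at h1
    have hg0 : γ 0 = x0 := by simp [hγ]
    simp only [Pi.sub_apply, zero_add, hg0, hw0, smul_eq_mul]
    have h0 : ε * (Real.exp (-k * ((1 - 0) * ρ)^2) - Real.exp (-k * ρ^2)) = 0 := by simp
    rw [h0]
    have := inv_pos.2 ht.1
    apply mul_nonneg this.le
    linarith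
  have : 0 < ε * (Real.exp (-k * ρ^2) * (2 * k * ρ^2)) := by positivity
  linarith

lemma smp {O : Set (EuclN N)} (hO : IsOpen O) (hc : IsPreconnected O) {w : EuclN N → ℝ}
    (hw : ContDiffOn ℝ 2 w O) {L : ℝ} (hL : 0 ≤ L) (h0 : ∀ x ∈ O, 0 ≤ w x)
    (hlap : ∀ x ∈ O, lap w x ≤ L * w x) : (∀ x ∈ O, w x = 0) ∨ ∀ x ∈ O, 0 < w x := by
  by_contra hcon
  push Not at hcon
  obtain ⟨⟨y, hy, hy2⟩, z, hz, hz2⟩ := hcon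
  obtain ⟨x0, hx0, h1, h2⟩ := hopf hO hc hw hL (fun x hx _ => hlap x hx)
    ⟨y, hy, lt_of_le_of_ne (h0 y hy) hy2.symm⟩ ⟨z, hz, hz2⟩
  refine h2 (IsLocalMin.fderiv_eq_zero ?_)
  filter_upwards [hO.mem_nhds hx0] with t ht
  rw [h1]; exact h0 t ht

lemma smp_sys {m : ℕ} {O : Set (EuclN N)} (hO : IsOpen O) (hc : IsPreconnected O)
    {V : Fin m → EuclN N → ℝ}
    (hw : ∀ i, ContDiffOn ℝ 2 (V i) O) {L : ℝ} (hL : 0 ≤ L) (h0 : ∀ i, ∀ x ∈ O, 0 ≤ V i x)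
    (hlap : ∀ i, ∀ x ∈ O, lap (V i) x ≤ L * V i x)
    (hcoup : ∀ I J : Finset (Fin m), I.Nonempty → J.Nonempty → Disjoint I J → I ∪ J = Finset.univ →
      ∃ i ∈ I, ∃ j ∈ J, ¬ ((∀ x ∈ O, V i x = 0) ∧ ∀ x ∈ O, 0 < V j x)) :
    (∀ i, ∀ x ∈ O, V i x = 0) ∨ ∀ i, ∀ x ∈ O, 0 < V i x := by
  classical
  have hs := fun i => smp hO hc (hw i) hL (h0 i) (hlap i)
  by_contra hcon
  push Not at hcon
  obtain ⟨⟨i1, y, hy, hy2⟩, i2, z, hz, hz2⟩ := hcon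
  obtain ⟨i, hi, j, hj, hn⟩ := hcoup (Finset.univ.filter fun i => ∀ x ∈ O, V i x = 0)
    (Finset.univ.filter fun i => ¬ ∀ x ∈ O, V i x = 0)
    ⟨i2, by
      simp only [Finset.mem_filter, Finset.mem_univ, true_and]
      exact (hs i2).resolve_right (fun h => absurd (h z hz) (not_lt.2 hz2))⟩
    ⟨i1, by
      simp only [Finset.mem_filter, Finset.mem_univ, true_and]
      exact fun h => hy2 (h y hy)⟩
    (Finset.disjoint_filter_filter_not _ _ _) (Finset.filter_union_filter_not_eq _ _)
  simp only [Finset.mem_filter, Finset.mem_univ, true_and] at hi hj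
  exact hn ⟨hi, (hs j).resolve_left hj⟩

/-- open half annulus -/
def HD (a R : ℝ) (e : EuclN N) : Set (EuclN N) := {x | a < ‖x‖ ∧ ‖x‖ < R ∧ 0 < ⟪x, e⟫}
/-- closed half annulus -/
def HB (a R : ℝ) (e : EuclN N) : Set (EuclN N) := {x | a ≤ ‖x‖ ∧ ‖x‖ ≤ R ∧ 0 ≤ ⟪x, e⟫}
/-- core -/
def KD (a R δ : ℝ) (e : EuclN N) : Set (EuclN N) := {x | a + δ ≤ ‖x‖ ∧ ‖x‖ ≤ R - δ ∧ δ ≤ ⟪x, e⟫}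

lemma HD_open (a R : ℝ) (e : EuclN N) : IsOpen (HD a R e) :=
  (isOpen_lt continuous_const continuous_norm).inter
    ((isOpen_lt continuous_norm continuous_const).inter
    (isOpen_lt continuous_const (by fun_prop : Continuous fun x : EuclN N => ⟪x, e⟫)))

lemma HB_compact (a R : ℝ) (e : EuclN N) : IsCompact (HB a R e) := by
  have hcl : IsClosed (HB a R e) := (isClosed_le continuous_const continuous_norm).inter
    ((isClosed_le continuous_norm continuous_const).inter
    (isClosed_le continuous_const (by fun_prop : Continuous fun x : EuclN N => ⟪x, e⟫)))
  exact (isCompact_closedBall 0 R).of_isClosed_subset hcl (fun x hx => by simpa using hx.2.1)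

lemma HD_sub_HB (a R : ℝ) (e : EuclN N) : HD a R e ⊆ HB a R e :=
  fun _ hx => ⟨hx.1.le, hx.2.1.le, hx.2.2.le⟩

lemma HD_preconnected {a R : ℝ} (ha : 0 ≤ a) (e : EuclN N) : IsPreconnected (HD a R e) := by
  have h1 : IsPreconnected ({x : EuclN N | 0 < ⟪x, e⟫} ×ˢ Ioo a R) := by
    apply Convex.isPreconnected
    apply Convex.prod _ (convex_Ioo a R)
    intro x hx y hy s t hs ht hst
    simp only [mem_setOf_eq] at hx hy ⊢
    rw [inner_add_left, inner_smul_left, inner_smul_left]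
    simp only [conj_trivial]
    rcases hs.eq_or_lt with h | h
    · subst h; simp at hst; subst hst; simpa using hy
    · have := mul_pos h hx; have := mul_nonneg ht hy.le; linarith
  have hne : ∀ x : EuclN N, 0 < ⟪x, e⟫ → x ≠ 0 := by rintro x h rfl; simp at h
  have h2 := h1.image (fun p : EuclN N × ℝ => (p.2 / ‖p.1‖) • p.1) (by
    refine ContinuousOn.fun_smul (f := fun p : EuclN N × ℝ => p.2 / ‖p.1‖) (g := fun p : EuclN N × ℝ => p.1) ?_ continuousOn_fst
    apply continuousOn_snd.div continuous_fst.norm.continuousOn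
    intro p hp; exact norm_ne_zero_iff.2 (hne _ hp.1))
  convert h2 using 1
  ext x
  constructor
  · intro hx
    have hn := norm_pos_iff.2 (hne x hx.2.2)
    exact ⟨(x, ‖x‖), ⟨hx.2.2, hx.1, hx.2.1⟩, by simp [div_self hn.ne']⟩
  · rintro ⟨⟨z, ρ⟩, ⟨hz, hρ1, hρ2⟩, rfl⟩
    have hn := norm_pos_iff.2 (hne z hz)
    have hρ : 0 < ρ := lt_of_le_of_lt ha hρ1
    have : ‖(ρ / ‖z‖) • z‖ = ρ := by
      rw [norm_smul, norm_div, norm_norm, Real.norm_of_nonneg hρ.le]; field_simp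
    refine ⟨by simpa only [this] using hρ1, by simpa only [this] using hρ2, ?_⟩
    simp only [inner_smul_left, conj_trivial]
    exact mul_pos (div_pos hρ hn) hz

set_option maxHeartbeats 800000 in
lemma narrow {a R : ℝ} (ha : 0 ≤ a) (haR : a < R) {L : ℝ} (hL : 0 ≤ L) :
    ∃ δ > 0, ∀ e : EuclN N, ‖e‖ = 1 → ∃ h : EuclN N → ℝ, ContDiff ℝ 2 h ∧
      (∀ x ∈ HB a R e, 1 ≤ h x) ∧ ∀ x ∈ HD a R e, x ∉ KD a R δ e → L * h x < - lap h x := by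
  have hR : 0 < R := by linarith
  set M := (4 * L + 1) * Real.exp 1 with hM
  have hM0 : 0 < M := by positivity
  obtain ⟨k, hk1, hkM, hkR, hka⟩ : ∃ k : ℝ, 1 ≤ k ∧ M ≤ k ∧ M / R^2 ≤ k ∧ (M + 2 * N) / (4 * a^2) ≤ k :=
    by
      have z1 : 0 ≤ M / R^2 := by positivity
      have z2 : 0 ≤ (M + 2 * N) / (4 * a^2) := by positivity
      exact ⟨1 + M + M / R^2 + (M + 2 * N) / (4 * a^2), by linarith, by linarith, by linarith, by linarith⟩
  have hk0 : 0 < k := by linarith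
  have e1 : M ≤ k^2 := by nlinarith
  have e2 : M ≤ k^2 * R^2 := by
    rw [div_le_iff₀ (by positivity)] at hkR
    nlinarith [sq_nonneg R, mul_nonneg (sub_nonneg.2 hk1) (mul_nonneg hk0.le (sq_nonneg R))]
  have e3 : 0 < a → M ≤ 4 * k^2 * a^2 - 2 * k * N := by
    intro ha
    rw [div_le_iff₀ (by positivity)] at hka
    have : M ≤ k * 4 * a^2 - 2 * N := by linarith
    nlinarith
  set δ := min (R/2) (min (1/k) (min (1/(2*R*k)) (1/(k*(2*a+R))))) with hδ
  have hδ0 : 0 < δ := by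
    refine lt_min (by positivity) (lt_min (by positivity) (lt_min (by positivity) (by positivity)))
  have d1 : δ ≤ R/2 := min_le_left _ _
  have d2 : k * δ ≤ 1 := by
    have : δ ≤ 1/k := (min_le_right _ _).trans (min_le_left _ _)
    rw [le_div_iff₀ hk0] at this; linarith
  have d3 : k * (2 * R * δ) ≤ 1 := by
    have : δ ≤ 1/(2*R*k) := (min_le_right _ _).trans ((min_le_right _ _).trans (min_le_left _ _))
    rw [le_div_iff₀ (by positivity)] at this; linarith
  have d4 : k * (2 * a * δ + δ^2) ≤ 1 := by
    have : δ ≤ 1/(k*(2*a+R)) := (min_le_right _ _).trans ((min_le_right _ _).trans (min_le_right _ _))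
    rw [le_div_iff₀ (by positivity)] at this
    have : k * δ * δ ≤ k * δ * R := by gcongr; linarith
    nlinarith
  refine ⟨δ, hδ0, fun e he => ?_⟩
  classical
  set c : ℝ := if 0 < a then 1 else 0 with hc
  have hc0 : 0 ≤ c := by rw [hc]; split_ifs <;> norm_num
  have hc1 : c ≤ 1 := by rw [hc]; split_ifs <;> norm_num
  set E1 : EuclN N → ℝ := fun x => Real.exp (-k * ⟪x, e⟫) with hE1
  set E2 : EuclN N → ℝ := fun x => Real.exp (k * ‖x - 0‖^2) with hE2
  set E3 : EuclN N → ℝ := fun x => Real.exp (-k * ‖x - 0‖^2) with hE3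
  have C1 : ContDiff ℝ 2 E1 := (contDiff_const.mul (contDiff_id.inner ℝ contDiff_const)).exp
  have C2 : ContDiff ℝ 2 E2 := (contDiff_const.mul ((contDiff_id.sub contDiff_const).norm_sq ℝ)).exp
  have C3 : ContDiff ℝ 2 E3 := (contDiff_const.mul ((contDiff_id.sub contDiff_const).norm_sq ℝ)).exp
  set A := Real.exp (-k * R^2) with hA
  set B := c * Real.exp (k * a^2) with hB
  set h : EuclN N → ℝ := fun x => 4 - E1 x - A * E2 x - B * E3 x with hh
  have hlap : ∀ x, - lap h x = E1 x * k^2 + A * (E2 x * (4 * k^2 * ‖x‖^2 + 2 * k * N)) +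
      B * (E3 x * (4 * k^2 * ‖x‖^2 - 2 * k * N)) := by
    intro x
    have q1 := (contDiff_const (c := (4:ℝ))).sub C1
    have q2 : ContDiff ℝ 2 (fun x => A * E2 x) := contDiff_const.mul C2
    have q3 : ContDiff ℝ 2 (fun x => B * E3 x) := contDiff_const.mul C3
    rw [hh, lap_sub (q1.sub q2).contDiffAt q3.contDiffAt, lap_sub q1.contDiffAt q2.contDiffAt,
      lap_sub contDiffAt_const C1.contDiffAt, lap_smul _ C2.contDiffAt, lap_smul _ C3.contDiffAt,
      lap_const, hE1, lap_exp_inner _ _ _ he, hE2, lap_exp_sq, hE3, lap_exp_sq]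
    simp only [sub_zero]; ring
  have hAE : ∀ x, A * E2 x = Real.exp (k * (‖x‖^2 - R^2)) := by
    intro x; simp only [hA, hE2, sub_zero]; rw [← Real.exp_add]; ring_nf
  have hBE : ∀ x, B * E3 x = c * Real.exp (k * (a^2 - ‖x‖^2)) := by
    intro x; simp only [hB, hE3, sub_zero]; rw [mul_assoc, ← Real.exp_add]; ring_nf
  have hge : ∀ x ∈ HB a R e, 1 ≤ h x := by
    intro x hx
    have h1 : E1 x ≤ 1 := Real.exp_le_one_iff.2 (by nlinarith [hx.2.2])
    have h2 : A * E2 x ≤ 1 := by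
      rw [hAE]; refine Real.exp_le_one_iff.2 ?_
      have : ‖x‖^2 ≤ R^2 := by gcongr; exact hx.2.1
      nlinarith
    have h3 : B * E3 x ≤ 1 := by
      rw [hBE]
      have : Real.exp (k * (a^2 - ‖x‖^2)) ≤ 1 := by
        refine Real.exp_le_one_iff.2 ?_
        have : a^2 ≤ ‖x‖^2 := by gcongr; exact hx.1
        nlinarith
      nlinarith [Real.exp_pos (k * (a^2 - ‖x‖^2))]
    simp only [hh]; linarith
  refine ⟨h, ((contDiff_const.sub C1).sub (contDiff_const.mul C2)).sub (contDiff_const.mul C3), hge, ?_⟩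
  intro x hx hxK
  have hle4 : h x ≤ 4 := by
    have h2 : 0 < A * E2 x := by rw [hAE]; positivity
    have h3 : 0 ≤ B * E3 x := by rw [hBE]; positivity
    have := Real.exp_pos (-k * ⟪x, e⟫)
    simp only [hh]; simp only [hE1]; linarith
  have hmain : 4 * L + 1 ≤ - lap h x := by
    rw [hlap]
    have t1 : 0 ≤ E1 x * k^2 := by positivity
    have t2 : 0 ≤ A * (E2 x * (4 * k^2 * ‖x‖^2 + 2 * k * N)) := by positivity
    have t3' : 0 < a → M ≤ 4 * k^2 * ‖x‖^2 - 2 * k * N := by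
      intro h
      have := e3 h
      have h2 : a^2 ≤ ‖x‖^2 := by gcongr; exact hx.1.le
      nlinarith [mul_le_mul_of_nonneg_left h2 (sq_nonneg k)]
    have t3 : 0 ≤ B * (E3 x * (4 * k^2 * ‖x‖^2 - 2 * k * N)) := by
      by_cases h : 0 < a
      · have := t3' h
        have : 0 ≤ 4 * k^2 * ‖x‖^2 - 2 * k * N := by linarith
        positivity
      · simp [hB, hc, h]
    have key : ∀ s t : ℝ, -1 ≤ s → M ≤ t → 4 * L + 1 ≤ Real.exp s * t := by
      intro s t hs ht
      have h1 : Real.exp (-1) ≤ Real.exp s := Real.exp_le_exp.2 hs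
      calc 4 * L + 1 = Real.exp (-1) * M := by
            rw [hM, mul_comm (4 * L + 1), ← mul_assoc, ← Real.exp_add]; simp
        _ ≤ _ := by gcongr
    by_cases c1 : ⟪x, e⟫ < δ
    · have := key (-k * ⟪x, e⟫) (k^2) (by nlinarith) e1
      simp only [hE1] at *; linarith
    · by_cases c2 : R - δ < ‖x‖
      · have := key (k * (‖x‖^2 - R^2)) (4 * k^2 * ‖x‖^2 + 2 * k * N) (by
          have w1 : (R-δ)^2 ≤ ‖x‖^2 := by gcongr; linarith
          have w2 : R^2 - 2 * R * δ ≤ ‖x‖^2 := by linarith [sq_nonneg δ, (by ring : (R-δ)^2 = R^2 - 2*R*δ + δ^2)]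
          have w3 := mul_le_mul_of_nonneg_left w2 hk0.le
          linarith) (by
          have h1 : (R/2)^2 ≤ ‖x‖^2 := by gcongr; linarith
          have h2 : (0:ℝ) ≤ 2 * k * N := by positivity
          nlinarith [mul_le_mul_of_nonneg_left h1 (sq_nonneg k)])
        rw [← hAE, mul_assoc] at this; linarith
      · have c3 : ‖x‖ < a + δ := by
          by_contra h; exact hxK ⟨not_lt.1 h, not_lt.1 c2, not_lt.1 c1⟩
        have ha' : 0 < a := by
          rcases ha.eq_or_lt with h | h
          · exfalso
            have := (le_abs_self _).trans (abs_real_inner_le_norm x e)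
            rw [he] at this; linarith
          · exact h
        have := key (k * (a^2 - ‖x‖^2)) (4 * k^2 * ‖x‖^2 - 2 * k * N) (by
          have w1 : ‖x‖^2 ≤ (a+δ)^2 := by gcongr
          have w2 : ‖x‖^2 ≤ a^2 + (2 * a * δ + δ^2) := by linarith [(by ring : (a+δ)^2 = a^2 + (2 * a * δ + δ^2))]
          have w3 := mul_le_mul_of_nonneg_left w2 hk0.le
          linarith) (t3' ha')
        have hcc : c = 1 := by simp [hc, ha']
        have h4 := hBE x
        rw [hcc, one_mul] at h4
        rw [← h4, mul_assoc] at this; linarith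
  nlinarith

lemma narrow_max {m : ℕ} {a R δ L : ℝ} {e : EuclN N} (hL : 0 ≤ L) {h : EuclN N → ℝ}
    (hC : ContDiff ℝ 2 h) (h1 : ∀ x ∈ HB a R e, 1 ≤ h x)
    (hh : ∀ x ∈ HD a R e, x ∉ KD a R δ e → L * h x < - lap h x)
    {V : Fin m → EuclN N → ℝ} (hcont : ∀ i, ContinuousOn (V i) (HB a R e))
    (hV : ∀ i, ContDiffOn ℝ 2 (V i) (HD a R e))
    (hb : ∀ i, ∀ x ∈ HB a R e, x ∉ HD a R e → 0 ≤ V i x)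
    (hK : ∀ i, ∀ x ∈ HD a R e, x ∈ KD a R δ e → 0 ≤ V i x)
    (hin : ∀ i, ∀ x ∈ HD a R e, V i x < 0 → (∀ j, V i x ≤ V j x) → L * V i x ≤ - lap (V i) x) :
    ∀ i, ∀ x ∈ HD a R e, 0 ≤ V i x := by
  by_contra hcon
  push Not at hcon
  obtain ⟨i1, x1, hx1, hneg⟩ := hcon
  have hne : (HB a R e).Nonempty := ⟨x1, HD_sub_HB _ _ _ hx1⟩
  have hpos : ∀ x ∈ HB a R e, 0 < h x := fun x hx => by linarith [h1 x hx]
  have hex : ∀ i, ∃ x ∈ HB a R e, IsMinOn (fun y => V i y / h y) (HB a R e) x := fun i =>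
    (HB_compact a R e).exists_isMinOn hne ((hcont i).div hC.continuous.continuousOn
      (fun x hx => (hpos x hx).ne'))
  choose X hX hXm using hex
  obtain ⟨i0, -, hi0⟩ := Finset.exists_min_image Finset.univ (fun i => V i (X i) / h (X i)) ⟨i1, Finset.mem_univ _⟩
  set x0 := X i0 with hx0
  set t := - (V i0 x0 / h x0) with ht
  have hall : ∀ j, ∀ x ∈ HB a R e, - t * h x ≤ V j x := by
    intro j x hx
    have a1 := hi0 j (Finset.mem_univ _)
    have a2 : V j (X j) / h (X j) ≤ V j x / h x := hXm j hx
    have a3 : -t ≤ V j x / h x := by rw [ht, neg_neg]; exact a1.trans a2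
    rwa [le_div_iff₀ (hpos x hx)] at a3
  have ht0 : 0 < t := by
    have := hall i1 x1 (HD_sub_HB _ _ _ hx1)
    have := hpos x1 (HD_sub_HB _ _ _ hx1)
    nlinarith
  have hx0B : x0 ∈ HB a R e := hX i0
  have heq : V i0 x0 = - t * h x0 := by rw [ht]; field_simp [(hpos x0 hx0B).ne']
  have hlt : V i0 x0 < 0 := by rw [heq]; nlinarith [hpos x0 hx0B]
  have hx0D : x0 ∈ HD a R e := by
    by_contra hn; linarith [hb i0 x0 hx0B hn]
  have hx0K : x0 ∉ KD a R δ e := fun hk => by linarith [hK i0 x0 hx0D hk]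
  have h3 := hin i0 x0 hx0D hlt (fun j => by rw [heq]; exact hall j x0 hx0B)
  have h4 := hh x0 hx0D hx0K
  have hVx := (hV i0).contDiffAt ((HD_open a R e).mem_nhds hx0D)
  have hth : ContDiffAt ℝ 2 (fun x => t * h x) x0 := (contDiff_const.mul hC).contDiffAt
  have hloc : IsLocalMin (fun x => V i0 x + t * h x) x0 := by
    filter_upwards [(HD_open a R e).mem_nhds hx0D] with x hx
    have := hall i0 x (HD_sub_HB _ _ _ hx)
    rw [heq]; linarith
  have h5 := lap_nonneg_of_isLocalMin (hVx.add hth) hloc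
  rw [lap_add hVx hth, lap_smul t hC.contDiffAt] at h5
  rw [heq] at h3
  nlinarith

end MP

/-! ### Quadratic form -/
namespace QF
variable {N m : ℕ}
open Filter Topology

def C1c (Ψ : Fin m → EuclN N → ℝ) : Prop := ∀ i, ContDiff ℝ 1 (Ψ i) ∧ HasCompactSupport (Ψ i)

noncomputable def bi (c : Fin m → Fin m → EuclN N → ℝ) (Φ Ψ : Fin m → EuclN N → ℝ) (x : EuclN N) : ℝ :=
  (∑ i, ⟪gradient (Φ i) x, gradient (Ψ i) x⟫) - ∑ i, ∑ j, c i j x * Φ i x * Ψ j x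

noncomputable def BF (c : Fin m → Fin m → EuclN N → ℝ) (Φ Ψ : Fin m → EuclN N → ℝ) : ℝ := ∫ x, bi c Φ Ψ x

lemma grad_cont {u : EuclN N → ℝ} (hu : ContDiff ℝ 1 u) : Continuous (gradient u) :=
  (InnerProductSpace.toDual ℝ (EuclN N)).symm.continuous.comp (hu.continuous_fderiv (by norm_num))

lemma grad_lin {F G : EuclN N → ℝ} {x : EuclN N} (hF : DifferentiableAt ℝ F x)
    (hG : DifferentiableAt ℝ G x) (t : ℝ) :
    gradient (fun y => t * F y + G y) x = t • gradient F x + gradient G x := by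
  unfold gradient
  rw [fderiv_fun_add (hF.const_mul t) hG, fderiv_const_mul hF, map_add, map_smul]

lemma grad_zero_of {u : EuclN N → ℝ} {x : EuclN N} (hx : x ∉ tsupport u) : gradient u x = 0 := by
  have : fderiv ℝ u x = 0 := image_eq_zero_of_notMem_tsupport (fun h => hx (tsupport_fderiv_subset ℝ h))
  simp [gradient, this]

lemma C1c.lin {F G : Fin m → EuclN N → ℝ} (hF : C1c F) (hG : C1c G) (t : ℝ) :
    C1c (fun i y => t * F i y + G i y) := fun i =>
  ⟨(contDiff_const.mul (hF i).1).add (hG i).1, ((hF i).2.mul_left (f := fun _ => t)).add (hG i).2⟩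

variable {c : Fin m → Fin m → EuclN N → ℝ}

lemma bi_cont (hc : ∀ i j, Continuous (c i j)) {Φ Ψ : Fin m → EuclN N → ℝ} (hΦ : C1c Φ) (hΨ : C1c Ψ) :
    Continuous (bi c Φ Ψ) := by
  unfold bi
  refine Continuous.sub ?_ ?_
  · exact continuous_finsetSum _ fun i _ => (grad_cont (hΦ i).1).inner (grad_cont (hΨ i).1)
  · exact continuous_finsetSum _ fun i _ => continuous_finsetSum _ fun j _ =>
      ((hc i j).mul (hΦ i).1.continuous).mul (hΨ j).1.continuous

lemma bi_zero {Φ Ψ : Fin m → EuclN N → ℝ} {x : EuclN N} (hx : ∀ i, x ∉ tsupport (Φ i)) : bi c Φ Ψ x = 0 := by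
  simp [bi, fun i => grad_zero_of (hx i), fun i => image_eq_zero_of_notMem_tsupport (hx i)]

lemma bi_zero' {Φ Ψ : Fin m → EuclN N → ℝ} {x : EuclN N} (hx : ∀ i, x ∉ tsupport (Ψ i)) : bi c Φ Ψ x = 0 := by
  simp [bi, fun i => grad_zero_of (hx i), fun i => image_eq_zero_of_notMem_tsupport (hx i)]

lemma bi_int (hc : ∀ i j, Continuous (c i j)) {Φ Ψ : Fin m → EuclN N → ℝ} (hΦ : C1c Φ) (hΨ : C1c Ψ) :
    Integrable (bi c Φ Ψ) := by
  refine (bi_cont hc hΦ hΨ).integrable_of_hasCompactSupport ?_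
  refine HasCompactSupport.intro (K := ⋃ i, tsupport (Φ i)) (isCompact_iUnion fun i => (hΦ i).2) ?_
  intro x hx
  exact bi_zero (by simpa using hx)

lemma bi_lin_left {F G Ψ : Fin m → EuclN N → ℝ} (hF : C1c F) (hG : C1c G) (t : ℝ) (x) :
    bi c (fun i y => t * F i y + G i y) Ψ x = t * bi c F Ψ x + bi c G Ψ x := by
  unfold bi
  have h1 : ∑ i, ⟪gradient (fun y => t * F i y + G i y) x, gradient (Ψ i) x⟫ =
     t * (∑ i, ⟪gradient (F i) x, gradient (Ψ i) x⟫) + ∑ i, ⟪gradient (G i) x, gradient (Ψ i) x⟫ := by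
    rw [Finset.mul_sum, ← Finset.sum_add_distrib]
    refine Finset.sum_congr rfl fun i _ => ?_
    rw [grad_lin ((hF i).1.differentiable (by norm_num) x) ((hG i).1.differentiable (by norm_num) x),
      inner_add_left, inner_smul_left]; simp
  have h2 : ∑ i, ∑ j, c i j x * (t * F i x + G i x) * Ψ j x =
     t * (∑ i, ∑ j, c i j x * F i x * Ψ j x) + ∑ i, ∑ j, c i j x * G i x * Ψ j x := by
    simp only [Finset.mul_sum, ← Finset.sum_add_distrib]
    refine Finset.sum_congr rfl fun i _ => Finset.sum_congr rfl fun j _ => by ring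
  rw [h1, h2]; ring

lemma bi_lin_right {F G Ψ : Fin m → EuclN N → ℝ} (hF : C1c F) (hG : C1c G) (t : ℝ) (x) :
    bi c Ψ (fun i y => t * F i y + G i y) x = t * bi c Ψ F x + bi c Ψ G x := by
  unfold bi
  have h1 : ∑ i, ⟪gradient (Ψ i) x, gradient (fun y => t * F i y + G i y) x⟫ =
     t * (∑ i, ⟪gradient (Ψ i) x, gradient (F i) x⟫) + ∑ i, ⟪gradient (Ψ i) x, gradient (G i) x⟫ := by
    rw [Finset.mul_sum, ← Finset.sum_add_distrib]
    refine Finset.sum_congr rfl fun i _ => ?_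
    rw [grad_lin ((hF i).1.differentiable (by norm_num) x) ((hG i).1.differentiable (by norm_num) x),
      inner_add_right, inner_smul_right]
  have h2 : ∑ i, ∑ j, c i j x * Ψ i x * (t * F j x + G j x) =
     t * (∑ i, ∑ j, c i j x * Ψ i x * F j x) + ∑ i, ∑ j, c i j x * Ψ i x * G j x := by
    simp only [Finset.mul_sum, ← Finset.sum_add_distrib]
    refine Finset.sum_congr rfl fun i _ => Finset.sum_congr rfl fun j _ => by ring
  rw [h1, h2]; ring

lemma BF_lin_left (hc : ∀ i j, Continuous (c i j)) {F G Ψ : Fin m → EuclN N → ℝ} (hF : C1c F)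
    (hG : C1c G) (hΨ : C1c Ψ) (t : ℝ) :
    BF c (fun i y => t * F i y + G i y) Ψ = t * BF c F Ψ + BF c G Ψ := by
  unfold BF
  simp_rw [bi_lin_left hF hG]
  rw [integral_add ((bi_int hc hF hΨ).const_mul t) (bi_int hc hG hΨ), integral_const_mul]

lemma BF_lin_right (hc : ∀ i j, Continuous (c i j)) {F G Ψ : Fin m → EuclN N → ℝ} (hF : C1c F)
    (hG : C1c G) (hΨ : C1c Ψ) (t : ℝ) :
    BF c Ψ (fun i y => t * F i y + G i y) = t * BF c Ψ F + BF c Ψ G := by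
  unfold BF
  simp_rw [bi_lin_right hF hG]
  rw [integral_add ((bi_int hc hΨ hF).const_mul t) (bi_int hc hΨ hG), integral_const_mul]

lemma BF_expand (hc : ∀ i j, Continuous (c i j)) {F G : Fin m → EuclN N → ℝ} (hF : C1c F)
    (hG : C1c G) (t : ℝ) :
    BF c (fun i y => t * F i y + G i y) (fun i y => t * F i y + G i y) =
      t^2 * BF c F F + t * (BF c F G + BF c G F) + BF c G G := by
  rw [BF_lin_left hc hF hG (hF.lin hG t), BF_lin_right hc hF hG hF, BF_lin_right hc hF hG hG]
  ring

lemma Qform_eq {f : Fin m → ℝ → (Fin m → ℝ) → ℝ} {U : Fin m → EuclN N → ℝ} {O : Set (EuclN N)}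
    (hcU : ∀ i j, ∀ x ∈ O, c i j x = pd (f i) j ‖x‖ (fun k => U k x))
    {Ψ : Fin m → EuclN N → ℝ} (hO : MeasurableSet O) (hΨ : IsTestFun O Ψ) : Qform f U O Ψ = BF c Ψ Ψ := by
  unfold Qform BF
  rw [← setIntegral_eq_integral_of_forall_compl_eq_zero (s := O) (f := bi c Ψ Ψ)]
  · refine setIntegral_congr_fun hO fun x hx => ?_
    simp only [bi, real_inner_self_eq_norm_sq, hcU _ _ x hx]
  · intro x hx
    exact bi_zero fun i hi => hx ((hΨ i).2.2 hi)

lemma test_lin {O : Set (EuclN N)} {F G : Fin m → EuclN N → ℝ} (hF : IsTestFun O F)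
    (hG : IsTestFun O G) (t : ℝ) : IsTestFun O (fun i y => t * F i y + G i y) := by
  intro i
  have h := C1c.lin (fun i => ⟨(hF i).1, (hF i).2.1⟩) (fun i => ⟨(hG i).1, (hG i).2.1⟩) t i
  refine ⟨h.1, h.2, ?_⟩
  refine (tsupport_add _ _).trans (union_subset ?_ (hG i).2.2)
  exact (closure_mono (Function.support_const_smul_subset t (F i))).trans (hF i).2.2

lemma test_C1c {O : Set (EuclN N)} {F : Fin m → EuclN N → ℝ} (hF : IsTestFun O F) : C1c F :=
  fun i => ⟨(hF i).1, (hF i).2.1⟩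

lemma test_zero {O : Set (EuclN N)} : IsTestFun O (fun (_ : Fin m) (_ : EuclN N) => (0:ℝ)) := by
  intro i
  refine ⟨contDiff_const, HasCompactSupport.zero, ?_⟩
  have : tsupport (fun _ : EuclN N => (0:ℝ)) = ∅ := tsupport_eq_empty_iff.2 rfl
  rw [this]; exact empty_subset _

lemma test_sum {O : Set (EuclN N)} {n : ℕ} {Ψ : Fin n → Fin m → EuclN N → ℝ}
    (hΨ : ∀ l, IsTestFun O (Ψ l)) (t : Fin n → ℝ) {p : (Fin m → EuclN N → ℝ) → Prop}
    (h0 : p (fun _ _ => 0))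
    (hp : ∀ l (s : ℝ) G, IsTestFun O G → p G → p (fun i y => s * Ψ l i y + G i y)) :
    IsTestFun O (fun i x => ∑ l, t l * Ψ l i x) ∧ p (fun i x => ∑ l, t l * Ψ l i x) := by
  classical
  have : ∀ S : Finset (Fin n), IsTestFun O (fun i x => ∑ l ∈ S, t l * Ψ l i x) ∧
      p (fun i x => ∑ l ∈ S, t l * Ψ l i x) := by
    intro S
    induction S using Finset.induction_on with
    | empty => simpa using ⟨test_zero, h0⟩
    | insert l S hl ih =>
      simp only [Finset.sum_insert hl]
      exact ⟨test_lin (hΨ l) ih.1 _, hp l _ _ ih.1 ih.2⟩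
  exact this Finset.univ

lemma BF_zero : BF c (fun _ _ => 0) (fun _ _ => 0) = 0 := by
  unfold BF bi; simp [gradient]

lemma neg_extend (hc : ∀ i j, Continuous (c i j)) {f : Fin m → ℝ → (Fin m → ℝ) → ℝ}
    {U : Fin m → EuclN N → ℝ} {O : Set (EuclN N)} (hO : MeasurableSet O)
    (hcU : ∀ i j, ∀ x ∈ O, c i j x = pd (f i) j ‖x‖ (fun k => U k x)) {n : ℕ}
    {Ψ : Fin n → Fin m → EuclN N → ℝ} (hΨ : ∀ l, IsTestFun O (Ψ l))
    (hneg : ∀ t : Fin n → ℝ, t ≠ 0 → Qform f U O (fun i x => ∑ l, t l * Ψ l i x) < 0)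
    {F : Fin m → EuclN N → ℝ} (hF : IsTestFun O F) (hFneg : BF c F F < 0)
    (horth : ∀ l, BF c F (Ψ l) + BF c (Ψ l) F = 0) : NegDefFamily f U O (n+1) := by
  have hF' := test_C1c hF
  refine ⟨Fin.cons F Ψ, ?_, ?_⟩
  · intro l; refine Fin.cases ?_ (fun l => ?_) l
    · simpa using hF
    · simpa using hΨ l
  · intro t ht
    have hsum : (fun (i : Fin m) (x : EuclN N) => ∑ l, t l * (Fin.cons F Ψ : Fin (n+1) → Fin m → EuclN N → ℝ) l i x)
       = fun i x => t 0 * F i x + ∑ l, t (Fin.succ l) * Ψ l i x := by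
      funext i x; rw [Fin.sum_univ_succ]; simp
    rw [hsum]
    obtain ⟨hG, hG2⟩ := test_sum hΨ (fun l => t l.succ) (p := fun G => BF c F G + BF c G F = 0)
      (by
        have := BF_lin_left (c := c) hc hF' hF' hF' (-1)
        have h2 := BF_lin_right (c := c) hc hF' hF' hF' (-1)
        simp at this h2; rw [h2, this]; norm_num) (by
      intro l s G hG hpG
      rw [BF_lin_left hc (test_C1c (hΨ l)) (test_C1c hG) hF', BF_lin_right hc (test_C1c (hΨ l)) (test_C1c hG) hF']
      have := horth l
      linear_combination s * this + hpG)
    rw [Qform_eq hcU hO (test_lin hF hG _), BF_expand hc hF' (test_C1c hG), hG2]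
    by_cases h0 : t 0 = 0
    · have : (fun l : Fin n => t l.succ) ≠ 0 := by
        intro h; apply ht; funext l; refine Fin.cases h0 (fun l => congrFun h l) l
      have := hneg _ this
      rw [Qform_eq hcU hO hG] at this
      rw [h0]; linarith
    · have h1 : BF c (fun i x => ∑ l, t (Fin.succ l) * Ψ l i x) (fun i x => ∑ l, t (Fin.succ l) * Ψ l i x) ≤ 0 := by
        by_cases h : (fun l : Fin n => t l.succ) = 0
        · have h' : ∀ l : Fin n, t l.succ = 0 := fun l => congrFun h l
          simp only [h', zero_mul, Finset.sum_const_zero]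
          exact BF_zero.le
        · have := hneg _ h
          rw [Qform_eq hcU hO hG] at this; exact this.le
      have : t 0 ^ 2 * BF c F F < 0 := mul_neg_of_pos_of_neg (by positivity) hFneg
      linarith

end QF

namespace QF
variable {N m n : ℕ} {c : Fin m → Fin m → EuclN N → ℝ}
open Filter Topology

noncomputable def At (φ : Fin n → Fin m → EuclN N → ℝ) (ε : ℝ) (w : Fin n → ℝ) (i : Fin m) (x : EuclN N) : ℝ :=
  √(ε^2 + ∑ k, w k * φ k i x ^ 2) - ε

section
variable {φ : Fin n → Fin m → EuclN N → ℝ} {ε : ℝ} {w : Fin n → ℝ}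

lemma At_pos (hε : 0 < ε) (hw : ∀ k, 0 ≤ w k) (i x) : 0 < ε^2 + ∑ k, w k * φ k i x ^ 2 := by
  have : 0 ≤ ∑ k, w k * φ k i x ^ 2 := Finset.sum_nonneg fun k _ => mul_nonneg (hw k) (sq_nonneg _)
  positivity

lemma At_supp {i : Fin m} {x : EuclN N} (hε : 0 < ε) (hx : ∀ k, w k ≠ 0 → φ k i x = 0) : At φ ε w i x = 0 := by
  have : ∑ k, w k * φ k i x ^ 2 = 0 := Finset.sum_eq_zero fun k _ => by
    by_cases h : w k = 0
    · simp [h]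
    · simp [hx k h]
  simp [At, this, Real.sqrt_sq hε.le]

lemma At_tsupp (hε : 0 < ε) (i : Fin m) :
    tsupport (At φ ε w i) ⊆ ⋃ k : {k : Fin n // w k ≠ 0}, tsupport (φ k i) := by
  refine closure_minimal ?_ (isClosed_iUnion_of_finite fun k => isClosed_tsupport _)
  intro x hx
  by_contra hcon
  simp only [mem_iUnion, not_exists] at hcon
  exact hx (At_supp hε fun k hk => image_eq_zero_of_notMem_tsupport (hcon ⟨k, hk⟩))

lemma At_C1c (hφ : ∀ k, C1c (φ k)) (hε : 0 < ε) (hw : ∀ k, 0 ≤ w k) : C1c (At φ ε w) := by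
  intro i
  refine ⟨?_, ?_⟩
  · refine ContDiff.sub (ContDiff.sqrt ?_ fun x => (At_pos hε hw i x).ne') contDiff_const
    exact contDiff_const.add (ContDiff.sum fun k _ => contDiff_const.mul (((hφ k i).1).pow 2))
  · exact (isCompact_iUnion fun k : {k : Fin n // w k ≠ 0} => (hφ k i).2).of_isClosed_subset
      (isClosed_tsupport _) (At_tsupp hε i)

lemma At_grad (hφ : ∀ k, C1c (φ k)) (hε : 0 < ε) (hw : ∀ k, 0 ≤ w k) (i x) :
    gradient (At φ ε w i) x = (√(ε^2 + ∑ k, w k * φ k i x ^ 2))⁻¹ •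
      ∑ k, (w k * φ k i x) • gradient (φ k i) x := by
  have h1 : ∀ k, HasFDerivAt (fun y => w k * φ k i y ^ 2) ((2 * (w k * φ k i x)) • fderiv ℝ (φ k i) x) x := by
    intro k
    have := (((hφ k i).1.differentiable (by norm_num) x).hasFDerivAt.pow 2).const_mul (w k)
    refine this.congr_fderiv ?_
    ext v; simp; ring
  have h2 := ((HasFDerivAt.fun_sum fun k (_ : k ∈ Finset.univ) => h1 k).const_add (ε^2)).sqrt (At_pos hε hw i x).ne'
  have h3 := (h2.sub_const ε).fderiv
  have h4 : fderiv ℝ (At φ ε w i) x = (√(ε^2 + ∑ k, w k * φ k i x ^ 2))⁻¹ •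
      ∑ k, (w k * φ k i x) • fderiv ℝ (φ k i) x := by
    refine Eq.trans h3 ?_
    simp only [mul_smul, ← Finset.smul_sum]
    rw [← mul_smul]; congr 1
    field_simp
  unfold gradient
  rw [h4, map_smul, map_sum]
  simp only [map_smul]

lemma At_bound (hφ : ∀ k, C1c (φ k)) (hε : 0 < ε) (hε1 : ε ≤ 1) (hw : ∀ k, 0 ≤ w k)
    (hcoop : ∀ i j, i ≠ j → ∀ x, 0 ≤ c i j x) (x) :
    bi c (At φ ε w) (At φ ε w) x ≤ ∑ k, w k * bi c (φ k) (φ k) x +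
      ε * ∑ i, ∑ j, |c i j x| * (√(∑ k, w k * φ k i x ^ 2) + √(∑ k, w k * φ k j x ^ 2) + 1) := by
  set T : Fin m → ℝ := fun i => √(∑ k, w k * φ k i x ^ 2) with hT
  have hs0 : ∀ i, 0 ≤ ∑ k, w k * φ k i x ^ 2 :=
    fun i => Finset.sum_nonneg fun k _ => mul_nonneg (hw k) (sq_nonneg _)
  have hT0 : ∀ i, 0 ≤ T i := fun i => Real.sqrt_nonneg _
  have hTsq : ∀ i, T i ^ 2 = ∑ k, w k * φ k i x ^ 2 := fun i => Real.sq_sqrt (hs0 i)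
  have hA0 : ∀ i, 0 ≤ At φ ε w i x := by
    intro i
    have : ε ≤ √(ε^2 + ∑ k, w k * φ k i x ^ 2) := Real.le_sqrt_of_sq_le (by linarith [hs0 i])
    unfold At; linarith
  have hAT : ∀ i, At φ ε w i x ≤ T i := by
    intro i
    have : √(ε^2 + ∑ k, w k * φ k i x ^ 2) ≤ ε + T i := by
      apply Real.sqrt_le_iff.2 ⟨by linarith [hT0 i], ?_⟩
      rw [← hTsq]; nlinarith [hT0 i]
    unfold At; linarith
  have hTA : ∀ i, T i ≤ At φ ε w i x + ε := by
    intro i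
    have : T i ≤ √(ε^2 + ∑ k, w k * φ k i x ^ 2) := Real.sqrt_le_sqrt (by nlinarith)
    unfold At; linarith
  have hgr : ∀ i, ⟪gradient (At φ ε w i) x, gradient (At φ ε w i) x⟫ ≤
      ∑ k, w k * ⟪gradient (φ k i) x, gradient (φ k i) x⟫ := by
    intro i
    simp only [real_inner_self_eq_norm_sq]
    rw [At_grad hφ hε hw, norm_smul, mul_pow]
    have hp := At_pos (φ := φ) hε hw i x
    have h1 : ‖∑ k, (w k * φ k i x) • gradient (φ k i) x‖ ≤ ∑ k, w k * |φ k i x| * ‖gradient (φ k i) x‖ := by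
      refine (norm_sum_le _ _).trans (Finset.sum_le_sum fun k _ => ?_)
      rw [norm_smul, norm_mul, Real.norm_of_nonneg (hw k), Real.norm_eq_abs]
    have h2 : (∑ k, w k * |φ k i x| * ‖gradient (φ k i) x‖)^2 ≤
        (∑ k, w k * φ k i x ^ 2) * ∑ k, w k * ‖gradient (φ k i) x‖ ^ 2 := by
      apply Finset.sum_sq_le_sum_mul_sum_of_sq_eq_mul
      · exact fun k _ => mul_nonneg (hw k) (sq_nonneg _)
      · exact fun k _ => mul_nonneg (hw k) (sq_nonneg _)
      · intro k _; rw [← sq_abs (φ k i x)]; ring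
    have h3 : ‖∑ k, (w k * φ k i x) • gradient (φ k i) x‖^2 ≤
        (ε^2 + ∑ k, w k * φ k i x ^ 2) * ∑ k, w k * ‖gradient (φ k i) x‖ ^ 2 := by
      have h4 : 0 ≤ ∑ k, w k * ‖gradient (φ k i) x‖ ^ 2 :=
        Finset.sum_nonneg fun k _ => mul_nonneg (hw k) (sq_nonneg _)
      have h5 := pow_le_pow_left₀ (norm_nonneg _) h1 2
      nlinarith [sq_nonneg ε]
    rw [norm_inv, inv_pow, Real.norm_of_nonneg (Real.sqrt_nonneg _), Real.sq_sqrt hp.le,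
      inv_mul_le_iff₀ hp]
    exact h3
  have hcs : ∀ i j, ∑ k, w k * (φ k i x * φ k j x) ≤ T i * T j := by
    intro i j
    rw [hT]; simp only
    rw [← Real.sqrt_mul (hs0 i)]
    apply Real.le_sqrt_of_sq_le
    apply Finset.sum_sq_le_sum_mul_sum_of_sq_eq_mul
    · exact fun k _ => mul_nonneg (hw k) (sq_nonneg _)
    · exact fun k _ => mul_nonneg (hw k) (sq_nonneg _)
    · intro k _; ring
  have hcc : ∀ i j, c i j x * ∑ k, w k * (φ k i x * φ k j x) ≤ c i j x * (T i * T j) := by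
    intro i j
    by_cases hij : i = j
    · subst hij
      have : ∑ k, w k * (φ k i x * φ k i x) = T i * T i := by
        rw [← sq, hTsq]; exact Finset.sum_congr rfl fun k _ => by ring
      rw [this]
    · exact mul_le_mul_of_nonneg_left (hcs i j) (hcoop i j hij x)
  have hterm : ∀ i j, - (c i j x * At φ ε w i x * At φ ε w j x) ≤
      - (c i j x * ∑ k, w k * (φ k i x * φ k j x)) + ε * (|c i j x| * (T i + T j + 1)) := by
    intro i j
    have h1 : |T i * T j - At φ ε w i x * At φ ε w j x| ≤ ε * (T i + T j + 1) := by
      rw [abs_of_nonneg (by nlinarith [hA0 i, hA0 j, hAT i, hAT j, hT0 i, hT0 j, mul_le_mul (hAT i) (hAT j) (hA0 j) (hT0 i)])]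
      have a1 := mul_le_mul (hTA i) (hTA j) (hT0 j) (by linarith [hA0 i])
      nlinarith [hAT i, hAT j]
    have h2 : c i j x * (T i * T j - At φ ε w i x * At φ ε w j x) ≤ |c i j x| * (ε * (T i + T j + 1)) := by
      refine (le_abs_self _).trans ?_
      rw [abs_mul]; exact mul_le_mul_of_nonneg_left h1 (abs_nonneg _)
    linarith [hcc i j]
  unfold bi
  have e1 : ∑ k, w k * (∑ i, ⟪gradient (φ k i) x, gradient (φ k i) x⟫ - ∑ i, ∑ j, c i j x * φ k i x * φ k j x)
     = ∑ i, (∑ k, w k * ⟪gradient (φ k i) x, gradient (φ k i) x⟫) - ∑ i, ∑ j, c i j x * ∑ k, w k * (φ k i x * φ k j x) := by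
    simp only [mul_sub, Finset.sum_sub_distrib, Finset.mul_sum]
    congr 1
    · exact Finset.sum_comm
    · rw [Finset.sum_comm]; refine Finset.sum_congr rfl fun i _ => ?_
      rw [Finset.sum_comm]; refine Finset.sum_congr rfl fun j _ => Finset.sum_congr rfl fun k _ => by ring
  rw [e1]
  have s1 := Finset.sum_le_sum fun i (_ : i ∈ Finset.univ) => hgr i
  have s2 := Finset.sum_le_sum fun i (_ : i ∈ Finset.univ) => Finset.sum_le_sum fun j (_ : j ∈ Finset.univ) => hterm i j
  simp only [Finset.sum_add_distrib, Finset.sum_neg_distrib, ← Finset.mul_sum] at s2 ⊢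
  linarith

lemma hidden (hc : ∀ i j, Continuous (c i j)) (hφ : ∀ k, C1c (φ k))
    (hcoop : ∀ i j, i ≠ j → ∀ x, 0 ≤ c i j x) (X : ℝ) {η : ℝ} (hη : 0 < η) :
    ∃ ε > 0, ∀ w : Fin n → ℝ, (∀ k, 0 ≤ w k) → (∀ k, w k ≤ X) →
      BF c (At φ ε w) (At φ ε w) ≤ ∑ k, w k * BF c (φ k) (φ k) + η := by
  set K : Set (EuclN N) := ⋃ k, ⋃ i, tsupport (φ k i) with hK
  have hKc : IsCompact K := isCompact_iUnion fun k => isCompact_iUnion fun i => (hφ k i).2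
  set G : (Fin n → ℝ) × EuclN N → ℝ := fun p => ∑ i, ∑ j, |c i j p.2| *
    (√(∑ k, p.1 k * φ k i p.2 ^ 2) + √(∑ k, p.1 k * φ k j p.2 ^ 2) + 1) with hG
  have hφc : ∀ k i, Continuous (φ k i) := fun k i => (hφ k i).1.continuous
  have hGc : Continuous G := by
    rw [hG]; fun_prop
  obtain ⟨C, hC⟩ := ((isCompact_Icc (a := (0 : Fin n → ℝ)) (b := fun _ => X)).prod hKc).exists_bound_of_continuousOn
    hGc.continuousOn
  set V := volume.real K with hV
  have hV0 : 0 ≤ V := measureReal_nonneg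
  refine ⟨min 1 (η / ((|C| * V) + 1)), lt_min one_pos (by positivity), ?_⟩
  set ε := min 1 (η / ((|C| * V) + 1)) with hε
  have hε0 : 0 < ε := lt_min one_pos (by positivity)
  intro w hw hwX
  have hint : Integrable (fun x => ∑ k, w k * bi c (φ k) (φ k) x) :=
    integrable_finsetSum _ fun k _ => (bi_int hc (hφ k) (hφ k)).const_mul _
  have hint2 : Integrable (K.indicator fun _ : EuclN N => ε * |C|) :=
    (integrableOn_const hKc.measure_lt_top.ne).integrable_indicator hKc.isClosed.measurableSet
  have h1 : BF c (At φ ε w) (At φ ε w) ≤ ∫ x, ((∑ k, w k * bi c (φ k) (φ k) x) + K.indicator (fun _ => ε * |C|) x) := by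
    refine integral_mono (bi_int hc (At_C1c hφ hε0 hw) (At_C1c hφ hε0 hw)) (hint.add hint2) ?_
    intro x
    by_cases hx : x ∈ K
    · have a1 := At_bound hφ hε0 (min_le_left _ _) hw hcoop x
      have a2 : G (w, x) ≤ |C| := (le_abs_self _).trans ((hC (w, x) ⟨⟨hw, hwX⟩, hx⟩).trans (le_abs_self _))
      have a3 := mul_le_mul_of_nonneg_left a2 hε0.le
      simp only [indicator_of_mem hx]
      simp only [hG] at a3
      linarith
    · have hx' : ∀ k i, x ∉ tsupport (φ k i) := by simpa [hK] using hx
      have a1 : bi c (At φ ε w) (At φ ε w) x = 0 := bi_zero fun i hi => by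
        obtain ⟨k, hk⟩ := mem_iUnion.1 (At_tsupp hε0 i hi)
        exact hx' _ _ hk
      simp [a1, fun k => bi_zero (c := c) (Ψ := φ k) (hx' k), indicator_of_notMem hx]
  refine h1.trans ?_
  rw [integral_add hint hint2, integral_finset_sum _ (fun k _ => (bi_int hc (hφ k) (hφ k)).const_mul _),
    integral_indicator hKc.isClosed.measurableSet, setIntegral_const]
  simp only [integral_const_mul, smul_eq_mul]
  have : V * (ε * |C|) ≤ η := by
    have h2 : ε ≤ η / ((|C| * V) + 1) := min_le_right _ _
    rw [le_div_iff₀ (by positivity)] at h2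
    nlinarith
  unfold BF
  linarith

end
end QF

namespace QF
variable {N m n : ℕ} {c : Fin m → Fin m → EuclN N → ℝ}
open Filter Topology

lemma BF_swap (Φ Ψ : Fin m → EuclN N → ℝ) : BF c Φ Ψ = BF (fun i j => c j i) Ψ Φ := by
  unfold BF; congr 1; funext x; unfold bi
  congr 1
  · exact Finset.sum_congr rfl fun i _ => real_inner_comm _ _
  · rw [Finset.sum_comm]; exact Finset.sum_congr rfl fun i _ => Finset.sum_congr rfl fun j _ => by ring

lemma At_param {X : Type*} [TopologicalSpace X] [FirstCountableTopology X] [LocallyCompactSpace X]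
    {φ : Fin n → Fin m → EuclN N → ℝ} {ε : ℝ}
    (hc : ∀ i j, Continuous (c i j)) (hφ : ∀ k, C1c (φ k)) (hε : 0 < ε) {w : X → Fin n → ℝ}
    (hw : ∀ s k, 0 ≤ w s k) (hwc : Continuous w) {Ψ : Fin m → EuclN N → ℝ} (hΨ : C1c Ψ) :
    Continuous fun s => BF c (At φ ε (w s)) Ψ := by
  set K : Set (EuclN N) := ⋃ i, tsupport (Ψ i) with hK
  have hKc : IsCompact K := isCompact_iUnion fun i => (hΨ i).2
  have h1 : ∀ s, BF c (At φ ε (w s)) Ψ = ∫ x in K, bi c (At φ ε (w s)) Ψ x := by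
    intro s
    unfold BF
    rw [setIntegral_eq_integral_of_forall_compl_eq_zero]
    intro x hx
    exact bi_zero' (by simpa [hK] using hx)
  simp_rw [h1]
  refine continuous_parametric_integral_of_continuous ?_ hKc
  have hφc : ∀ k i, Continuous (φ k i) := fun k i => (hφ k i).1.continuous
  have hφg : ∀ k i, Continuous (gradient (φ k i)) := fun k i => grad_cont (hφ k i).1
  have hΨc : ∀ i, Continuous (Ψ i) := fun i => (hΨ i).1.continuous
  have hΨg : ∀ i, Continuous (gradient (Ψ i)) := fun i => grad_cont (hΨ i).1
  have hwk : ∀ k, Continuous fun s => w s k := fun k => (continuous_apply k).comp hwc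
  have hS : ∀ i, Continuous fun p : X × EuclN N => √(ε^2 + ∑ k, w p.1 k * φ k i p.2 ^ 2) := by
    intro i; fun_prop
  have hSi : ∀ i, Continuous fun p : X × EuclN N => (√(ε^2 + ∑ k, w p.1 k * φ k i p.2 ^ 2))⁻¹ :=
    fun i => (hS i).inv₀ fun p => (Real.sqrt_pos.2 (At_pos hε (hw p.1) i p.2)).ne'
  have : Function.uncurry (fun s x => bi c (At φ ε (w s)) Ψ x) = fun p : X × EuclN N =>
      (∑ i, ⟪(√(ε^2 + ∑ k, w p.1 k * φ k i p.2 ^ 2))⁻¹ •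
      ∑ k, (w p.1 k * φ k i p.2) • gradient (φ k i) p.2, gradient (Ψ i) p.2⟫) -
      ∑ i, ∑ j, c i j p.2 * (√(ε^2 + ∑ k, w p.1 k * φ k i p.2 ^ 2) - ε) * Ψ j p.2 := by
    funext ⟨s, x⟩
    simp only [Function.uncurry, bi, At_grad hφ hε (hw s)]
    rfl
  rw [this]
  refine Continuous.sub (continuous_finsetSum _ fun i _ => ?_) (continuous_finsetSum _ fun i _ =>
    continuous_finsetSum _ fun j _ => ?_)
  · refine Continuous.inner ((hSi i).smul ?_) ((hΨg i).comp continuous_snd)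
    fun_prop
  · have := hS i
    fun_prop

lemma BF_comb (hc : ∀ i j, Continuous (c i j)) {F G : Fin m → EuclN N → ℝ} (hF : C1c F)
    (hG : C1c G) (t s : ℝ) :
    BF c (fun i y => t * F i y + s * G i y) (fun i y => t * F i y + s * G i y) =
      t^2 * BF c F F + t * s * (BF c F G + BF c G F) + s^2 * BF c G G := by
  have h0 : C1c (fun (_ : Fin m) (_ : EuclN N) => (0:ℝ)) := fun i => ⟨contDiff_const, HasCompactSupport.zero⟩
  have hz : ∀ H : Fin m → EuclN N → ℝ, BF c H (fun _ _ => 0) = 0 := by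
    intro H; unfold BF bi; simp [gradient]
  have hz' : ∀ H : Fin m → EuclN N → ℝ, BF c (fun _ _ => 0) H = 0 := by
    intro H; unfold BF bi; simp [gradient]
  have hsG := hG.lin h0 s
  have e := BF_expand hc hF hsG t
  rw [BF_lin_left hc hG h0 hF, BF_lin_right hc hG h0 hF, BF_expand hc hG h0] at e
  simp only [hz, hz', add_zero] at e
  rw [e]; ring

lemma test_comb {O : Set (EuclN N)} {F G : Fin m → EuclN N → ℝ} (hF : IsTestFun O F)
    (hG : IsTestFun O G) (t s : ℝ) : IsTestFun O (fun i y => t * F i y + s * G i y) := by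
  have := test_lin hF (test_lin hG test_zero s) t
  simpa using this

lemma D_comb (hc : ∀ i j, Continuous (c i j)) {F G H : Fin m → EuclN N → ℝ} (hF : C1c F)
    (hG : C1c G) (hH : C1c H) (t s : ℝ) :
    BF c (fun i y => t * F i y + s * G i y) H = t * BF c F H + s * BF c G H := by
  have h0 : C1c (fun (_ : Fin m) (_ : EuclN N) => (0:ℝ)) := fun i => ⟨contDiff_const, HasCompactSupport.zero⟩
  have hz' : BF c (fun _ _ => 0) H = 0 := by unfold BF bi; simp [gradient]
  have e := BF_lin_left hc hF (hG.lin h0 s) hH t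
  rw [BF_lin_left hc hG h0 hH] at e
  simp only [hz', add_zero] at e
  exact e

noncomputable def yy (s : Fin (N+1) → ℝ) : EuclN N := WithLp.toLp 2 (fun i => s (Fin.castSucc i))

lemma yy_cont : Continuous (yy : (Fin (N+1) → ℝ) → EuclN N) := by
  unfold yy
  exact (PiLp.continuous_toLp 2 _).comp (by fun_prop)

lemma yy_neg (s : Fin (N+1) → ℝ) : yy (-s) = - yy s := by ext i; simp [yy]

lemma yy_ne {s : Fin (N+1) → ℝ} (hs : ‖s‖ = 1) (hz : |s (Fin.last N)| ≤ 1/2) : yy s ≠ 0 := by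
  intro h
  have : ‖s‖ ≤ 1/2 := by
    refine (pi_norm_le_iff_of_nonneg (by norm_num)).2 fun i => ?_
    refine Fin.lastCases ?_ (fun j => ?_) i
    · simpa using hz
    · have := congrArg (fun v : EuclN N => v j) h
      simp [yy] at this
      simp [this]
  linarith

theorem exists_dir (hN : 2 ≤ N) (hc : ∀ i j, Continuous (c i j))
    (hcoop : ∀ i j, i ≠ j → ∀ x, 0 ≤ c i j x)
    {f : Fin m → ℝ → (Fin m → ℝ) → ℝ}
    {U : Fin m → EuclN N → ℝ} {O : Set (EuclN N)} (hO : MeasurableSet O)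
    (hcU : ∀ i j, ∀ x ∈ O, c i j x = pd (f i) j ‖x‖ (fun k => U k x))
    (hMorse : ¬ NegDefFamily f U O (N + 1)) :
    ∃ e : EuclN N, ‖e‖ = 1 ∧ ∀ Ψ, IsTestFun (halfDom O e) Ψ → 0 ≤ BF c Ψ Ψ := by
  by_contra hcon
  push Not at hcon
  -- step A
  have hA : ∀ y : EuclN N, ∃ φ, y ≠ 0 → IsTestFun (halfDom O y) φ ∧ BF c φ φ < 0 := by
    intro y
    by_cases hy : y = 0
    · exact ⟨fun _ _ => 0, fun h => absurd hy h⟩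
    obtain ⟨φ, h1, h2⟩ := hcon ((‖y‖)⁻¹ • y) (norm_smul_inv_norm hy)
    refine ⟨φ, fun _ => ⟨fun i => ⟨(h1 i).1, (h1 i).2.1, (h1 i).2.2.trans ?_⟩, h2⟩⟩
    rintro x ⟨hx, hx2⟩
    refine ⟨hx, ?_⟩
    rw [inner_smul_right] at hx2
    exact (pos_iff_pos_of_mul_pos hx2).1 (inv_pos.2 (norm_pos_iff.2 hy))
  choose Φ hΦ using hA
  have hB : ∀ y : EuclN N, ∃ ρ : ℝ, 0 < ρ ∧ (y ≠ 0 → ∀ y', dist y' y < ρ → ∀ i, ∀ x ∈ tsupport (Φ y i), 0 < ⟪x, y'⟫) := by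
    intro y
    by_cases hy : y = 0
    · exact ⟨1, one_pos, fun h => absurd hy h⟩
    have hcomp : IsCompact (⋃ i, tsupport (Φ y i)) := isCompact_iUnion fun i => ((hΦ y hy).1 i).2.1
    have : ∀ᶠ y' in 𝓝 y, ∀ x ∈ (⋃ i, tsupport (Φ y i)), 0 < ⟪x, y'⟫ := by
      refine hcomp.eventually_forall_of_forall_eventually fun x hx => ?_
      obtain ⟨i, hi⟩ := mem_iUnion.1 hx
      have h0 : 0 < ⟪x, y⟫ := (((hΦ y hy).1 i).2.2 hi).2
      have hcont : Continuous fun p : EuclN N × EuclN N => ⟪p.2, p.1⟫ := by fun_prop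
      exact (hcont.tendsto (y, x)).eventually (lt_mem_nhds h0)
    obtain ⟨ρ, hρ, h⟩ := Metric.eventually_nhds_iff.1 this
    exact ⟨ρ, hρ, fun _ y' hy' i x hx => h hy' x (mem_iUnion.2 ⟨i, hx⟩)⟩
  choose ρ hρ hρ2 using hB
  -- finite cover
  set S0 : Set (Fin (N+1) → ℝ) := {s | ‖s‖ = 1 ∧ |s (Fin.last N)| ≤ 1/2} with hS0
  have hsph : IsCompact {s : Fin (N+1) → ℝ | ‖s‖ = 1} := by
    have h : {s : Fin (N+1) → ℝ | ‖s‖ = 1} = Metric.sphere 0 1 := by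
      ext s; simp
    rw [h]; exact isCompact_sphere _ _
  have hS0c : IsCompact S0 := hsph.inter_right (isClosed_le (by fun_prop : Continuous fun s : Fin (N+1) → ℝ => |s (Fin.last N)|) continuous_const)
  have hYc : IsCompact (yy '' S0) := hS0c.image yy_cont
  obtain ⟨t, ht, hcov⟩ := hYc.elim_nhds_subcover (fun y => Metric.ball y (ρ y)) (fun y _ => Metric.ball_mem_nhds y (hρ y))
  have hS0ne : S0.Nonempty := by
    refine ⟨Pi.single (Fin.castSucc ⟨0, by omega⟩) 1, ?_, ?_⟩
    · rw [Pi.norm_single]; simp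
    · rw [Pi.single_eq_of_ne (Fin.castSucc_lt_last _).ne']; norm_num
  set Y : Fin t.card → EuclN N := fun k => (t.equivFin.symm k : EuclN N) with hY
  have hYne : ∀ k, Y k ≠ 0 := by
    intro k
    obtain ⟨s, hs, h⟩ := ht (Y k) (t.equivFin.symm k).2
    rw [← h]; exact yy_ne hs.1 hs.2
  set φ : Fin t.card → Fin m → EuclN N → ℝ := fun k => Φ (Y k) with hφdef
  have hφt : ∀ k, IsTestFun (halfDom O (Y k)) (φ k) := fun k => (hΦ (Y k) (hYne k)).1
  have hφ : ∀ k, C1c (φ k) := fun k => test_C1c (hφt k)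
  have hφneg : ∀ k, BF c (φ k) (φ k) < 0 := fun k => (hΦ (Y k) (hYne k)).2
  set w : (Fin (N+1) → ℝ) → Fin t.card → ℝ := fun s k => max 0 (ρ (Y k) - dist (yy s) (Y k)) + max 0 (s (Fin.last N) - 1/2) with hw
  have hyc := yy_cont (N := N)
  have hwc : Continuous w := by rw [hw]; fun_prop
  have hw0 : ∀ s k, 0 ≤ w s k := fun s k => by simp only [hw]; positivity
  have hcov' : ∀ s ∈ S0, ∃ k, 0 < w s k := by
    intro s hs
    obtain ⟨y, hy, h⟩ := mem_iUnion₂.1 (hcov ⟨s, hs, rfl⟩)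
    refine ⟨t.equivFin ⟨y, hy⟩, ?_⟩
    have hYy : Y (t.equivFin ⟨y, hy⟩) = y := by simp [hY]
    simp only [hw, hYy]
    have : 0 < ρ y - dist (yy s) y := by have := Metric.mem_ball.1 h; linarith
    have h1 := lt_max_of_lt_right (b := (0:ℝ)) this
    have h2 := le_max_left 0 (s (Fin.last N) - 1/2)
    linarith
  set Sp : Set (Fin (N+1) → ℝ) := {s | ‖s‖ = 1 ∧ -(1/2) ≤ s (Fin.last N)} with hSp
  have hSpc : IsCompact Sp := hsph.inter_right (isClosed_le continuous_const (by fun_prop : Continuous fun s : Fin (N+1) → ℝ => s (Fin.last N)))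
  have hpos : ∀ s ∈ Sp, ∃ k, 0 < w s k := by
    intro s hs
    by_cases h : s (Fin.last N) ≤ 1/2
    · exact hcov' s ⟨hs.1, abs_le.2 ⟨by linarith [hs.2], h⟩⟩
    · obtain ⟨s0, hs0⟩ := hS0ne
      obtain ⟨k, -⟩ := hcov' s0 hs0
      refine ⟨k, ?_⟩
      simp only [hw]
      have h1 := lt_max_of_lt_right (b := (0:ℝ)) (by linarith : 0 < s (Fin.last N) - 1/2)
      have h2 := le_max_left 0 (ρ (Y k) - dist (yy s) (Y k))
      linarith
  have hnegs : ∀ s ∈ Sp, ∑ k, w s k * BF c (φ k) (φ k) < 0 := by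
    intro s hs
    obtain ⟨k, hk⟩ := hpos s hs
    refine Finset.sum_neg' (fun j _ => mul_nonpos_of_nonneg_of_nonpos (hw0 s j) (hφneg j).le) ⟨k, Finset.mem_univ _, mul_neg_of_pos_of_neg hk (hφneg k)⟩
  have hwk : ∀ k, Continuous fun s => w s k := fun k => (continuous_apply k).comp hwc
  obtain ⟨η, hη, hηs⟩ : ∃ η > 0, ∀ s ∈ Sp, ∑ k, w s k * BF c (φ k) (φ k) ≤ -(2 * η) := by
    have hne : Sp.Nonempty := hS0ne.mono fun s hs => ⟨hs.1, (abs_le.1 hs.2).1⟩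
    obtain ⟨s1, hs1, hmax⟩ := hSpc.exists_isMaxOn hne (f := fun s => ∑ k, w s k * BF c (φ k) (φ k)) (by fun_prop)
    refine ⟨-(∑ k, w s1 k * BF c (φ k) (φ k))/2, by linarith [hnegs s1 hs1], fun s hs => ?_⟩
    have : ∑ k, w s k * BF c (φ k) (φ k) ≤ ∑ k, w s1 k * BF c (φ k) (φ k) := hmax hs
    linarith
  obtain ⟨X, hX⟩ := hsph.exists_bound_of_continuousOn (f := fun s => ∑ k, w s k) (by fun_prop)
  obtain ⟨ε, hε, hhid⟩ := hidden hc hφ hcoop X hη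
  have hPneg : ∀ s ∈ Sp, BF c (At φ ε (w s)) (At φ ε (w s)) < 0 := by
    intro s hs
    have h1 := hhid (w s) (hw0 s) (fun k => by
      have h2 := (le_abs_self _).trans (hX s hs.1)
      exact (Finset.single_le_sum (fun j _ => hw0 s j) (Finset.mem_univ k)).trans h2)
    linarith [hηs s hs]
  have hPC := fun s => At_C1c hφ hε (hw0 s)
  have hPt : ∀ s, IsTestFun O (At φ ε (w s)) := by
    intro s i
    refine ⟨(hPC s i).1, (hPC s i).2, (At_tsupp hε i).trans (iUnion_subset fun k => ?_)⟩
    exact (hφt k i).2.2.trans fun x hx => hx.1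
  set al : (Fin (N+1) → ℝ) → ℝ := fun s => max 0 (s (Fin.last N) + 1/2) with hal
  have halc : Continuous al := by rw [hal]; fun_prop
  set F : (Fin (N+1) → ℝ) → Fin m → EuclN N → ℝ := fun s i x =>
    al s * At φ ε (w s) i x + (-(al (-s))) * At φ ε (w (-s)) i x with hF
  have hFt : ∀ s, IsTestFun O (F s) := fun s => test_comb (hPt s) (hPt (-s)) _ _
  -- support property
  have hsup : ∀ s i x, s (Fin.last N) ≤ 1/2 → x ∈ tsupport (At φ ε (w s) i) → 0 < ⟪x, yy s⟫ := by
    intro s i x hs hx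
    obtain ⟨⟨k, hk⟩, hxk⟩ := mem_iUnion.1 (At_tsupp hε i hx)
    refine hρ2 (Y k) (hYne k) (yy s) ?_ i x hxk
    by_contra hd
    apply hk
    simp only [hw]
    rw [max_eq_left (by linarith), max_eq_left (by linarith), add_zero]
  have hFneg : ∀ s, ‖s‖ = 1 → BF c (F s) (F s) < 0 := by
    intro s hs
    rw [hF]; simp only
    rw [BF_comb hc (hPC s) (hPC (-s))]
    by_cases h1 : s (Fin.last N) < 1/2
    · by_cases h2 : -(1/2) < s (Fin.last N)
      · have hx0 : BF c (At φ ε (w s)) (At φ ε (w (-s))) = 0 ∧ BF c (At φ ε (w (-s))) (At φ ε (w s)) = 0 := by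
          have key : ∀ x, (∀ i, x ∉ tsupport (At φ ε (w s) i)) ∨ (∀ i, x ∉ tsupport (At φ ε (w (-s)) i)) := by
            intro x
            by_contra hk
            push Not at hk
            obtain ⟨⟨i, hi⟩, j, hj⟩ := hk
            have a1 := hsup s i x h1.le hi
            have a2 := hsup (-s) j x (by simp only [Pi.neg_apply]; linarith) hj
            rw [yy_neg, inner_neg_right] at a2
            linarith
          unfold BF
          constructor
          · rw [← integral_zero (EuclN N) ℝ (μ := volume)]; congr 1; funext x
            exact (key x).elim bi_zero bi_zero'
          · rw [← integral_zero (EuclN N) ℝ (μ := volume)]; congr 1; funext x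
            exact (key x).elim bi_zero' bi_zero
        rw [hx0.1, hx0.2]
        have p1 : 0 < al s := lt_max_of_lt_right (by linarith)
        have p2 := hPneg s ⟨hs, h2.le⟩
        have p3 := hPneg (-s) ⟨by rwa [norm_neg], by simp only [Pi.neg_apply]; linarith⟩
        have q1 := mul_neg_of_pos_of_neg (pow_pos p1 2) p2
        have q2 := mul_nonpos_of_nonneg_of_nonpos (sq_nonneg (-al (-s))) p3.le
        linarith
      · have p0 : al s = 0 := max_eq_left (by linarith)
        have p1 : 0 < al (-s) := lt_max_of_lt_right (by simp only [Pi.neg_apply]; linarith)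
        have p3 := hPneg (-s) ⟨by rwa [norm_neg], by simp only [Pi.neg_apply]; linarith⟩
        have q1 := mul_neg_of_pos_of_neg (pow_pos p1 2) p3
        rw [p0]; linarith
    · have p0 : al (-s) = 0 := max_eq_left (by simp only [Pi.neg_apply]; linarith)
      have p1 : 0 < al s := lt_max_of_lt_right (by linarith)
      have p3 := hPneg s ⟨hs, by linarith⟩
      have q1 := mul_neg_of_pos_of_neg (pow_pos p1 2) p3
      rw [p0]; linarith
  -- maximal family
  obtain ⟨k0, hk0, hP, hnP⟩ : ∃ k ≤ N, NegDefFamily f U O k ∧ ¬ NegDefFamily f U O (k+1) := by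
    by_contra hno
    push Not at hno
    have : ∀ k ≤ N + 1, NegDefFamily f U O k := by
      intro k
      induction k with
      | zero => exact fun _ => ⟨fun l => l.elim0, fun l => l.elim0, fun t ht => absurd (Subsingleton.elim _ _) ht⟩
      | succ k ih => exact fun hk => hno k (by omega) (ih (by omega))
    exact hMorse (this _ le_rfl)
  obtain ⟨Ψ, hΨ, hΨneg⟩ := hP
  set D : (Fin (N+1) → ℝ) → Fin k0 → ℝ := fun s l => BF c (F s) (Ψ l) + BF c (Ψ l) (F s) with hD
  have hDe : ∀ s l, D s l = al s * (BF c (At φ ε (w s)) (Ψ l) + BF (fun i j => c j i) (At φ ε (w s)) (Ψ l))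
      - al (-s) * (BF c (At φ ε (w (-s))) (Ψ l) + BF (fun i j => c j i) (At φ ε (w (-s))) (Ψ l)) := by
    intro s l
    simp only [hD]
    rw [BF_swap (Ψ l) (F s), hF]; simp only
    rw [D_comb hc (hPC s) (hPC (-s)) (test_C1c (hΨ l)), D_comb (fun i j => hc j i) (hPC s) (hPC (-s)) (test_C1c (hΨ l))]
    ring
  have hDc : ∀ l, Continuous fun s => D s l := by
    intro l
    simp_rw [hDe]
    have a1 := At_param hc hφ hε hw0 hwc (test_C1c (hΨ l))
    have a2 := At_param (fun i j => hc j i) hφ hε hw0 hwc (test_C1c (hΨ l))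
    have a3 := (halc.mul (a1.add a2))
    exact a3.sub (a3.comp continuous_neg)
  have hDo : ∀ s l, D (-s) l = - D s l := by
    intro s l
    rw [hDe, hDe, neg_neg]; ring
  obtain ⟨s, hs, hs0⟩ := BU.borsuk_ulam (n := N) (fun s l => if h : (l : ℕ) < k0 then D s ⟨l, h⟩ else 0)
    (by
      refine continuous_pi fun l => ?_
      by_cases h : (l : ℕ) < k0
      · simpa [h] using hDc ⟨l, h⟩
      · simpa [h] using continuous_const)
    (by
      intro s; funext l
      by_cases h : (l : ℕ) < k0
      · simp [h, hDo]
      · simp [h])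
  refine hnP (neg_extend hc hO hcU hΨ hΨneg (hFt s) (hFneg s hs) fun l => ?_)
  have := congrFun hs0 ⟨l, by omega⟩
  simpa using this

end QF

namespace LS
open Filter Topology QF LapC

noncomputable def sqp (t : ℝ) : ℝ := (max 0 t)^2

lemma sqp_hasDeriv (t : ℝ) : HasDerivAt sqp (2 * max 0 t) t := by
  have hne : ∀ t : ℝ, t ≠ 0 → HasDerivAt sqp (2 * max 0 t) t := by
    intro t ht
    rcases lt_or_gt_of_ne ht with h | h
    · have : sqp =ᶠ[𝓝 t] fun _ => 0 := by
        filter_upwards [gt_mem_nhds h] with s hs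
        simp [sqp, max_eq_left (le_of_lt hs)]
      rw [max_eq_left h.le, mul_zero]
      exact (hasDerivAt_const t (0:ℝ)).congr_of_eventuallyEq this
    · have : sqp =ᶠ[𝓝 t] fun s => s^2 := by
        filter_upwards [lt_mem_nhds h] with s hs
        simp [sqp, max_eq_right (le_of_lt hs)]
      rw [max_eq_right h.le]
      refine HasDerivAt.congr_of_eventuallyEq ?_ this
      simpa using hasDerivAt_pow 2 t
  by_cases ht : t = 0
  · subst ht
    refine hasDerivAt_of_hasDerivAt_of_ne (g := fun t => 2 * max 0 t) (fun y hy => hne y hy) ?_ ?_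
    · unfold sqp; fun_prop
    · fun_prop
  · exact hne t ht

lemma sqp_nonneg (t : ℝ) : 0 ≤ sqp t := sq_nonneg _

lemma sqp_C1 : ContDiff ℝ 1 sqp := by
  rw [contDiff_one_iff_deriv]
  refine ⟨fun t => (sqp_hasDeriv t).differentiableAt, ?_⟩
  have : deriv sqp = fun t => 2 * max 0 t := funext fun t => (sqp_hasDeriv t).deriv
  rw [this]; fun_prop

noncomputable def eta (δ t : ℝ) : ℝ := √(sqp (t - δ) + δ^2) - δ
noncomputable def eta' (δ t : ℝ) : ℝ := max 0 (t - δ) / √(sqp (t - δ) + δ^2)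

variable {δ : ℝ}

lemma eta_pos (hδ : 0 < δ) (t : ℝ) : 0 < sqp (t - δ) + δ^2 := by
  have := sqp_nonneg (t-δ); positivity

lemma eta_hasDeriv (hδ : 0 < δ) (t : ℝ) : HasDerivAt (eta δ) (eta' δ t) t := by
  have h1 : HasDerivAt (fun t => sqp (t - δ) + δ^2) (2 * max 0 (t - δ)) t := by
    have := (((sqp_hasDeriv (t - δ)).comp t ((hasDerivAt_id t).sub_const δ)).add_const (δ^2))
    simpa using this
  have h2 := (h1.sqrt (eta_pos hδ t).ne').sub_const δ
  refine h2.congr_deriv ?_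
  unfold eta'
  rw [mul_div_mul_left _ _ two_ne_zero]

lemma eta_C1 (hδ : 0 < δ) : ContDiff ℝ 1 (eta δ) := by
  refine ContDiff.sub (ContDiff.sqrt ?_ fun t => (eta_pos hδ t).ne') contDiff_const
  exact (sqp_C1.comp (contDiff_id.sub contDiff_const)).add contDiff_const

lemma eta_zero (hδ : 0 < δ) {t : ℝ} (ht : t ≤ δ) : eta δ t = 0 := by
  simp [eta, sqp, max_eq_left (sub_nonpos.2 ht), Real.sqrt_sq hδ.le]

lemma eta_nonneg (hδ : 0 < δ) (t : ℝ) : 0 ≤ eta δ t := by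
  have : δ ≤ √(sqp (t - δ) + δ^2) := Real.le_sqrt_of_sq_le (by linarith [sqp_nonneg (t - δ)])
  unfold eta; linarith

lemma eta_le (hδ : 0 < δ) (t : ℝ) : eta δ t ≤ max 0 t := by
  have h0 : max 0 (t - δ) ≤ max 0 t := max_le_max le_rfl (by linarith)
  have : √(sqp (t - δ) + δ^2) ≤ max 0 (t - δ) + δ := by
    refine Real.sqrt_le_iff.2 ⟨by positivity, ?_⟩
    have := le_max_left 0 (t - δ)
    unfold sqp; nlinarith
  unfold eta; linarith

lemma eta_ge (hδ : 0 < δ) (t : ℝ) : max 0 t - 2 * δ ≤ eta δ t := by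
  have h0 : max 0 t ≤ max 0 (t - δ) + δ :=
    max_le (by positivity) (by linarith [le_max_right 0 (t - δ)])
  have : max 0 (t - δ) ≤ √(sqp (t - δ) + δ^2) := Real.le_sqrt_of_sq_le (by unfold sqp; nlinarith)
  unfold eta; linarith

lemma eta'_nonneg (t : ℝ) : 0 ≤ eta' δ t := div_nonneg (le_max_left _ _) (Real.sqrt_nonneg _)

lemma eta'_le_one (hδ : 0 < δ) (t : ℝ) : eta' δ t ≤ 1 := by
  refine (div_le_one (Real.sqrt_pos.2 (eta_pos hδ t))).2 ?_
  exact Real.le_sqrt_of_sq_le (by unfold sqp; nlinarith)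

lemma eta'_zero {t : ℝ} (ht : t ≤ δ) : eta' δ t = 0 := by
  simp [eta', max_eq_left (sub_nonpos.2 ht)]

lemma eta'_half (hδ : 0 < δ) {t : ℝ} (ht : 2 * δ ≤ t) : 1/2 ≤ eta' δ t := by
  have hs : max 0 (t - δ) = t - δ := max_eq_right (by linarith)
  unfold eta'
  rw [le_div_iff₀ (Real.sqrt_pos.2 (eta_pos hδ t)), hs]
  have : √(sqp (t - δ) + δ^2) ≤ 2 * (t - δ) := by
    refine Real.sqrt_le_iff.2 ⟨by linarith, ?_⟩
    unfold sqp; rw [hs]; nlinarith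
  linarith

variable {N m : ℕ}

lemma lap_contOn {O : Set (EuclN N)} (hO : IsOpen O) {V : EuclN N → ℝ} (hV : ContDiffOn ℝ 2 V O) :
    ContinuousOn (lap V) O := by
  have h1 := hV.continuousOn_iteratedFDerivWithin (m := 2) le_rfl hO.uniqueDiffOn
  have h2 : ContinuousOn (iteratedFDeriv ℝ 2 V) O :=
    h1.congr fun x hx => (iteratedFDerivWithin_of_isOpen 2 hO hx).symm
  unfold lap
  refine continuousOn_finset_sum _ fun i _ => ?_
  exact (ContinuousMultilinearMap.apply ℝ (fun _ : Fin 2 => EuclN N) ℝ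
    ![EuclideanSpace.single i 1, EuclideanSpace.single i 1]).continuous.comp_continuousOn h2

lemma grad_contOn {O : Set (EuclN N)} (hO : IsOpen O) {V : EuclN N → ℝ} (hV : ContDiffOn ℝ 1 V O) :
    ContinuousOn (gradient V) O :=
  (InnerProductSpace.toDual ℝ (EuclN N)).symm.continuous.comp_continuousOn
    (hV.continuousOn_fderiv_of_isOpen hO le_rfl)

lemma int_of {O K : Set (EuclN N)} {F : EuclN N → ℝ} (hF : ContinuousOn F O) (hK : IsCompact K)
    (hKO : K ⊆ O) (h0 : ∀ x ∉ K, F x = 0) : Integrable F :=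
  ((hF.mono hKO).integrableOn_compact hK).integrable_of_forall_notMem_eq_zero h0

open Classical in
noncomputable def Pd (O : Set (EuclN N)) (V : Fin m → EuclN N → ℝ) (δ : ℝ) (i : Fin m) (x : EuclN N) : ℝ :=
  if x ∈ O then eta δ (V i x) else 0

/-- data for Lemma S -/
structure Dat (c : Fin m → Fin m → EuclN N → ℝ) (O B : Set (EuclN N)) (V : Fin m → EuclN N → ℝ) : Prop where
  hc : ∀ i j, Continuous (c i j)
  coop : ∀ i j, i ≠ j → ∀ x, 0 ≤ c i j x
  hO : IsOpen O
  hOc : IsPreconnected O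
  hB : IsCompact B
  hOB : O ⊆ B
  hQ : ∀ Ψ, IsTestFun O Ψ → 0 ≤ BF c Ψ Ψ
  hV : ∀ i, ContDiffOn ℝ 2 (V i) O
  hVB : ∀ i, ContinuousOn (V i) B
  hV0 : ∀ i, ∀ x ∈ B, x ∉ O → V i x = 0
  hsub : ∀ i, ∀ x ∈ O, 0 < V i x → - lap (V i) x ≤ ∑ j, c i j x * max 0 (V j x)

namespace Dat
variable {c : Fin m → Fin m → EuclN N → ℝ} {O B : Set (EuclN N)} {V : Fin m → EuclN N → ℝ}

def KK (_ : Dat c O B V) (δ : ℝ) (i : Fin m) : Set (EuclN N) := B ∩ {x | δ ≤ V i x}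

variable (D : Dat c O B V)
include D

lemma KK_compact (i) : IsCompact (D.KK δ i) :=
  D.hB.of_isClosed_subset ((D.hVB i).preimage_isClosed_of_isClosed D.hB.isClosed isClosed_Ici) inter_subset_left

lemma KK_sub (hδ : 0 < δ) (i) : D.KK δ i ⊆ O := by
  rintro x ⟨hx, h⟩
  by_contra hn
  have := D.hV0 i x hx hn
  simp only [mem_setOf_eq] at h; linarith

lemma Pd_zero (hδ : 0 < δ) {i x} (hx : x ∉ D.KK δ i) : Pd O V δ i x = 0 := by
  unfold Pd
  split_ifs with h
  · refine eta_zero hδ ?_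
    by_contra hn
    exact hx ⟨D.hOB h, (not_le.1 hn).le⟩
  · rfl

lemma Pd_eq {i x} (hx : x ∈ O) : Pd O V δ i =ᶠ[𝓝 x] fun y => eta δ (V i y) := by
  filter_upwards [D.hO.mem_nhds hx] with y hy
  simp [Pd, hy]

lemma Pd_tsupp (hδ : 0 < δ) (i) : tsupport (Pd O V δ i) ⊆ D.KK δ i := by
  refine closure_minimal ?_ (D.KK_compact i).isClosed
  intro x hx
  by_contra h
  exact hx (D.Pd_zero hδ h)

lemma Pd_test (hδ : 0 < δ) : IsTestFun O (Pd O V δ) := by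
  intro i
  refine ⟨?_, (D.KK_compact i).of_isClosed_subset (isClosed_tsupport _) (D.Pd_tsupp hδ i), (D.Pd_tsupp hδ i).trans (D.KK_sub hδ i)⟩
  rw [contDiff_iff_contDiffAt]
  intro x
  by_cases hx : x ∈ O
  · refine ContDiffAt.congr_of_eventuallyEq ?_ (D.Pd_eq hx)
    exact (eta_C1 hδ).contDiffAt.comp x (((D.hV i).contDiffAt (D.hO.mem_nhds hx)).of_le (by norm_num))
  · have hxK : x ∉ D.KK δ i := fun h => hx (D.KK_sub hδ i h)
    have : Pd O V δ i =ᶠ[𝓝 x] fun _ => 0 := by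
      filter_upwards [(D.KK_compact i).isClosed.isOpen_compl.mem_nhds hxK] with y hy
      exact D.Pd_zero hδ hy
    exact contDiffAt_const.congr_of_eventuallyEq this

lemma Pd_grad (hδ : 0 < δ) {i x} (hx : x ∈ O) :
    gradient (Pd O V δ i) x = eta' δ (V i x) • gradient (V i) x := by
  have hd : HasFDerivAt (V i) (fderiv ℝ (V i) x) x :=
    (((D.hV i).contDiffAt (D.hO.mem_nhds hx)).differentiableAt (by norm_num)).hasFDerivAt
  have h1 := (eta_hasDeriv hδ (V i x)).comp_hasFDerivAt x hd
  have h2 := (h1.congr_of_eventuallyEq (D.Pd_eq hx)).fderiv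
  unfold gradient
  rw [h2, map_smul]

lemma gradV (i) : ContinuousOn (gradient (V i)) O := grad_contOn D.hO ((D.hV i).of_le (by norm_num))

lemma est : ∃ C : ℝ, 0 ≤ C ∧ ∀ δ, 0 < δ → BF c (Pd O V δ) (Pd O V δ) +
    ∫ x, ∑ i, Pd O V δ i x * (lap (V i) x + ∑ j, c i j x * max 0 (V j x)) ≤ C * δ := by
  obtain ⟨C0, hC0⟩ := D.hB.exists_bound_of_continuousOn (f := fun x => ∑ i, ∑ j, |V i x| * |c i j x| * 2) (by
    refine continuousOn_finset_sum _ fun i _ => continuousOn_finset_sum _ fun j _ => ?_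
    exact ((D.hVB i).abs.mul (D.hc i j).abs.continuousOn).mul continuousOn_const)
  refine ⟨|C0| * volume.real B, by positivity, fun δ hδ => ?_⟩
  have hT := D.Pd_test hδ
  have hTc := test_C1c hT
  set P := Pd O V δ with hP
  set K : Set (EuclN N) := ⋃ i, D.KK δ i with hK
  have hKc : IsCompact K := isCompact_iUnion fun i => D.KK_compact i
  have hKO : K ⊆ O := iUnion_subset fun i => D.KK_sub hδ i
  have hPK : ∀ i, ∀ x ∉ K, P i x = 0 := fun i x hx => D.Pd_zero hδ fun h => hx (mem_iUnion.2 ⟨i, h⟩)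
  have hGK : ∀ i, ∀ x ∉ K, gradient (P i) x = 0 := fun i x hx => grad_zero_of fun h =>
    hx (mem_iUnion.2 ⟨i, D.Pd_tsupp hδ i h⟩)
  have hPc : ∀ i, Continuous (P i) := fun i => (hTc i).1.continuous
  have hPg : ∀ i, Continuous (gradient (P i)) := fun i => grad_cont (hTc i).1
  have hVc : ∀ i, ContinuousOn (V i) O := fun i => (D.hV i).continuousOn
  have hl : ∀ i, ContinuousOn (lap (V i)) O := fun i => lap_contOn D.hO (D.hV i)
  have i1 : ∀ i, Integrable fun x => ⟪gradient (V i) x, gradient (P i) x⟫ := fun i =>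
    int_of ((D.gradV i).inner (hPg i).continuousOn) hKc hKO (fun x hx => by rw [hGK i x hx, inner_zero_right])
  have i2 : Integrable fun x => ∑ i, ∑ j, c i j x * P i x * P j x := by
    refine int_of (O := O) ?_ hKc hKO (fun x hx => by simp [hPK _ x hx])
    have := D.hc
    exact Continuous.continuousOn (by fun_prop)
  have i3 : ∀ i, Integrable fun x => (- lap (V i) x) * P i x := fun i =>
    int_of ((hl i).neg.mul (hPc i).continuousOn) hKc hKO (fun x hx => by rw [hPK i x hx, mul_zero])
  have i4 : Integrable fun x => ∑ i, P i x * (lap (V i) x + ∑ j, c i j x * max 0 (V j x)) := by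
    refine int_of (O := O) ?_ hKc hKO (fun x hx => by simp [hPK _ x hx])
    refine continuousOn_finset_sum _ fun i _ => (hPc i).continuousOn.mul ((hl i).add ?_)
    refine continuousOn_finset_sum _ fun j _ => (D.hc i j).continuousOn.mul ?_
    exact (by fun_prop : Continuous fun t : ℝ => max 0 t).comp_continuousOn (hVc j)
  have i5 : Integrable (B.indicator fun _ : EuclN N => |C0| * δ) :=
    (integrableOn_const D.hB.measure_lt_top.ne).integrable_indicator D.hB.isClosed.measurableSet
  have s1 : BF c P P ≤ ∫ x, ((∑ i, ⟪gradient (V i) x, gradient (P i) x⟫) - ∑ i, ∑ j, c i j x * P i x * P j x) := by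
    refine integral_mono (bi_int D.hc hTc hTc) ((integrable_finset_sum _ fun i _ => i1 i).sub i2) ?_
    intro x
    unfold bi
    simp only
    refine sub_le_sub_right (Finset.sum_le_sum fun i _ => ?_) _
    by_cases hx : x ∈ O
    · rw [hP, D.Pd_grad hδ hx, inner_smul_left, inner_smul_right, real_inner_self_eq_norm_sq]
      have a1 := eta'_nonneg (δ := δ) (V i x)
      have a2 := eta'_le_one hδ (V i x)
      simp only [conj_trivial]
      have : 0 ≤ eta' δ (V i x) * ‖gradient (V i) x‖^2 := by positivity
      nlinarith
    · rw [hGK i x fun h => hx (hKO h)]; simp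
  have s2 : ∫ x, ((∑ i, ⟪gradient (V i) x, gradient (P i) x⟫) - ∑ i, ∑ j, c i j x * P i x * P j x) =
      ∫ x, ((∑ i, (- lap (V i) x) * P i x) - ∑ i, ∑ j, c i j x * P i x * P j x) := by
    rw [integral_sub (integrable_finset_sum _ fun i _ => i1 i) i2,
      integral_sub (integrable_finset_sum _ fun i _ => i3 i) i2,
      integral_finset_sum _ (fun i _ => i1 i), integral_finset_sum _ (fun i _ => i3 i)]
    congr 1
    exact Finset.sum_congr rfl fun i _ => ibp D.hO (D.hV i) (hTc i).1 (hTc i).2 (hT i).2.2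
  rw [s2] at s1
  have i6 : Integrable fun x => (∑ i, (- lap (V i) x) * P i x) - ∑ i, ∑ j, c i j x * P i x * P j x :=
    (integrable_finset_sum _ fun i _ => i3 i).sub i2
  have s3 : (∫ x, ((∑ i, (- lap (V i) x) * P i x) - ∑ i, ∑ j, c i j x * P i x * P j x)) +
      (∫ x, ∑ i, P i x * (lap (V i) x + ∑ j, c i j x * max 0 (V j x))) ≤ ∫ x, B.indicator (fun _ => |C0| * δ) x := by
    rw [← integral_add i6 i4]
    refine integral_mono (i6.add i4) i5 ?_
    intro x
    simp only
    by_cases hx : x ∈ O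
    · rw [indicator_of_mem (D.hOB hx)]
      have e1 : ((∑ i, (- lap (V i) x) * P i x) - ∑ i, ∑ j, c i j x * P i x * P j x) +
        ∑ i, P i x * (lap (V i) x + ∑ j, c i j x * max 0 (V j x)) =
        ∑ i, ∑ j, c i j x * P i x * (max 0 (V j x) - P j x) := by
        simp only [mul_sub, Finset.sum_sub_distrib, mul_add, Finset.sum_add_distrib, Finset.mul_sum]
        have : ∀ i, -lap (V i) x * P i x = - (P i x * lap (V i) x) := fun i => by ring
        simp only [this, Finset.sum_neg_distrib]
        have : ∀ i j, P i x * (c i j x * max 0 (V j x)) = c i j x * P i x * max 0 (V j x) := fun i j => by ring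
        simp only [this]; ring
      rw [e1]
      have e2 : ∑ i, ∑ j, c i j x * P i x * (max 0 (V j x) - P j x) ≤ (∑ i, ∑ j, |V i x| * |c i j x| * 2) * δ := by
        simp only [Finset.sum_mul]
        refine Finset.sum_le_sum fun i _ => Finset.sum_le_sum fun j _ => ?_
        have hPx : ∀ i, P i x = eta δ (V i x) := fun i => by simp [hP, Pd, hx]
        have b1 : |P i x| ≤ |V i x| := by
          rw [hPx, abs_of_nonneg (eta_nonneg hδ _)]
          exact (eta_le hδ _).trans (max_le (abs_nonneg _) (le_abs_self _))
        have b2 : |max 0 (V j x) - P j x| ≤ 2 * δ := by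
          rw [hPx, abs_of_nonneg (by linarith [eta_le hδ (V j x)])]
          linarith [eta_ge hδ (V j x)]
        calc _ ≤ |c i j x * P i x * (max 0 (V j x) - P j x)| := le_abs_self _
          _ = |c i j x| * |P i x| * |max 0 (V j x) - P j x| := by rw [abs_mul, abs_mul]
          _ ≤ |c i j x| * |V i x| * (2 * δ) := by gcongr
          _ = _ := by ring
      have e3 : ∑ i, ∑ j, |V i x| * |c i j x| * 2 ≤ |C0| :=
        (le_abs_self _).trans ((hC0 x (D.hOB hx)).trans (le_abs_self _))
      exact e2.trans (mul_le_mul_of_nonneg_right e3 hδ.le)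
    · have : ∀ i, P i x = 0 := fun i => hPK i x fun h => hx (hKO h)
      simp only [this]
      simp only [mul_zero, zero_mul, Finset.sum_const_zero, sub_zero, add_zero]
      exact indicator_nonneg (fun _ _ => by positivity) _
  rw [integral_indicator D.hB.isClosed.measurableSet, setIntegral_const, smul_eq_mul] at s3
  linarith

lemma term_nonneg (hδ : 0 < δ) (i x) : 0 ≤ Pd O V δ i x * (lap (V i) x + ∑ j, c i j x * max 0 (V j x)) := by
  by_cases hx : x ∈ D.KK δ i
  · have hxO := D.KK_sub hδ i hx
    have h1 := D.hsub i x hxO (lt_of_lt_of_le hδ hx.2)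
    refine mul_nonneg ?_ (by linarith)
    simp only [Pd, hxO, if_true]; exact eta_nonneg hδ _
  · rw [D.Pd_zero hδ hx, zero_mul]

end Dat
end LS

namespace LS
open Filter Topology QF LapC
variable {N m : ℕ} {δ : ℝ}

def sing (i : Fin m) (φ : EuclN N → ℝ) : Fin m → EuclN N → ℝ := fun k => if k = i then φ else fun _ => 0

lemma sing_test {O : Set (EuclN N)} {φ : EuclN N → ℝ} (h : ContDiff ℝ 1 φ) (hc : HasCompactSupport φ)
    (hs : tsupport φ ⊆ O) (i : Fin m) : IsTestFun O (sing i φ) := by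
  intro k
  unfold sing
  split_ifs
  · exact ⟨h, hc, hs⟩
  · exact test_zero (m := 1) 0

lemma grad_zero_fun (x : EuclN N) : gradient (fun _ : EuclN N => (0:ℝ)) x = 0 := by simp [gradient]

lemma bi_sing (c : Fin m → Fin m → EuclN N → ℝ) (P : Fin m → EuclN N → ℝ) (i : Fin m) (φ : EuclN N → ℝ) (x) :
    bi c P (sing i φ) x + bi c (sing i φ) P x =
      2 * ⟪gradient (P i) x, gradient φ x⟫ - φ x * ∑ k, (c i k x + c k i x) * P k x := by
  have e1 : ∀ k, gradient (sing i φ k) x = if k = i then gradient φ x else 0 := by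
    intro k; unfold sing; split_ifs
    · rfl
    · exact grad_zero_fun x
  have e2 : ∀ k, sing i φ k x = if k = i then φ x else 0 := by
    intro k; unfold sing; split_ifs <;> rfl
  unfold bi
  simp only [e1, e2]
  have a1 : ∑ k, ⟪gradient (P k) x, if k = i then gradient φ x else 0⟫ = ⟪gradient (P i) x, gradient φ x⟫ := by
    rw [Finset.sum_eq_single i] <;> simp +contextual
  have a2 : ∑ k, ⟪if k = i then gradient φ x else 0, gradient (P k) x⟫ = ⟪gradient (P i) x, gradient φ x⟫ := by
    rw [← a1]; refine Finset.sum_congr rfl fun k _ => real_inner_comm _ _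
  have a3 : ∑ k, ∑ j, c k j x * P k x * (if j = i then φ x else 0) = ∑ k, φ x * (c k i x * P k x) := by
    refine Finset.sum_congr rfl fun k _ => ?_
    rw [Finset.sum_eq_single i] <;> simp +contextual
    ring
  have a4 : ∑ k, ∑ j, c k j x * (if k = i then φ x else 0) * P j x = ∑ k, φ x * (c i k x * P k x) := by
    rw [Finset.sum_eq_single i]
    · simp; exact Finset.sum_congr rfl fun k _ => by ring
    · intro b _ hb; simp [hb]
    · simp
  rw [a1, a2, a3, a4, Finset.mul_sum]
  have : ∑ k, φ x * ((c i k x + c k i x) * P k x) = ∑ k, φ x * (c i k x * P k x) + ∑ k, φ x * (c k i x * P k x) := by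
    rw [← Finset.sum_add_distrib]; exact Finset.sum_congr rfl fun k _ => by ring
  rw [this]; ring

/-- bump -/
noncomputable def bmp (x0 : EuclN N) (ε : ℝ) (x : EuclN N) : ℝ := sqp (1 - ‖x - x0‖^2/ε^2)

lemma bmp_C1 (x0 : EuclN N) (ε : ℝ) : ContDiff ℝ 1 (bmp x0 ε) := by
  refine sqp_C1.comp (contDiff_const.sub (ContDiff.div_const ?_ _))
  exact (contDiff_id.sub contDiff_const).norm_sq ℝ

lemma bmp_nonneg (x0 : EuclN N) (ε : ℝ) (x) : 0 ≤ bmp x0 ε x := sqp_nonneg _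

lemma bmp_le (x0 : EuclN N) (ε : ℝ) (x) : bmp x0 ε x ≤ 1 := by
  unfold bmp sqp
  have : 0 ≤ ‖x - x0‖^2/ε^2 := by positivity
  have h1 : max 0 (1 - ‖x - x0‖^2/ε^2) ≤ 1 := max_le (by norm_num) (by linarith)
  have h2 := le_max_left 0 (1 - ‖x - x0‖^2/ε^2)
  nlinarith

lemma bmp_tsupp (x0 : EuclN N) {ε : ℝ} (hε : 0 < ε) : tsupport (bmp x0 ε) ⊆ Metric.closedBall x0 ε := by
  refine closure_minimal ?_ Metric.isClosed_closedBall
  intro x hx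
  by_contra h
  refine hx ?_
  rw [Metric.mem_closedBall, dist_eq_norm, not_le] at h
  have : 1 ≤ ‖x - x0‖^2/ε^2 := by
    rw [le_div_iff₀ (by positivity)]; nlinarith
  unfold bmp sqp
  rw [max_eq_left (by linarith)]; norm_num

lemma bmp_supp (x0 : EuclN N) {ε : ℝ} (hε : 0 < ε) : HasCompactSupport (bmp x0 ε) :=
  (isCompact_closedBall x0 ε).of_isClosed_subset (isClosed_tsupport _) (bmp_tsupp x0 hε)

lemma bmp_pos (x0 : EuclN N) {ε : ℝ} (hε : 0 < ε) {x : EuclN N} (h : ‖x - x0‖ ≤ ε/2) : 9/16 ≤ bmp x0 ε x := by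
  have : ‖x - x0‖^2/ε^2 ≤ 1/4 := by
    rw [div_le_iff₀ (by positivity)]; nlinarith [norm_nonneg (x - x0)]
  unfold bmp sqp
  rw [max_eq_right (by linarith)]; nlinarith

lemma bmp_grad (x0 : EuclN N) (ε : ℝ) (v x : EuclN N) :
    ⟪v, gradient (bmp x0 ε) x⟫ = - (4/ε^2 * max 0 (1 - ‖x - x0‖^2/ε^2) * ⟪v, x - x0⟫) := by
  have h1 : HasFDerivAt (fun x : EuclN N => 1 - ‖x - x0‖^2/ε^2) (-((ε^2)⁻¹ • (2 • (innerSL ℝ (x - x0))))) x := by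
    have h0 : HasFDerivAt (fun x : EuclN N => ‖x - x0‖^2) (2 • (innerSL ℝ (x - x0))) x := by
      have := ((hasFDerivAt_id x).sub_const x0).norm_sq
      simpa using this
    have := (h0.const_mul ((ε^2)⁻¹)).const_sub 1
    refine this.congr_of_eventuallyEq (Eventually.of_forall fun y => ?_)
    simp only; ring
  have h2 := (sqp_hasDeriv (1 - ‖x - x0‖^2/ε^2)).comp_hasFDerivAt x h1
  have h3 : fderiv ℝ (bmp x0 ε) x = _ := h2.fderiv
  rw [real_inner_comm]
  unfold gradient
  rw [InnerProductSpace.toDual_symm_apply, h3]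
  rw [← real_inner_comm v]
  simp only [ContinuousLinearMap.smul_apply, ContinuousLinearMap.neg_apply, innerSL_apply_apply, smul_eq_mul, nsmul_eq_mul]
  push_cast
  ring

namespace Dat
variable {c : Fin m → Fin m → EuclN N → ℝ} {O B : Set (EuclN N)} {V : Fin m → EuclN N → ℝ}
variable (D : Dat c O B V)
include D

lemma Gcont (i) : ContinuousOn (fun x => lap (V i) x + ∑ j, c i j x * max 0 (V j x)) O := by
  refine (lap_contOn D.hO (D.hV i)).add ?_
  refine continuousOn_finset_sum _ fun j _ => (D.hc i j).continuousOn.mul ?_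
  exact (by fun_prop : Continuous fun t : ℝ => max 0 t).comp_continuousOn (D.hV j).continuousOn

lemma est_int (hδ : 0 < δ) : Integrable fun x => ∑ i, Pd O V δ i x * (lap (V i) x + ∑ j, c i j x * max 0 (V j x)) := by
  have hT := D.Pd_test hδ
  refine integrable_finset_sum _ fun i _ => ?_
  refine int_of ((hT i).1.continuous.continuousOn.mul (D.Gcont i)) (D.KK_compact (δ := δ) i) (D.KK_sub hδ i)
    (fun x hx => by simp [D.Pd_zero hδ hx])

lemma BF_le : ∃ C : ℝ, 0 ≤ C ∧ ∀ δ, 0 < δ → BF c (Pd O V δ) (Pd O V δ) ≤ C * δ := by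
  obtain ⟨C, hC, h⟩ := D.est
  refine ⟨C, hC, fun δ hδ => ?_⟩
  have := h δ hδ
  have h2 : 0 ≤ ∫ x, ∑ i, Pd O V δ i x * (lap (V i) x + ∑ j, c i j x * max 0 (V j x)) :=
    integral_nonneg fun x => Finset.sum_nonneg fun i _ => D.term_nonneg hδ i x
  linarith

lemma g_zero {i x} (hx : x ∈ O) (hv : 0 < V i x) : lap (V i) x + ∑ j, c i j x * max 0 (V j x) = 0 := by
  by_contra hne
  have hge : 0 ≤ lap (V i) x + ∑ j, c i j x * max 0 (V j x) := by linarith [D.hsub i x hx hv]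
  set G := fun x => lap (V i) x + ∑ j, c i j x * max 0 (V j x) with hG
  have hgp : 0 < G x := lt_of_le_of_ne hge (Ne.symm hne)
  have n1 := ((D.Gcont i).continuousAt (D.hO.mem_nhds hx)).eventually (lt_mem_nhds (show G x / 2 < G x by linarith))
  have n2 := ((D.hV i).continuousOn.continuousAt (D.hO.mem_nhds hx)).eventually (lt_mem_nhds (show V i x / 2 < V i x by linarith))
  obtain ⟨ρ, hρ, hb⟩ := Metric.eventually_nhds_iff_ball.1 (n1.and (n2.and (D.hO.mem_nhds hx)))
  obtain ⟨C, hC, h⟩ := D.est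
  set κ := V i x / 4 * (G x / 2) * volume.real (Metric.ball x ρ) with hκ
  have hvol : 0 < volume.real (Metric.ball x ρ) :=
    ENNReal.toReal_pos (Metric.measure_ball_pos _ _ hρ).ne' measure_ball_lt_top.ne
  have hκp : 0 < κ := by positivity
  set δ := min (V i x / 8) (κ / (2 * (C + 1))) with hδd
  have hδ : 0 < δ := lt_min (by positivity) (by positivity)
  have h1 := h δ hδ
  have h2 := D.hQ _ (D.Pd_test hδ)
  have h3 : κ ≤ ∫ x, ∑ i, Pd O V δ i x * (lap (V i) x + ∑ j, c i j x * max 0 (V j x)) := by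
    calc κ = ∫ y in Metric.ball x ρ, V i x / 4 * (G x / 2) := by
          rw [setIntegral_const, smul_eq_mul]; ring
      _ ≤ ∫ y in Metric.ball x ρ, ∑ i, Pd O V δ i y * (lap (V i) y + ∑ j, c i j y * max 0 (V j y)) := by
          refine setIntegral_mono_on (integrableOn_const measure_ball_lt_top.ne) (D.est_int hδ).integrableOn measurableSet_ball ?_
          intro y hy
          obtain ⟨b1, b2, b3⟩ := hb y hy
          refine le_trans ?_ (Finset.single_le_sum (f := fun i => Pd O V δ i y * (lap (V i) y + ∑ j, c i j y * max 0 (V j y))) (fun k _ => D.term_nonneg hδ k y) (Finset.mem_univ i))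
          have hy' : y ∈ O := b3
          simp only [Pd, hy', if_true]
          have := eta_ge hδ (V i y)
          have := le_max_right 0 (V i y)
          have : δ ≤ V i x / 8 := min_le_left _ _
          have b4 : V i x / 4 ≤ eta δ (V i y) := by linarith
          exact mul_le_mul b4 b1.le (by positivity) (eta_nonneg hδ _)
      _ ≤ _ := setIntegral_le_integral (D.est_int hδ) (Eventually.of_forall fun y => Finset.sum_nonneg fun k _ => D.term_nonneg hδ k y)
  have h4 : C * δ ≤ κ / 2 := by
    have : δ ≤ κ / (2 * (C + 1)) := min_le_right _ _
    rw [le_div_iff₀ (by positivity)] at this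
    nlinarith
  linarith

lemma no_neg {φ : Fin m → EuclN N → ℝ} (hφ : IsTestFun O φ) {κ δ0 : ℝ} (hκ : 0 < κ) (hδ0 : 0 < δ0)
    (h : ∀ δ, 0 < δ → δ < δ0 → BF c (Pd O V δ) φ + BF c φ (Pd O V δ) ≤ -κ) : False := by
  obtain ⟨C, hC, hB⟩ := D.BF_le
  have hq := D.hQ φ hφ
  set q := BF c φ φ
  set s := κ / (2 * (q + 1)) with hs
  have hsp : 0 < s := by positivity
  set δ := min (δ0 / 2) (s * κ / (4 * (C + 1))) with hδd
  have hδ : 0 < δ := lt_min (by positivity) (by positivity)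
  have h1 := h δ hδ (lt_of_le_of_lt (min_le_left _ _) (by linarith))
  have h2 := D.hQ _ (test_lin hφ (D.Pd_test hδ) s)
  rw [BF_expand D.hc (test_C1c hφ) (test_C1c (D.Pd_test hδ)) s] at h2
  have h3 := hB δ hδ
  have h4 : C * δ ≤ s * κ / 4 := by
    have : δ ≤ s * κ / (4 * (C + 1)) := min_le_right _ _
    rw [le_div_iff₀ (by positivity)] at this
    nlinarith
  have h5 : s * (q + 1) = κ / 2 := by rw [hs]; field_simp
  have h6 : s^2 * q ≤ s * κ / 2 := by
    have : s^2 * q = s * (s * (q + 1)) - s^2 := by ring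
    rw [this, h5]; nlinarith
  have h7 : s * (BF c φ (Pd O V δ) + BF c (Pd O V δ) φ) ≤ s * (-κ) := mul_le_mul_of_nonneg_left (by linarith) hsp.le
  have : 0 < s * κ := by positivity
  change 0 ≤ s^2 * q + _ + _ at h2
  linarith

lemma D_int (hδ : 0 < δ) {φ : EuclN N → ℝ} {i : Fin m} (hφ : IsTestFun O (sing i φ)) :
    Integrable (fun x => 2 * ⟪gradient (Pd O V δ i) x, gradient φ x⟫ - φ x * ∑ k, (c i k x + c k i x) * Pd O V δ k x) ∧
    BF c (Pd O V δ) (sing i φ) + BF c (sing i φ) (Pd O V δ) =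
      ∫ x, (2 * ⟪gradient (Pd O V δ i) x, gradient φ x⟫ - φ x * ∑ k, (c i k x + c k i x) * Pd O V δ k x) := by
  have a1 := bi_int D.hc (test_C1c (D.Pd_test hδ)) (test_C1c hφ)
  have a2 := bi_int D.hc (test_C1c hφ) (test_C1c (D.Pd_test hδ))
  simp_rw [← bi_sing]
  exact ⟨a1.add a2, (integral_add a1 a2).symm⟩

set_option maxHeartbeats 2000000 in
lemma bad {i x0} (hx0 : x0 ∈ O) (hz : V i x0 = 0) (hne : fderiv ℝ (V i) x0 ≠ 0) : False := by
  set g := gradient (V i) x0 with hg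
  have hfd : ∀ y, fderiv ℝ (V i) x0 y = ⟪g, y⟫ := fun y => by
    rw [hg]; unfold gradient; rw [InnerProductSpace.toDual_symm_apply]
  have hgne : g ≠ 0 := by
    intro h; apply hne; ext y; rw [hfd, h]; simp
  set G := ‖g‖ with hGd
  have hG : 0 < G := norm_pos_iff.2 hgne
  set q : ℝ := (4^N)⁻¹ with hq
  have hq0 : 0 < q := by positivity
  have hq1 : q ≤ 1 := inv_le_one_of_one_le₀ (one_le_pow₀ (by norm_num))
  set τ : ℝ := q / 256 with hτ
  have hτ0 : 0 < τ := by positivity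
  obtain ⟨M, hM⟩ := D.hB.exists_bound_of_continuousOn (f := fun x => ∑ k, (|c i k x| + |c k i x|) * |V k x|) (by
    refine continuousOn_finset_sum _ fun k _ => ContinuousOn.mul ?_ (D.hVB k).abs
    exact ((D.hc i k).abs.add (D.hc k i).abs).continuousOn)
  have hM0 : 0 ≤ |M| := abs_nonneg M
  have hdiff : HasFDerivAt (V i) (fderiv ℝ (V i) x0) x0 :=
    (((D.hV i).contDiffAt (D.hO.mem_nhds hx0)).differentiableAt (by norm_num)).hasFDerivAt
  have n1 := hdiff.isLittleO.def (c := τ * G) (by positivity)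
  have n2 := ((D.gradV i).continuousAt (D.hO.mem_nhds hx0)).eventually (Metric.ball_mem_nhds g (show 0 < τ * G by positivity))
  obtain ⟨ρ, hρ, hb⟩ := Metric.eventually_nhds_iff_ball.1 (n1.and (n2.and (D.hO.mem_nhds hx0)))
  set ε := min (ρ/2) (q * G / (8 * (|M| + 1))) with hε
  have hε0 : 0 < ε := lt_min (by positivity) (by positivity)
  have hερ : ε < ρ := lt_of_le_of_lt (min_le_left _ _) (by linarith)
  have hMε : |M| ≤ q * G / (8 * ε) := by
    have : ε ≤ q * G / (8 * (|M| + 1)) := min_le_right _ _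
    rw [le_div_iff₀ (by positivity)] at this ⊢
    nlinarith
  have hbb : ∀ x, ‖x - x0‖ ≤ ε → |V i x - ⟪g, x - x0⟫| ≤ τ * G * ‖x - x0‖ ∧ ‖gradient (V i) x - g‖ ≤ τ * G ∧ x ∈ O := by
    intro x hx
    obtain ⟨b1, b2, b3⟩ := hb x (by rw [Metric.mem_ball, dist_eq_norm]; linarith)
    refine ⟨?_, ?_, b3⟩
    · rw [hz, hfd, sub_zero, Real.norm_eq_abs] at b1; exact b1
    · have : dist (gradient (V i) x) g < τ * G := b2
      rw [dist_eq_norm] at this; exact this.le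
  have hsuppO : tsupport (bmp x0 ε) ⊆ O := fun x hx => (hbb x (by
    have := bmp_tsupp x0 hε0 hx; rwa [Metric.mem_closedBall, dist_eq_norm] at this)).2.2
  have hφ := sing_test (bmp_C1 x0 ε) (bmp_supp x0 hε0) hsuppO i
  set A := Metric.ball (x0 + (ε/2/G) • g) (ε/4) with hA
  set CB := Metric.closedBall x0 ε with hCB
  set v := volume.real CB with hv
  have hvp : 0 < v := ENNReal.toReal_pos (Metric.measure_closedBall_pos _ _ hε0).ne' measure_closedBall_lt_top.ne
  have hvA : volume.real A = q * v := by
    rw [hv, hA, hCB, measureReal_def, Measure.addHaar_ball_of_pos _ _ (by positivity), ENNReal.toReal_mul, ENNReal.toReal_ofReal (by positivity), ← measureReal_def, Measure.addHaar_real_closedBall _ _ (by positivity)]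
    simp only [finrank_euclideanSpace, Fintype.card_fin, div_pow, hq]
    ring
  refine D.no_neg hφ (κ := v * (q * G / (32 * ε))) (δ0 := G * ε / 16) (by positivity) (by positivity) ?_
  intro δ hδ hδ1
  obtain ⟨hint, heq⟩ := D.D_int hδ hφ
  rw [heq]
  have j1 : Integrable (CB.indicator fun _ : EuclN N => 16 * τ * G / ε + |M|) :=
    (integrableOn_const measure_closedBall_lt_top.ne).integrable_indicator measurableSet_closedBall
  have j2 : Integrable (A.indicator fun _ : EuclN N => 7 / 32 * G / ε) :=
    (integrableOn_const measure_ball_lt_top.ne).integrable_indicator measurableSet_ball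
  have hle : ∫ x, (2 * ⟪gradient (Pd O V δ i) x, gradient (bmp x0 ε) x⟫ - bmp x0 ε x * ∑ k, (c i k x + c k i x) * Pd O V δ k x) ≤
      ∫ x, (CB.indicator (fun _ : EuclN N => 16 * τ * G / ε + |M|) x - A.indicator (fun _ : EuclN N => 7 / 32 * G / ε) x) := by
    refine integral_mono hint (j1.sub j2) ?_
    intro x
    simp only
    by_cases hx : x ∈ CB
    · have hxr : ‖x - x0‖ ≤ ε := by rwa [hCB, Metric.mem_closedBall, dist_eq_norm] at hx
      obtain ⟨b1, b2, b3⟩ := hbb x hxr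
      rw [indicator_of_mem hx]
      have t2 : - (bmp x0 ε x * ∑ k, (c i k x + c k i x) * Pd O V δ k x) ≤ |M| := by
        refine (neg_le_abs _).trans ?_
        rw [abs_mul, abs_of_nonneg (bmp_nonneg x0 ε x)]
        have : |∑ k, (c i k x + c k i x) * Pd O V δ k x| ≤ |M| := by
          refine le_trans ?_ ((le_abs_self _).trans ((hM x (D.hOB b3)).trans (le_abs_self _)))
          refine (Finset.abs_sum_le_sum_abs _ _).trans (Finset.sum_le_sum fun k _ => ?_)
          rw [abs_mul]
          refine mul_le_mul (abs_add_le _ _) ?_ (abs_nonneg _) (by positivity)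
          simp only [Pd, b3, if_true]
          rw [abs_of_nonneg (eta_nonneg hδ _)]
          exact (eta_le hδ _).trans (max_le (abs_nonneg _) (le_abs_self _))
        have := bmp_le x0 ε x
        have := bmp_nonneg x0 ε x
        have := abs_nonneg (∑ k, (c i k x + c k i x) * Pd O V δ k x)
        nlinarith
      rw [D.Pd_grad hδ b3, inner_smul_left, conj_trivial, bmp_grad]
      set ip := ⟪gradient (V i) x, x - x0⟫ with hip
      have b4 : |ip - ⟪g, x - x0⟫| ≤ τ * G * ‖x - x0‖ := by
        rw [hip, ← inner_sub_left]
        exact (abs_real_inner_le_norm _ _).trans (by gcongr)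
      have b5 : τ * G * ‖x - x0‖ ≤ τ * G * ε := by gcongr
      rw [abs_le] at b1 b4
      have e0 := eta'_nonneg (δ := δ) (V i x)
      have e1 := eta'_le_one hδ (V i x)
      set ρ' := max 0 (1 - ‖x - x0‖^2/ε^2) with hρ'
      have r0 : 0 ≤ ρ' := le_max_left _ _
      have r1 : ρ' ≤ 1 := max_le (by norm_num) (by
        have : 0 ≤ ‖x - x0‖^2/ε^2 := by positivity
        linarith)
      by_cases hxA : x ∈ A
      · rw [indicator_of_mem hxA]
        set y := x - x0 with hy
        have hgν : ‖(ε/2/G) • g‖ = ε/2 := by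
          rw [norm_smul, Real.norm_of_nonneg (by positivity), ← hGd]; field_simp
        have hyA : ‖y - (ε/2/G) • g‖ < ε/4 := by
          rw [hA, Metric.mem_ball, dist_eq_norm] at hxA
          rwa [hy, sub_sub]
        have y1 : ‖y‖ ≤ 3*ε/4 := by
          have := norm_add_le (y - (ε/2/G) • g) ((ε/2/G) • g)
          rw [sub_add_cancel, hgν] at this; linarith
        have y2 : G * ε / 4 ≤ ⟪g, y⟫ := by
          have h1 : ⟪g, y⟫ = ⟪g, y - (ε/2/G) • g⟫ + G * ε / 2 := by
            rw [inner_sub_right g y, inner_smul_right, real_inner_self_eq_norm_sq, ← hGd]; field_simp; ring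
          have h2 := (abs_le.1 (abs_real_inner_le_norm g (y - (ε/2/G) • g))).1
          have h3 : ‖g‖ * ‖y - (ε/2/G) • g‖ ≤ G * (ε/4) := by gcongr
          linarith
        have r2 : 7/16 ≤ ρ' := by
          refine le_trans ?_ (le_max_right _ _)
          have : ‖y‖^2/ε^2 ≤ 9/16 := by
            rw [div_le_iff₀ (by positivity)]; nlinarith [norm_nonneg y]
          linarith
        have τ1 : τ * G * ε ≤ G * ε / 256 := by
          have h1 : τ ≤ 1/256 := by rw [hτ]; linarith
          have h2 : 0 < G * ε := by positivity
          calc τ * G * ε = τ * (G * ε) := by ring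
            _ ≤ 1/256 * (G * ε) := mul_le_mul_of_nonneg_right h1 h2.le
            _ = _ := by ring
        have v1 : G * ε / 8 ≤ V i x := by
          have : 0 < G * ε := by positivity
          linarith
        have v2 : G * ε / 8 ≤ ip := by
          have : 0 < G * ε := by positivity
          linarith
        have e2 := eta'_half hδ (t := V i x) (by linarith)
        have k1 : 7/32 * G / ε ≤ 4/ε^2 * ρ' * ip := by
          calc 7/32 * G / ε = 4/ε^2 * (7/16) * (G * ε / 8) := by field_simp; ring
            _ ≤ _ := by gcongr
        have k0 : 0 < 7/32 * G / ε := by positivity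
        have k2 : 1/2 * (7/32 * G / ε) ≤ eta' δ (V i x) * (4/ε^2 * ρ' * ip) := by
          refine mul_le_mul e2 k1 k0.le e0
        have : 0 ≤ 16 * τ * G / ε := by positivity
        linarith
      · rw [indicator_of_notMem hxA]
        have k : 2 * (eta' δ (V i x) * -(4/ε^2 * ρ' * ip)) ≤ 16 * τ * G / ε := by
          by_cases hVp : V i x ≤ δ
          · rw [eta'_zero hVp]; simp; positivity
          · push Not at hVp
            have k1 : - (2 * (τ * G * ε)) ≤ ip := by linarith
            have k2 : -(4/ε^2 * ρ' * ip) ≤ 8 * τ * G / ε := by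
              calc -(4/ε^2 * ρ' * ip) = 4/ε^2 * ρ' * (-ip) := by ring
                _ ≤ 4/ε^2 * ρ' * (2 * (τ * G * ε)) := by gcongr; linarith
                _ ≤ 4/ε^2 * 1 * (2 * (τ * G * ε)) := by gcongr
                _ = _ := by field_simp; ring
            have k3 : 0 ≤ 8 * τ * G / ε := by positivity
            have : eta' δ (V i x) * -(4/ε^2 * ρ' * ip) ≤ 8 * τ * G / ε := by
              calc _ ≤ eta' δ (V i x) * (8 * τ * G / ε) := mul_le_mul_of_nonneg_left k2 e0
                _ ≤ 1 * (8 * τ * G / ε) := mul_le_mul_of_nonneg_right e1 k3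
                _ = _ := one_mul _
            have : 16 * τ * G / ε = 2 * (8 * τ * G / ε) := by ring
            linarith
        linarith
    · have hA' : x ∉ A := by
        intro hxA
        apply hx
        rw [hA, Metric.mem_ball, dist_eq_norm] at hxA
        rw [hCB, Metric.mem_closedBall, dist_eq_norm]
        have hgν : ‖(ε/2/G) • g‖ = ε/2 := by
          rw [norm_smul, Real.norm_of_nonneg (by positivity), ← hGd]; field_simp
        have := norm_add_le (x - (x0 + (ε/2/G) • g)) ((ε/2/G) • g)
        rw [hgν] at this
        have e : x - (x0 + (ε/2/G) • g) + (ε/2/G) • g = x - x0 := by abel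
        rw [e] at this; linarith
      have hxs : x ∉ tsupport (bmp x0 ε) := fun h => hx (bmp_tsupp x0 hε0 h)
      rw [indicator_of_notMem hx, indicator_of_notMem hA', grad_zero_of hxs, image_eq_zero_of_notMem_tsupport hxs]
      simp
  refine hle.trans ?_
  rw [integral_sub j1 j2, integral_indicator measurableSet_closedBall, integral_indicator measurableSet_ball,
    setIntegral_const, setIntegral_const, smul_eq_mul, smul_eq_mul, hvA]
  have f1 : 16 * τ * G / ε = q * G / (16 * ε) := by rw [hτ]; field_simp; ring
  rw [f1]
  have f2 : v * (q * G / (16 * ε) + |M|) ≤ v * (q * G / (16 * ε) + q * G / (8 * ε)) := by gcongr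
  refine (sub_le_sub_right f2 _).trans (le_of_eq ?_)
  field_simp; ring

lemma dich (i) : (∀ x ∈ O, 0 < V i x) ∨ ∀ x ∈ O, V i x ≤ 0 := by
  by_contra hcon
  push Not at hcon
  obtain ⟨⟨z, hz, hz0⟩, y, hy, hy0⟩ := hcon
  obtain ⟨L, hL⟩ := D.hB.exists_bound_of_continuousOn (D.hc i i).continuousOn
  obtain ⟨x0, h1, h2, h3⟩ := MP.hopf D.hO D.hOc (D.hV i) (abs_nonneg L) (fun x hx hp => by
    have h := D.g_zero hx hp
    have h2 : c i i x * max 0 (V i x) ≤ ∑ j, c i j x * max 0 (V j x) := by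
      rw [← Finset.add_sum_erase _ _ (Finset.mem_univ i)]
      have : 0 ≤ ∑ j ∈ Finset.univ.erase i, c i j x * max 0 (V j x) :=
        Finset.sum_nonneg fun j hj => mul_nonneg (D.coop i j (Finset.ne_of_mem_erase hj).symm x) (le_max_left _ _)
      linarith
    rw [max_eq_right hp.le] at h2
    have h3 : - c i i x ≤ |L| := (neg_le_abs _).trans ((hL x (D.hOB hx)).trans (le_abs_self _))
    nlinarith) ⟨y, hy, hy0⟩ ⟨z, hz, hz0⟩
  exact D.bad h1 h2 h3

lemma mixed {i j} (hij : i ≠ j) (hi : ∀ x ∈ O, 0 < V i x) (hj : ∀ x ∈ O, V j x ≤ 0) {x1} (hx1 : x1 ∈ O)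
    (hpos : 0 < c i j x1 + c j i x1) : False := by
  set S := c i j x1 + c j i x1 with hS
  have n1 := ((D.hc i j).add (D.hc j i)).continuousAt.eventually (lt_mem_nhds (show S / 2 < S by linarith))
  have hv := hi x1 hx1
  have n2 := ((D.hV i).continuousOn.continuousAt (D.hO.mem_nhds hx1)).eventually (lt_mem_nhds (show V i x1 / 2 < V i x1 by linarith))
  obtain ⟨ρ, hρ, hb⟩ := Metric.eventually_nhds_iff_ball.1 (n1.and (n2.and (D.hO.mem_nhds hx1)))
  set ε := ρ/2 with hε
  have hε0 : 0 < ε := by positivity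
  have hsuppO : tsupport (bmp x1 ε) ⊆ O := fun x hx => (hb x (by
    have := bmp_tsupp x1 hε0 hx; rw [Metric.mem_closedBall] at this; rw [Metric.mem_ball]; linarith)).2.2
  have hφ := sing_test (bmp_C1 x1 ε) (bmp_supp x1 hε0) hsuppO j
  set A := Metric.closedBall x1 (ε/2) with hA
  have hvA : 0 < volume.real A :=
    ENNReal.toReal_pos (Metric.measure_closedBall_pos _ _ (by positivity)).ne' measure_closedBall_lt_top.ne
  refine D.no_neg hφ (κ := volume.real A * (9/16 * (S/2 * (V i x1 / 4)))) (δ0 := V i x1 / 8) (by positivity) (by positivity) ?_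
  intro δ hδ hδ1
  obtain ⟨hint, heq⟩ := D.D_int hδ hφ
  rw [heq]
  have j2 : Integrable (A.indicator fun _ : EuclN N => - (9/16 * (S/2 * (V i x1 / 4)))) :=
    (integrableOn_const measure_closedBall_lt_top.ne).integrable_indicator measurableSet_closedBall
  refine (integral_mono hint j2 ?_).trans (le_of_eq ?_)
  · intro x
    simp only
    by_cases hx : x ∈ O
    · have g0 : gradient (Pd O V δ j) x = 0 := by
        rw [D.Pd_grad hδ hx, eta'_zero ((hj x hx).trans hδ.le), zero_smul]
      rw [g0, inner_zero_left]
      have hP : ∀ k, Pd O V δ k x = eta δ (V k x) := fun k => by simp [Pd, hx]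
      have hPj : Pd O V δ j x = 0 := by rw [hP, eta_zero hδ ((hj x hx).trans hδ.le)]
      have hterm : ∀ k ∈ Finset.univ, 0 ≤ (c j k x + c k j x) * Pd O V δ k x := by
        intro k _
        by_cases hk : k = j
        · rw [hk, hPj, mul_zero]
        · refine mul_nonneg (add_nonneg (D.coop _ _ (Ne.symm hk) x) (D.coop _ _ hk x)) ?_
          rw [hP]; exact eta_nonneg hδ _
      have hsum := Finset.single_le_sum hterm (Finset.mem_univ i)
      have hb0 := bmp_nonneg x1 ε x
      by_cases hxA : x ∈ A
      · rw [indicator_of_mem hxA]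
        have hxA' : dist x x1 ≤ ε/2 := hxA
        obtain ⟨b1, b2, -⟩ := hb x (by rw [Metric.mem_ball]; linarith)
        have b1 : S / 2 < c i j x + c j i x := b1
        have b3 : 9/16 ≤ bmp x1 ε x := bmp_pos x1 hε0 (by rwa [← dist_eq_norm])
        have b4 : V i x1 / 4 ≤ Pd O V δ i x := by
          rw [hP]
          have := eta_ge hδ (V i x)
          have := le_max_right 0 (V i x)
          linarith
        have b5 : S / 2 * (V i x1 / 4) ≤ (c j i x + c i j x) * Pd O V δ i x :=
          mul_le_mul (by linarith) b4 (by positivity) (by linarith)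
        have b6 : 9/16 * (S/2 * (V i x1 / 4)) ≤ bmp x1 ε x * ∑ k, (c j k x + c k j x) * Pd O V δ k x :=
          mul_le_mul b3 (b5.trans hsum) (by positivity) hb0
        linarith
      · rw [indicator_of_notMem hxA]
        have := mul_nonneg hb0 (Finset.sum_nonneg hterm)
        linarith
    · have hxs : x ∉ tsupport (bmp x1 ε) := fun h => hx (hsuppO h)
      have hxA : x ∉ A := by
        intro h
        have hxA' : dist x x1 ≤ ε/2 := h
        exact hx (hb x (by rw [Metric.mem_ball]; linarith)).2.2
      rw [indicator_of_notMem hxA, grad_zero_of hxs, image_eq_zero_of_notMem_tsupport hxs]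
      simp
  · rw [integral_indicator measurableSet_closedBall, setIntegral_const, smul_eq_mul]; ring

theorem concl (hcoup : ∀ I J : Finset (Fin m), I.Nonempty → J.Nonempty → Disjoint I J → I ∪ J = Finset.univ →
      ∃ i ∈ I, ∃ j ∈ J, ∃ x ∈ O, 0 < c i j x) :
    (∀ i, ∀ x ∈ O, 0 < V i x) ∨ ∀ i, ∀ x ∈ O, V i x ≤ 0 := by
  classical
  by_contra hcon
  push Not at hcon
  obtain ⟨⟨i1, y, hy, hy2⟩, i2, z, hz, hz2⟩ := hcon
  have hcoup' := hcoup (Finset.univ.filter fun i => ∀ x ∈ O, V i x ≤ 0)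
    (Finset.univ.filter fun i => ¬ ∀ x ∈ O, V i x ≤ 0)
    ⟨i1, by
      simp only [Finset.mem_filter, Finset.mem_univ, true_and]
      exact (D.dich i1).resolve_left fun h => absurd (h y hy) (not_lt.2 hy2)⟩
    ⟨i2, by
      simp only [Finset.mem_filter, Finset.mem_univ, true_and]
      intro h; exact absurd (h z hz) (not_le.2 hz2)⟩
    (Finset.disjoint_filter_filter_not _ _ _) (Finset.filter_union_filter_not_eq _ _)
  obtain ⟨i, hi, j, hj, x, hx, hp⟩ := hcoup'
  simp only [Finset.mem_filter, Finset.mem_univ, true_and] at hi hj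
  have hj' := (D.dich j).resolve_right hj
  have hne : j ≠ i := by rintro rfl; exact hj hi
  refine D.mixed hne hj' hi hx ?_
  have := D.coop j i hne x
  linarith

end Dat
end LS

namespace RP
open Filter Topology QF LapC MP
variable {N m : ℕ}

/-- orthonormal pair -/
structure ON (e b : EuclN N) : Prop where
  e1 : ‖e‖ = 1
  b1 : ‖b‖ = 1
  eb : ⟪e, b⟫ = 0

noncomputable def rot (e b : EuclN N) (t : ℝ) (x : EuclN N) : EuclN N :=
  x + (((cos t - 1) * ⟪e, x⟫ - sin t * ⟪b, x⟫) • e + (sin t * ⟪e, x⟫ + (cos t - 1) * ⟪b, x⟫) • b)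

lemma rot_zero (e b : EuclN N) (x) : rot e b 0 x = x := by simp [rot]

lemma rot_neg_b (e b : EuclN N) (t x) : rot e (-b) t x = rot e b (-t) x := by
  unfold rot
  simp only [inner_neg_left, cos_neg, sin_neg]
  module

namespace ON
variable {e b : EuclN N} (h : ON e b)
include h

lemma ee : ⟪e, e⟫ = 1 := by rw [real_inner_self_eq_norm_sq, h.e1]; norm_num
lemma bb : ⟪b, b⟫ = 1 := by rw [real_inner_self_eq_norm_sq, h.b1]; norm_num
lemma be : ⟪b, e⟫ = 0 := by rw [real_inner_comm, h.eb]
lemma neg : ON e (-b) := ⟨h.e1, by rw [norm_neg, h.b1], by rw [inner_neg_right, h.eb, neg_zero]⟩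

lemma inner_e (t x) : ⟪e, rot e b t x⟫ = cos t * ⟪e, x⟫ - sin t * ⟪b, x⟫ := by
  unfold rot
  simp only [inner_add_right, inner_smul_right, h.ee, h.eb]; ring

lemma inner_b (t x) : ⟪b, rot e b t x⟫ = sin t * ⟪e, x⟫ + cos t * ⟪b, x⟫ := by
  unfold rot
  simp only [inner_add_right, inner_smul_right, h.bb, h.be]; ring

lemma rot_norm (t x) : ‖rot e b t x‖ = ‖x‖ := by
  have : ‖rot e b t x‖^2 = ‖x‖^2 := by
    rw [← real_inner_self_eq_norm_sq, ← real_inner_self_eq_norm_sq]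
    unfold rot
    simp only [inner_add_right, inner_add_left, inner_smul_right, inner_smul_left, h.ee, h.bb, h.eb, h.be, conj_trivial,
      real_inner_comm e x, real_inner_comm b x]
    have := sin_sq_add_cos_sq t
    rw [real_inner_comm x e, real_inner_comm x b]
    linear_combination ( ⟪x, e⟫^2 + ⟪x, b⟫^2) * this
  exact (sq_eq_sq₀ (norm_nonneg _) (norm_nonneg _)).1 this

lemma hasDeriv (t x) : HasDerivAt (fun t => rot e b t x) (ang e b (rot e b t x)) t := by
  rw [ang_apply, h.inner_e, h.inner_b]
  unfold rot
  have hc := (hasDerivAt_cos t).sub_const 1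
  have hs := hasDerivAt_sin t
  have h1 := (((hc.mul_const ⟪e, x⟫).sub (hs.mul_const ⟪b, x⟫)).smul_const e).add
    (((hs.mul_const ⟪e, x⟫).add (hc.mul_const ⟪b, x⟫)).smul_const b)
  have := h1.const_add x
  refine HasDerivAt.congr_deriv this ?_
  module

lemma refl_rot (t x) : reflPt e (rot e b t x) = rot e b (-t) (reflPt e x) := by
  have h1 : ⟪rot e b t x, e⟫ = cos t * ⟪e, x⟫ - sin t * ⟪b, x⟫ := by rw [real_inner_comm, h.inner_e]
  unfold reflPt
  rw [h1]
  unfold rot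
  simp only [inner_sub_right, inner_smul_right, h.ee, h.be, cos_neg, sin_neg, real_inner_comm e x]
  module

lemma refl_comp (s x) : reflPt (cos s • e + sin s • b) x = rot e b (2 * s) (reflPt e x) := by
  unfold rot reflPt
  simp only [inner_sub_right, inner_add_right, inner_smul_right, h.ee, h.be, cos_two_mul, sin_two_mul,
    real_inner_comm e x, real_inner_comm b x]
  have := sin_sq_add_cos_sq s
  rw [add_comm] at this
  have h2 : sin s ^ 2 = 1 - cos s ^ 2 := by linarith
  rw [← sub_eq_zero]
  rw [show x - (2 * (cos s * ⟪e, x⟫ + sin s * ⟪b, x⟫)) • (cos s • e + sin s • b) = x - ((2 * (cos s * ⟪e, x⟫ + sin s * ⟪b, x⟫)) * cos s) • e - (2 * (cos s * sin s * ⟪e, x⟫ + sin s ^ 2 * ⟪b, x⟫)) • b from by module, h2]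
  module

lemma unit (s : ℝ) : ‖cos s • e + sin s • b‖ = 1 := by
  have : ‖cos s • e + sin s • b‖^2 = 1 := by
    rw [← real_inner_self_eq_norm_sq]
    simp only [inner_add_right, inner_add_left, inner_smul_right, inner_smul_left, h.ee, h.bb, h.eb, h.be, conj_trivial]
    have := sin_sq_add_cos_sq s
    linear_combination this
  nlinarith [norm_nonneg (cos s • e + sin s • b)]

lemma turn (s : ℝ) : ON (cos s • e + sin s • b) (-sin s • e + cos s • b) := by
  refine ⟨h.unit s, ?_, ?_⟩
  · have := h.unit (s + π/2)
    rwa [cos_add_pi_div_two, sin_add_pi_div_two] at this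
  · simp only [inner_add_right, inner_add_left, inner_smul_right, inner_smul_left, h.ee, h.bb, h.eb, h.be, conj_trivial]
    ring

end ON

lemma exists_perp (hN : 2 ≤ N) {e : EuclN N} (he : ‖e‖ = 1) : ∃ b, ON e b := by
  obtain ⟨v, hv0, hv⟩ : ∃ v : EuclN N, v ≠ 0 ∧ ⟪e, v⟫ = 0 := by
    have h1 : Module.finrank ℝ (ℝ ∙ e : Submodule ℝ (EuclN N)) ≤ 1 := by
      rw [finrank_span_singleton (by rintro rfl; simp at he)]
    have h2 := Submodule.finrank_add_finrank_orthogonal (ℝ ∙ e : Submodule ℝ (EuclN N))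
    rw [finrank_euclideanSpace, Fintype.card_fin] at h2
    have h3 : 0 < Module.finrank ℝ ((ℝ ∙ e)ᗮ : Submodule ℝ (EuclN N)) := by omega
    obtain ⟨v, hv⟩ := Module.finrank_pos_iff_exists_ne_zero.1 h3
    exact ⟨v, by simpa using hv, Submodule.mem_orthogonal_singleton_iff_inner_right.1 v.2⟩
  refine ⟨(‖v‖)⁻¹ • v, he, ?_, ?_⟩
  · rw [norm_smul, norm_inv, norm_norm, inv_mul_cancel₀ (norm_ne_zero_iff.2 hv0)]
  · rw [inner_smul_right, hv, mul_zero]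

/-- closed annulus/ball -/
def CA (N : ℕ) (a R : ℝ) : Set (EuclN N) := {x | a ≤ ‖x‖ ∧ ‖x‖ ≤ R}
def OA (N : ℕ) (a R : ℝ) : Set (EuclN N) := {x | a < ‖x‖ ∧ ‖x‖ < R}

lemma OA_open (a R : ℝ) : IsOpen (OA N a R) :=
  (isOpen_lt continuous_const continuous_norm).inter (isOpen_lt continuous_norm continuous_const)
lemma OA_sub (a R : ℝ) : OA N a R ⊆ CA N a R := fun _ h => ⟨h.1.le, h.2.le⟩
lemma CA_closed (a R : ℝ) : IsClosed (CA N a R) :=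
  (isClosed_le continuous_const continuous_norm).inter (isClosed_le continuous_norm continuous_const)
lemma CA_compact (a R : ℝ) : IsCompact (CA N a R) :=
  (isCompact_closedBall 0 R).of_isClosed_subset (CA_closed a R) (fun x hx => by simpa using hx.2)
lemma HD_sub_OA (a R : ℝ) (e : EuclN N) : HD a R e ⊆ OA N a R := fun _ h => ⟨h.1, h.2.1⟩
lemma HB_sub_CA (a R : ℝ) (e : EuclN N) : HB a R e ⊆ CA N a R := fun _ h => ⟨h.1, h.2.1⟩

lemma CA_unique {a R : ℝ} (hN : 2 ≤ N) (ha : 0 ≤ a) (haR : a < R) : UniqueDiffOn ℝ (CA N a R) := by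
  intro x hx
  obtain ⟨u, hu, hxu⟩ : ∃ u : EuclN N, ‖u‖ = 1 ∧ x = ‖x‖ • u := by
    by_cases h0 : x = 0
    · have : Nontrivial (EuclN N) := by
        have : Nonempty (Fin N) := ⟨⟨0, by omega⟩⟩
        infer_instance
      obtain ⟨u, hu⟩ := exists_norm_eq (EuclN N) (c := 1) (by norm_num)
      exact ⟨u, hu, by simp [h0]⟩
    · exact ⟨(‖x‖)⁻¹ • x, by rw [norm_smul, norm_inv, norm_norm, inv_mul_cancel₀ (norm_ne_zero_iff.2 h0)],
        by rw [smul_smul, mul_inv_cancel₀ (norm_ne_zero_iff.2 h0), one_smul]⟩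
  have hsub : Metric.closedBall (((a+R)/2) • u) ((R-a)/2) ⊆ CA N a R := by
    intro y hy
    rw [Metric.mem_closedBall, dist_eq_norm] at hy
    have hn : ‖((a+R)/2) • u‖ = (a+R)/2 := by rw [norm_smul, hu, mul_one, Real.norm_of_nonneg (by linarith)]
    have h1 := norm_sub_norm_le y (((a+R)/2) • u)
    have h2 := norm_sub_norm_le (((a+R)/2) • u) y
    rw [norm_sub_rev] at h2
    constructor <;> linarith
  refine UniqueDiffWithinAt.mono ?_ hsub
  refine uniqueDiffOn_convex (convex_closedBall _ _) ?_ x ?_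
  · refine ⟨((a+R)/2) • u, ?_⟩
    exact Metric.ball_subset_interior_closedBall (Metric.mem_ball_self (by linarith))
  · rw [Metric.mem_closedBall, dist_eq_norm]
    have : x - ((a+R)/2) • u = (‖x‖ - (a+R)/2) • u := by rw [sub_smul, ← hxu]
    rw [this, norm_smul, hu, mul_one, Real.norm_eq_abs, abs_le]
    have := hx.1; have := hx.2
    constructor <;> linarith

end RP

namespace RP
open Filter Topology QF LapC MP
variable {N m : ℕ}

section ff
variable {f : Fin m → ℝ → (Fin m → ℝ) → ℝ}
  (hf : ∀ i, ContDiff ℝ 1 (fun q : ℝ × (Fin m → ℝ) => f i q.1 q.2))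
include hf

lemma f_has (i r s) : HasFDerivAt (f i r) (fderiv ℝ (f i r) s) s := by
  have : ContDiff ℝ 1 (f i r) := (hf i).comp (contDiff_const.prodMk contDiff_id)
  exact (this.differentiable (by norm_num) s).hasFDerivAt

lemma pd_cont (i j) : Continuous (fun q : ℝ × (Fin m → ℝ) => pd (f i) j q.1 q.2) := by
  have h : ∀ q : ℝ × (Fin m → ℝ), pd (f i) j q.1 q.2 = fderiv ℝ (fun q : ℝ × (Fin m → ℝ) => f i q.1 q.2) q (0, Pi.single j 1) := by
    intro q
    have h1 : HasFDerivAt (fun s : Fin m → ℝ => (q.1, s)) (ContinuousLinearMap.inr ℝ ℝ (Fin m → ℝ)) q.2 :=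
      hasFDerivAt_prodMk_right q.1 q.2
    have h2 := (((hf i).differentiable (by norm_num)) (q.1, q.2)).hasFDerivAt.comp q.2 h1
    have h3 : fderiv ℝ (f i q.1) q.2 = _ := h2.fderiv
    unfold pd
    rw [h3]; simp
  simp_rw [h]
  exact ((hf i).continuous_fderiv (by norm_num)).clm_apply continuous_const

omit hf in
lemma fd_sum (i : Fin m) (r : ℝ) (s v : Fin m → ℝ) : fderiv ℝ (f i r) s v = ∑ j, pd (f i) j r s * v j := by
  have : v = ∑ j, v j • (Pi.single j (1:ℝ) : Fin m → ℝ) := by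
    ext k; simp [Finset.sum_apply, Pi.single_apply]
  conv_lhs => rw [this]
  rw [map_sum]
  refine Finset.sum_congr rfl fun j _ => ?_
  rw [map_smul, smul_eq_mul, mul_comm]; rfl

lemma f_mv (i r) (u v : Fin m → ℝ) : ∃ ξ : Fin m → ℝ, (∀ k, min (u k) (v k) ≤ ξ k ∧ ξ k ≤ max (u k) (v k)) ∧
    f i r u - f i r v = ∑ j, pd (f i) j r ξ * (u j - v j) := by
  obtain ⟨z, hz, h⟩ := domain_mvt (s := univ) (f := f i r) (fun x _ => (f_has hf i r x).hasFDerivWithinAt)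
    convex_univ (mem_univ v) (mem_univ u)
  refine ⟨z, ?_, ?_⟩
  · have := (convex_Icc (v ⊓ u) (v ⊔ u)).segment_subset ⟨inf_le_left, le_sup_left⟩ ⟨inf_le_right, le_sup_right⟩ hz
    intro k
    have h1 := this.1 k
    have h2 := this.2 k
    simp only [Pi.inf_apply, Pi.sup_apply] at h1 h2
    rw [inf_comm] at h1; rw [sup_comm] at h2
    exact ⟨h1, h2⟩
  · rw [h, fd_sum]; rfl

variable {r : ℝ} (hco : ∀ i j, i ≠ j → ∀ s, 0 ≤ pd (f i) j r s)
include hco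

lemma f_le {i} {u v : Fin m → ℝ} (h : ∀ k, v k ≤ u k) (hi : u i = v i) : f i r v ≤ f i r u := by
  obtain ⟨ξ, -, hξ⟩ := f_mv hf i r u v
  have : 0 ≤ ∑ j, pd (f i) j r ξ * (u j - v j) := by
    refine Finset.sum_nonneg fun j _ => ?_
    by_cases hj : j = i
    · rw [hj, hi]; simp
    · exact mul_nonneg (hco i j (Ne.symm hj) _) (by linarith [h j])
  linarith

lemma fB {i} {u v : Fin m → ℝ} (hmono : ∀ i j (s t : Fin m → ℝ), (∀ k, s k ≤ t k) → pd (f i) j r s ≤ pd (f i) j r t)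
    (h : ∀ k, v k ≤ u k) : pd (f i) i r v * (u i - v i) ≤ f i r u - f i r v := by
  obtain ⟨ξ, h1, hξ⟩ := f_mv hf i r u v
  rw [hξ]
  have h2 : pd (f i) i r ξ * (u i - v i) ≤ ∑ j, pd (f i) j r ξ * (u j - v j) := by
    rw [← Finset.add_sum_erase _ _ (Finset.mem_univ i)]
    have : 0 ≤ ∑ j ∈ Finset.univ.erase i, pd (f i) j r ξ * (u j - v j) :=
      Finset.sum_nonneg fun j hj => mul_nonneg (hco i j (Finset.ne_of_mem_erase hj).symm _) (by linarith [h j])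
    linarith
  refine le_trans ?_ h2
  refine mul_le_mul_of_nonneg_right (hmono i i _ _ fun k => ?_) (by linarith [h i])
  have := (h1 k).1; rwa [min_eq_right (h k)] at this

lemma fA {i} {u v : Fin m → ℝ} (hmono : ∀ i j (s t : Fin m → ℝ), (∀ k, s k ≤ t k) → pd (f i) j r s ≤ pd (f i) j r t)
    (h : v i < u i) : f i r u - f i r v ≤ ∑ j, pd (f i) j r u * max 0 (u j - v j) := by
  set w : Fin m → ℝ := fun k => min (u k) (v k) with hw
  have h0 : f i r w ≤ f i r v := f_le hf hco (fun k => min_le_right _ _) (by simp [hw, h.le])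
  obtain ⟨ξ, h1, hξ⟩ := f_mv hf i r u w
  have h2 : ∑ j, pd (f i) j r ξ * (u j - w j) ≤ ∑ j, pd (f i) j r u * max 0 (u j - v j) := by
    refine Finset.sum_le_sum fun j _ => ?_
    have e : u j - w j = max 0 (u j - v j) := by
      simp only [hw]
      rcases le_total (u j) (v j) with h | h
      · rw [min_eq_left h, max_eq_left (by linarith), sub_self]
      · rw [min_eq_right h, max_eq_right (by linarith)]
    rw [e]
    refine mul_le_mul_of_nonneg_right (hmono i j _ _ fun k => ?_) (le_max_left _ _)
    have := (h1 k).2; rwa [max_eq_left (min_le_left _ _)] at this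
  linarith

lemma fC {i j} (hij : i ≠ j) {u v : Fin m → ℝ} (h : ∀ k, v k ≤ u k) (hi : u i = v i) (hj : v j < u j)
    (hp : 0 < pd (f i) j r u) : f i r v < f i r u := by
  classical
  have hc : Continuous fun t : ℝ => pd (f i) j r (Function.update u j t) :=
    (pd_cont hf i j).comp (continuous_const.prodMk (continuous_const.update j continuous_id))
  have h1 : ∀ᶠ t in 𝓝 (u j), 0 < pd (f i) j r (Function.update u j t) := by
    refine hc.continuousAt.eventually (lt_mem_nhds ?_)
    simp only [Function.update_eq_self]; exact hp
  obtain ⟨ρ, hρ, hb⟩ := Metric.eventually_nhds_iff_ball.1 h1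
  set t := max (v j) (u j - ρ/2) with ht
  have htu : t < u j := max_lt hj (by linarith)
  set z := Function.update u j t with hz
  have a1 : f i r v ≤ f i r z := by
    refine f_le hf hco (fun k => ?_) ?_
    · by_cases hk : k = j
      · subst hk; simp [hz, ht]
      · simp [hz, hk, h k]
    · simp [hz, hij, hi]
  obtain ⟨ξ, b1, b2⟩ := f_mv hf i r u z
  have b3 : ξ = Function.update u j (ξ j) := by
    ext k
    by_cases hk : k = j
    · subst hk; simp
    · have := b1 k; simp only [hz, Function.update_of_ne hk, min_self, max_self] at this
      rw [Function.update_of_ne hk]; linarith [this.1, this.2]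
  have b4 : 0 < pd (f i) j r ξ := by
    rw [b3]
    apply hb
    have := b1 j
    simp only [hz, Function.update_self] at this
    rw [min_eq_right htu.le, max_eq_left htu.le] at this
    have h3 : u j - ρ/2 ≤ t := le_max_right _ _
    rw [Metric.mem_ball, Real.dist_eq, abs_lt]; constructor <;> linarith [this.1, this.2]
  have b5 : ∑ k, pd (f i) k r ξ * (u k - z k) = pd (f i) j r ξ * (u j - t) := by
    rw [Finset.sum_eq_single j]
    · simp [hz]
    · intro k _ hk; simp [hz, hk]
    · simp
  have : 0 < pd (f i) j r ξ * (u j - t) := mul_pos b4 (by linarith)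
  linarith

lemma fD {i} {u v : Fin m → ℝ} {L : ℝ}
    (hL : ∀ s : Fin m → ℝ, (∀ k, min (u k) (v k) ≤ s k ∧ s k ≤ max (u k) (v k)) → ∑ j, |pd (f i) j r s| ≤ L)
    (hneg : u i - v i < 0) (hmin : ∀ j, u i - v i ≤ u j - v j) : L * (u i - v i) ≤ f i r u - f i r v := by
  obtain ⟨ξ, b1, b2⟩ := f_mv hf i r u v
  have h1 := hL ξ b1
  rw [b2]
  have h2 : (∑ j, |pd (f i) j r ξ|) * (u i - v i) ≤ ∑ j, pd (f i) j r ξ * (u j - v j) := by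
    rw [Finset.sum_mul]
    refine Finset.sum_le_sum fun j _ => ?_
    by_cases hj : j = i
    · subst hj; have := le_abs_self (pd (f j) j r ξ); nlinarith
    · have := hco i j (Ne.symm hj) ξ
      rw [abs_of_nonneg this]; exact mul_le_mul_of_nonneg_left (hmin j) this
  nlinarith
end ff

/-- standing data -/
structure Sys (a R : ℝ) (f : Fin m → ℝ → (Fin m → ℝ) → ℝ) (U : Fin m → EuclN N → ℝ)
    (c : Fin m → Fin m → EuclN N → ℝ) : Prop where
  hN : 2 ≤ N
  hm : 0 < m
  ha : 0 ≤ a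
  haR : a < R
  hf : ∀ i, ContDiff ℝ 1 (fun q : ℝ × (Fin m → ℝ) => f i q.1 q.2)
  hU : ∀ i, ContDiffOn ℝ 3 (U i) (CA N a R)
  hsol : ∀ i, ∀ x ∈ OA N a R, -lap (U i) x = f i ‖x‖ (fun k => U k x)
  hbR : ∀ i, ∀ x, ‖x‖ = R → U i x = 0
  hba : 0 < a → ∀ i, ∀ x, ‖x‖ = a → U i x = 0
  coop : ∀ i j, i ≠ j → ∀ r, a < r → r < R → ∀ s, 0 ≤ pd (f i) j r s
  coup : ∀ e : EuclN N, ‖e‖ = 1 → ∀ I J : Finset (Fin m), I.Nonempty → J.Nonempty → Disjoint I J → I ∪ J = Finset.univ →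
    ∃ i ∈ I, ∃ j ∈ J, ∃ x ∈ HD a R e, 0 < pd (f i) j ‖x‖ (fun k => U k x)
  mono : ∀ i j (r : ℝ) (s t : Fin m → ℝ), (∀ k, s k ≤ t k) → pd (f i) j r s ≤ pd (f i) j r t
  hc : ∀ i j, Continuous (c i j)
  ccoop : ∀ i j, i ≠ j → ∀ x, 0 ≤ c i j x
  hcU : ∀ i j, ∀ x ∈ OA N a R, c i j x = pd (f i) j ‖x‖ (fun k => U k x)

noncomputable def VV (a R : ℝ) (U : Fin m → EuclN N → ℝ) (e b : EuclN N) (i : Fin m) (x : EuclN N) : ℝ :=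
  fderivWithin ℝ (U i) (CA N a R) x (ang e b x)

def Sym (a R : ℝ) (U : Fin m → EuclN N → ℝ) (e : EuclN N) : Prop := ∀ i, ∀ x ∈ CA N a R, U i (reflPt e x) = U i x

namespace Sys
variable {a R : ℝ} {f : Fin m → ℝ → (Fin m → ℝ) → ℝ} {U : Fin m → EuclN N → ℝ} {c : Fin m → Fin m → EuclN N → ℝ}
variable (S : Sys a R f U c)
include S

lemma rot_CA {e b : EuclN N} (h : ON e b) {x} (hx : x ∈ CA N a R) (t) : rot e b t x ∈ CA N a R := by
  unfold CA at *; simpa [h.rot_norm] using hx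
lemma refl_CA {e : EuclN N} (h : ‖e‖ = 1) {x} (hx : x ∈ CA N a R) : reflPt e x ∈ CA N a R := by
  unfold CA at *; simpa [norm_refl h] using hx
lemma refl_OA {e : EuclN N} (h : ‖e‖ = 1) {x} (hx : x ∈ OA N a R) : reflPt e x ∈ OA N a R := by
  unfold OA at *; simpa [norm_refl h] using hx

lemma Ucont (i) : ContinuousOn (U i) (CA N a R) := (S.hU i).continuousOn
lemma Uat (i) {x} (hx : x ∈ OA N a R) : ContDiffAt ℝ 3 (U i) x :=
  (S.hU i).contDiffAt (mem_of_superset ((OA_open a R).mem_nhds hx) (OA_sub a R))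

lemma Lbound : ∃ L : ℝ, 0 ≤ L ∧ ∀ i, ∀ x ∈ CA N a R, ∀ y ∈ CA N a R, ∀ z ∈ CA N a R, ∀ s : Fin m → ℝ,
    (∀ k, min (U k y) (U k z) ≤ s k ∧ s k ≤ max (U k y) (U k z)) → ∑ j, |pd (f i) j ‖x‖ s| ≤ L := by
  have h1 : ∀ k, ∃ M, ∀ x ∈ CA N a R, ‖U k x‖ ≤ M := fun k => (CA_compact a R).exists_bound_of_continuousOn (S.Ucont k)
  choose M hM using h1
  have hK : IsCompact (Icc (0:ℝ) R ×ˢ Set.pi univ fun k => Icc (-M k) (M k)) :=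
    isCompact_Icc.prod (isCompact_univ_pi fun k => isCompact_Icc)
  have h2 : ∀ i, ∃ L, ∀ q ∈ (Icc (0:ℝ) R ×ˢ Set.pi univ fun k => Icc (-M k) (M k)), ‖∑ j, |pd (f i) j q.1 q.2|‖ ≤ L :=
    fun i => hK.exists_bound_of_continuousOn (continuous_finsetSum _ fun j _ => (pd_cont S.hf i j).abs).continuousOn
  choose L hL using h2
  refine ⟨∑ i, |L i|, Finset.sum_nonneg fun _ _ => abs_nonneg _, ?_⟩
  intro i x hx y hy z hz s hs
  have h3 := hL i (‖x‖, s) ⟨⟨norm_nonneg _, hx.2⟩, fun k _ => by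
    have e1 := abs_le.1 (hM k y hy)
    have e2 := abs_le.1 (hM k z hz)
    exact ⟨(le_min e1.1 e2.1).trans (hs k).1, (hs k).2.trans (max_le e1.2 e2.2)⟩⟩
  refine (le_abs_self _).trans (h3.trans ((le_abs_self _).trans ?_))
  exact Finset.single_le_sum (f := fun i => |L i|) (fun _ _ => abs_nonneg _) (Finset.mem_univ i)

lemma V_deriv {e b : EuclN N} (h : ON e b) {x} (hx : x ∈ CA N a R) (i t) :
    HasDerivAt (fun t => U i (rot e b t x)) (VV a R U e b i (rot e b t x)) t := by
  have h1 := (((S.hU i).differentiableOn (by norm_num)) _ (S.rot_CA h hx t)).hasFDerivWithinAt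
  have := h1.comp_hasDerivWithinAt (s := univ) t (h.hasDeriv t x).hasDerivWithinAt (fun t _ => S.rot_CA h hx t)
  exact hasDerivWithinAt_univ.1 this

lemma V_cont (e b : EuclN N) (i) : ContinuousOn (VV a R U e b i) (CA N a R) := by
  refine ContinuousOn.clm_apply ?_ (ang e b).continuous.continuousOn
  exact (S.hU i).continuousOn_fderivWithin (CA_unique S.hN S.ha S.haR) (by norm_num)

lemma V_eq (e b : EuclN N) (i) {x} (hx : x ∈ OA N a R) : VV a R U e b i x = fderiv ℝ (U i) x (ang e b x) := by
  unfold VV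
  rw [fderivWithin_of_mem_nhds (mem_of_superset ((OA_open a R).mem_nhds hx) (OA_sub a R))]

lemma V_ev (e b : EuclN N) (i) {x} (hx : x ∈ OA N a R) :
    VV a R U e b i =ᶠ[𝓝 x] fun y => fderiv ℝ (U i) y (ang e b y) := by
  filter_upwards [(OA_open a R).mem_nhds hx] with y hy
  exact S.V_eq e b i hy

lemma V_C2 (e b : EuclN N) (i) : ContDiffOn ℝ 2 (VV a R U e b i) (OA N a R) := by
  intro x hx
  refine ContDiffAt.contDiffWithinAt ?_
  refine ContDiffAt.congr_of_eventuallyEq ?_ (S.V_ev e b i hx)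
  exact ((S.Uat i hx).fderiv_right (by norm_num)).clm_apply (ang e b).contDiff.contDiffAt

lemma V_lap {e b : EuclN N} (h : ON e b) (i) {x} (hx : x ∈ OA N a R) :
    - lap (VV a R U e b i) x = ∑ j, c i j x * VV a R U e b j x := by
  rw [lap_congr (S.V_ev e b i hx), lap_ang (S.Uat i hx)]
  have hxC := OA_sub a R hx
  have d0 : DifferentiableAt ℝ (lap (U i)) x := by
    have h3 : ContDiffAt ℝ 1 (fun y => ∑ k, fderiv ℝ (fderiv ℝ (U i)) y (eb k) (eb k)) x := by
      have h2 : ContDiffAt ℝ 1 (fderiv ℝ (fderiv ℝ (U i))) x :=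
        ((S.Uat i hx).fderiv_right (m := 2) (by norm_num)).fderiv_right (by norm_num)
      exact ContDiffAt.sum fun k _ => (h2.clm_apply contDiffAt_const).clm_apply contDiffAt_const
    have : lap (U i) = (fun y => ∑ k, fderiv ℝ (fderiv ℝ (U i)) y (eb k) (eb k)) := funext fun y => lap_eq _ _
    rw [this]; exact h3.differentiableAt (by norm_num)
  have r0 := h.hasDeriv 0 x
  rw [rot_zero] at r0
  have d1 : HasDerivAt (fun t => lap (U i) (rot e b t x)) (fderiv ℝ (lap (U i)) x (ang e b x)) 0 := by
    refine HasFDerivAt.comp_hasDerivAt_of_eq (f := fun t => rot e b t x) 0 d0.hasFDerivAt r0 (rot_zero e b x).symm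
  have d2 : HasDerivAt (fun t => - f i ‖x‖ (fun k => U k (rot e b t x))) (-(∑ j, pd (f i) j ‖x‖ (fun k => U k x) * VV a R U e b j x)) 0 := by
    have d3 : HasDerivAt (fun t => (fun k => U k (rot e b t x))) (fun k => VV a R U e b k x) 0 := by
      rw [hasDerivAt_pi]
      intro k
      have := S.V_deriv h hxC k 0
      rwa [rot_zero] at this
    have d4 := HasFDerivAt.comp_hasDerivAt_of_eq (0:ℝ) (f_has S.hf i ‖x‖ (fun k => U k x)) d3 (by simp [rot_zero])
    rw [fd_sum] at d4
    exact d4.neg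
  have hev : (fun t => lap (U i) (rot e b t x)) = fun t => - f i ‖x‖ (fun k => U k (rot e b t x)) := by
    funext t
    have hy : rot e b t x ∈ OA N a R := by unfold OA at *; simpa [h.rot_norm] using hx
    have := S.hsol i _ hy
    rw [h.rot_norm] at this
    linarith
  rw [hev] at d1
  rw [d1.unique d2, neg_neg]
  simp_rw [S.hcU _ _ x hx]

lemma V_bd {e b : EuclN N} (h : ON e b) (i) {x} (hx : x ∈ CA N a R) (hn : x ∉ OA N a R) : VV a R U e b i x = 0 := by
  have hz : (∀ t, U i (rot e b t x) = 0) ∨ x = 0 := by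
    by_cases h1 : ‖x‖ < R
    · have h2 : ‖x‖ = a := by
        by_contra h2
        exact hn ⟨lt_of_le_of_ne hx.1 (Ne.symm h2), h1⟩
      rcases S.ha.eq_or_lt with h3 | h3
      · right; rw [← norm_eq_zero, h2, h3]
      · left; intro t; exact S.hba h3 i _ (by rw [h.rot_norm, h2])
    · left; intro t; exact S.hbR i _ (by rw [h.rot_norm]; exact le_antisymm hx.2 (not_lt.1 h1))
  rcases hz with hz | hz
  · have := S.V_deriv h hx i 0
    simp_rw [hz] at this
    rw [rot_zero] at this
    exact this.unique (hasDerivAt_const 0 0)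
  · rw [hz]; simp [VV]

lemma V_refl {e b : EuclN N} (h : ON e b) (hs : Sym a R U e) (i) {x} (hx : x ∈ CA N a R) :
    VV a R U e b i (reflPt e x) = - VV a R U e b i x := by
  have d1 := S.V_deriv h (S.refl_CA h.e1 hx) i 0
  have d2 := S.V_deriv h hx i (-0)
  have d3 := d2.comp 0 (hasDerivAt_neg (0:ℝ))
  have e1 : (fun t => U i (rot e b t (reflPt e x))) = (fun t => U i (rot e b t x)) ∘ Neg.neg := by
    funext t
    have : rot e b t (reflPt e x) = reflPt e (rot e b (-t) x) := by rw [h.refl_rot, neg_neg]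
    rw [this, hs i _ (S.rot_CA h hx _)]; rfl
  rw [e1] at d1
  have := d1.unique d3
  rw [neg_zero, rot_zero, rot_zero] at this
  rw [this]; ring

lemma V_T {e b : EuclN N} (h : ON e b) (hs : Sym a R U e) (i) {x} (hx : x ∈ CA N a R) (h0 : ⟪x, e⟫ = 0) :
    VV a R U e b i x = 0 := by
  have := S.V_refl h hs i hx
  have e1 : reflPt e x = x := by simp [reflPt, h0]
  rw [e1] at this; linarith

lemma V_zero_bd {e b : EuclN N} (h : ON e b) (hs : Sym a R U e) (i) {x} (hx : x ∈ HB a R e) (hn : x ∉ HD a R e) :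
    VV a R U e b i x = 0 := by
  by_cases h1 : x ∈ OA N a R
  · refine S.V_T h hs i (OA_sub a R h1) ?_
    by_contra h2
    exact hn ⟨h1.1, h1.2, lt_of_le_of_ne hx.2.2 (Ne.symm h2)⟩
  · exact S.V_bd h i (HB_sub_CA a R e hx) h1

lemma V_neg (e b : EuclN N) (i x) : VV a R U e (-b) i x = - VV a R U e b i x := by
  unfold VV
  rw [← map_neg]; congr 1
  simp only [ang_apply, inner_neg_left]; module

end Sys
end RP

namespace RP
open Filter Topology QF LapC MP
variable {N m : ℕ}

noncomputable def W (U : Fin m → EuclN N → ℝ) (e : EuclN N) (i : Fin m) (x : EuclN N) : ℝ :=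
  U i x - U i (reflPt e x)

lemma lap_zero_on {O : Set (EuclN N)} (hO : IsOpen O) {u : EuclN N → ℝ} (h : ∀ x ∈ O, u x = 0) {x} (hx : x ∈ O) :
    lap u x = 0 := by
  have : u =ᶠ[𝓝 x] fun _ => (0:ℝ) := by filter_upwards [hO.mem_nhds hx] with y hy using h y hy
  rw [lap_congr this, lap_const]

lemma refl_cont (e : EuclN N) : Continuous (reflPt e) := by unfold reflPt; fun_prop

lemma HD_neg {a R : ℝ} {e : EuclN N} (he : ‖e‖ = 1) {x} (hx : x ∈ HD a R (-e)) : reflPt e x ∈ HD a R e := by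
  have h := hx.2.2
  rw [inner_neg_right] at h
  exact ⟨by rw [norm_refl he]; exact hx.1, by rw [norm_refl he]; exact hx.2.1, by rw [inner_refl he]; exact h⟩

namespace Sys
variable {a R : ℝ} {f : Fin m → ℝ → (Fin m → ℝ) → ℝ} {U : Fin m → EuclN N → ℝ} {c : Fin m → Fin m → EuclN N → ℝ}
variable (S : Sys a R f U c)
include S

lemma co {x} (hx : x ∈ OA N a R) : ∀ i j, i ≠ j → ∀ s, 0 ≤ pd (f i) j ‖x‖ s :=
  fun i j hij s => S.coop i j hij _ hx.1 hx.2 s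

lemma W_cont {e : EuclN N} (he : ‖e‖ = 1) (i) : ContinuousOn (W U e i) (CA N a R) :=
  (S.Ucont i).sub ((S.Ucont i).comp (refl_cont e).continuousOn fun _ hx => S.refl_CA he hx)

lemma Wat {e : EuclN N} (he : ‖e‖ = 1) (i) {x} (hx : x ∈ OA N a R) : ContDiffAt ℝ 2 (fun y => U i (reflPt e y)) x := by
  have h1 : ContDiffAt ℝ 2 (U i) (reflPt e x) := (S.Uat i (S.refl_OA he hx)).of_le (by norm_num)
  refine h1.comp x ?_
  unfold reflPt
  exact contDiffAt_id.sub ((contDiffAt_const.mul (contDiffAt_id.inner ℝ contDiffAt_const)).smul contDiffAt_const)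

lemma W_C2 {e : EuclN N} (he : ‖e‖ = 1) (i) : ContDiffOn ℝ 2 (W U e i) (OA N a R) := fun x hx =>
  (((S.Uat i hx).of_le (by norm_num)).sub (S.Wat he i hx)).contDiffWithinAt

lemma W_lap {e : EuclN N} (he : ‖e‖ = 1) (i) {x} (hx : x ∈ OA N a R) :
    - lap (W U e i) x = f i ‖x‖ (fun k => U k x) - f i ‖x‖ (fun k => U k (reflPt e x)) := by
  unfold W
  rw [lap_sub ((S.Uat i hx).of_le (by norm_num)) (S.Wat he i hx), lap_refl _ he]
  have h1 := S.hsol i x hx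
  have h2 := S.hsol i _ (S.refl_OA he hx)
  rw [norm_refl he] at h2
  linarith

lemma W_bd {e : EuclN N} (he : ‖e‖ = 1) (i) {x} (hx : x ∈ HB a R e) (hn : x ∉ HD a R e) : W U e i x = 0 := by
  unfold W
  by_cases h1 : ‖x‖ < R
  · by_cases h2 : ‖x‖ = a
    · rcases S.ha.eq_or_lt with h3 | h3
      · have : x = 0 := by rw [← norm_eq_zero, h2, h3]
        simp [this, reflPt]
      · rw [S.hba h3 i x h2, S.hba h3 i _ (by rw [norm_refl he, h2]), sub_zero]
    · have h3 : ⟪x, e⟫ = 0 := by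
        by_contra h3
        exact hn ⟨lt_of_le_of_ne hx.1 (Ne.symm h2), h1, lt_of_le_of_ne hx.2.2 (Ne.symm h3)⟩
      simp [reflPt, h3]
  · have h2 : ‖x‖ = R := le_antisymm hx.2.1 (not_lt.1 h1)
    rw [S.hbR i x h2, S.hbR i _ (by rw [norm_refl he, h2]), sub_zero]

lemma smpW {e : EuclN N} (he : ‖e‖ = 1) (h0 : ∀ i, ∀ x ∈ HD a R e, 0 ≤ W U e i x) :
    (∀ i, ∀ x ∈ HD a R e, W U e i x = 0) ∨ ∀ i, ∀ x ∈ HD a R e, 0 < W U e i x := by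
  obtain ⟨L, hL, hLb⟩ := S.Lbound
  refine smp_sys (HD_open a R e) (HD_preconnected S.ha e) (fun i => (S.W_C2 he i).mono (HD_sub_OA a R e)) hL h0 ?_ ?_
  · intro i x hx
    have hxo := HD_sub_OA a R e hx
    have h1 := S.W_lap he i hxo
    have h2 := fB S.hf (S.co hxo) (fun i j => S.mono i j _) (i := i) (u := fun k => U k x) (v := fun k => U k (reflPt e x))
      (fun k => by have := h0 k x hx; unfold W at this; linarith)
    have h3 := hLb i x (OA_sub a R hxo) _ (S.refl_CA he (OA_sub a R hxo)) _ (S.refl_CA he (OA_sub a R hxo))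
      (fun k => U k (reflPt e x)) (fun k => by simp)
    have h4 := Finset.single_le_sum (f := fun j => |pd (f i) j ‖x‖ (fun k => U k (reflPt e x))|)
      (fun _ _ => abs_nonneg _) (Finset.mem_univ i)
    have h5 := neg_abs_le (pd (f i) i ‖x‖ (fun k => U k (reflPt e x)))
    have h6 := h0 i x hx
    have h7 : U i x - U i (reflPt e x) = W U e i x := rfl
    rw [h7] at h2
    nlinarith
  · intro I J hI hJ hd hu
    obtain ⟨i, hi, j, hj, x, hx, hp⟩ := S.coup e he I J hI hJ hd hu
    refine ⟨i, hi, j, hj, fun ⟨z1, z2⟩ => ?_⟩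
    have hxo := HD_sub_OA a R e hx
    have h1 := S.W_lap he i hxo
    rw [lap_zero_on (HD_open a R e) z1 hx] at h1
    have hij : i ≠ j := fun h => Finset.disjoint_left.1 hd hi (h ▸ hj)
    have h2 := fC S.hf (S.co hxo) hij (u := fun k => U k x) (v := fun k => U k (reflPt e x))
      (fun k => by have := h0 k x hx; unfold W at this; linarith)
      (by have := z1 x hx; unfold W at this; linarith) (by have := z2 x hx; unfold W at this; linarith) hp
    linarith

/-- linear combination `s Φ - V` of angular derivatives, abstractly -/
lemma smpL {e : EuclN N} (he : ‖e‖ = 1) {Z : Fin m → EuclN N → ℝ}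
    (hC : ∀ i, ContDiffOn ℝ 2 (Z i) (OA N a R)) (hZ : ∀ i, ∀ x ∈ OA N a R, - lap (Z i) x = ∑ j, c i j x * Z j x)
    (h0 : ∀ i, ∀ x ∈ HD a R e, 0 ≤ Z i x) :
    (∀ i, ∀ x ∈ HD a R e, Z i x = 0) ∨ ∀ i, ∀ x ∈ HD a R e, 0 < Z i x := by
  classical
  obtain ⟨L, hL, hLb⟩ := S.Lbound
  have hs : ∀ i j, ∀ x ∈ HD a R e, i ≠ j → 0 ≤ c i j x * Z j x := fun i j x hx hij => mul_nonneg (S.ccoop i j hij x) (h0 j x hx)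
  refine smp_sys (HD_open a R e) (HD_preconnected S.ha e) (fun i => (hC i).mono (HD_sub_OA a R e)) hL h0 ?_ ?_
  · intro i x hx
    have hxo := HD_sub_OA a R e hx
    have hxc := OA_sub a R hxo
    have h1 := hZ i x hxo
    rw [← Finset.add_sum_erase _ _ (Finset.mem_univ i)] at h1
    have h2 : 0 ≤ ∑ j ∈ Finset.univ.erase i, c i j x * Z j x :=
      Finset.sum_nonneg fun j hj => hs i j x hx (Finset.ne_of_mem_erase hj).symm
    have h3 := hLb i x hxc x hxc x hxc (fun k => U k x) (fun k => by simp)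
    have h4 := Finset.single_le_sum (f := fun j => |pd (f i) j ‖x‖ (fun k => U k x)|)
      (fun _ _ => abs_nonneg _) (Finset.mem_univ i)
    have h5 := neg_abs_le (pd (f i) i ‖x‖ (fun k => U k x))
    have h6 := h0 i x hx
    rw [S.hcU i i x hxo] at h1
    nlinarith
  · intro I J hI hJ hd hu
    obtain ⟨i, hi, j, hj, x, hx, hp⟩ := S.coup e he I J hI hJ hd hu
    refine ⟨i, hi, j, hj, fun ⟨z1, z2⟩ => ?_⟩
    have hxo := HD_sub_OA a R e hx
    have h1 := hZ i x hxo
    rw [lap_zero_on (HD_open a R e) z1 hx] at h1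
    have hij : i ≠ j := fun h => Finset.disjoint_left.1 hd hi (h ▸ hj)
    have h2 : c i j x * Z j x ≤ ∑ j, c i j x * Z j x := by
      refine Finset.single_le_sum (f := fun j => c i j x * Z j x) (fun k _ => ?_) (Finset.mem_univ j)
      by_cases hk : i = k
      · subst hk; rw [z1 x hx, mul_zero]
      · exact hs i k x hx hk
    rw [← S.hcU i j x hxo] at hp
    have := mul_pos hp (z2 x hx)
    linarith

/-- uniform narrow-domain data -/
lemma narrowW : ∃ δ > 0, ∀ e : EuclN N, ‖e‖ = 1 → (∀ i, ∀ x ∈ HD a R e, x ∈ KD a R δ e → 0 ≤ W U e i x) →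
    ∀ i, ∀ x ∈ HD a R e, 0 ≤ W U e i x := by
  obtain ⟨L, hL, hLb⟩ := S.Lbound
  obtain ⟨δ, hδ, h⟩ := narrow (N := N) S.ha S.haR hL
  refine ⟨δ, hδ, fun e he hK => ?_⟩
  obtain ⟨g, g1, g2, g3⟩ := h e he
  refine narrow_max hL g1 g2 g3 (fun i => (S.W_cont he i).mono (HB_sub_CA a R e))
    (fun i => (S.W_C2 he i).mono (HD_sub_OA a R e)) (fun i x hx hn => (S.W_bd he i hx hn).ge) hK ?_
  intro i x hx hneg hmin
  have hxo := HD_sub_OA a R e hx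
  have hxc := OA_sub a R hxo
  rw [S.W_lap he i hxo]
  exact fD S.hf (S.co hxo) (u := fun k => U k x) (v := fun k => U k (reflPt e x))
    (fun s hs => hLb i x hxc x hxc _ (S.refl_CA he hxc) s hs) hneg hmin

lemma narrowL : ∃ δ > 0, ∀ e : EuclN N, ‖e‖ = 1 → ∀ Z : Fin m → EuclN N → ℝ,
    (∀ i, ContDiffOn ℝ 2 (Z i) (OA N a R)) → (∀ i, ContinuousOn (Z i) (CA N a R)) →
    (∀ i, ∀ x ∈ HB a R e, x ∉ HD a R e → Z i x = 0) →
    (∀ i, ∀ x ∈ OA N a R, - lap (Z i) x = ∑ j, c i j x * Z j x) →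
    (∀ i, ∀ x ∈ HD a R e, x ∈ KD a R δ e → 0 ≤ Z i x) → ∀ i, ∀ x ∈ HD a R e, 0 ≤ Z i x := by
  obtain ⟨L, hL, hLb⟩ := S.Lbound
  obtain ⟨δ, hδ, h⟩ := narrow (N := N) S.ha S.haR hL
  refine ⟨δ, hδ, fun e he Z hC hZc hb hZ hK => ?_⟩
  obtain ⟨g, g1, g2, g3⟩ := h e he
  refine narrow_max hL g1 g2 g3 (fun i => (hZc i).mono (HB_sub_CA a R e))
    (fun i => (hC i).mono (HD_sub_OA a R e)) (fun i x hx hn => (hb i x hx hn).ge) hK ?_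
  intro i x hx hneg hmin
  have hxo := HD_sub_OA a R e hx
  have hxc := OA_sub a R hxo
  rw [hZ i x hxo]
  have h3 := hLb i x hxc x hxc x hxc (fun k => U k x) (fun k => by simp)
  have h2 : (∑ j, |pd (f i) j ‖x‖ (fun k => U k x)|) * Z i x ≤ ∑ j, c i j x * Z j x := by
    rw [Finset.sum_mul]
    refine Finset.sum_le_sum fun j _ => ?_
    rw [S.hcU i j x hxo]
    by_cases hj : j = i
    · subst hj; have := le_abs_self (pd (f j) j ‖x‖ (fun k => U k x)); nlinarith
    · have := S.co hxo i j (Ne.symm hj) (fun k => U k x)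
      rw [abs_of_nonneg this]; exact mul_le_mul_of_nonneg_left (hmin j) this
  nlinarith

lemma coupc {e : EuclN N} (he : ‖e‖ = 1) (I J : Finset (Fin m)) (hI : I.Nonempty) (hJ : J.Nonempty)
    (hd : Disjoint I J) (hu : I ∪ J = Finset.univ) : ∃ i ∈ I, ∃ j ∈ J, ∃ x ∈ HD a R e, 0 < c i j x := by
  obtain ⟨i, hi, j, hj, x, hx, hp⟩ := S.coup e he I J hI hJ hd hu
  exact ⟨i, hi, j, hj, x, hx, by rwa [S.hcU i j x (HD_sub_OA a R e hx)]⟩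

lemma sym_of_W {e : EuclN N} (he : ‖e‖ = 1) (h : ∀ i, ∀ x ∈ HD a R e, W U e i x = 0) : Sym a R U e := by
  have key : ∀ i, ∀ x ∈ HB a R e, U i (reflPt e x) = U i x := by
    intro i x hx
    have : W U e i x = 0 := by
      by_cases h1 : x ∈ HD a R e
      · exact h i x h1
      · exact S.W_bd he i hx h1
    unfold W at this; linarith
  intro i x hx
  rcases le_total 0 ⟪x, e⟫ with h1 | h1
  · exact key i x ⟨hx.1, hx.2, h1⟩
  · have h2 := S.refl_CA he hx
    have := key i _ ⟨h2.1, h2.2, by rw [inner_refl he]; linarith⟩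
    rw [refl_refl he] at this; exact this.symm

lemma W_alt {e : EuclN N} (he : ‖e‖ = 1) (hQ : ∀ Ψ, IsTestFun (HD a R e) Ψ → 0 ≤ BF c Ψ Ψ) :
    (∃ e' : EuclN N, ‖e'‖ = 1 ∧ ∀ i, ∀ x ∈ HD a R e', 0 < W U e' i x) ∨ Sym a R U e := by
  have D : LS.Dat c (HD a R e) (HB a R e) (W U e) :=
    { hc := S.hc, coop := S.ccoop, hO := HD_open a R e, hOc := HD_preconnected S.ha e, hB := HB_compact a R e
      hOB := HD_sub_HB a R e, hQ := hQ, hV := fun i => (S.W_C2 he i).mono (HD_sub_OA a R e)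
      hVB := fun i => (S.W_cont he i).mono (HB_sub_CA a R e), hV0 := fun i x hx hn => S.W_bd he i hx hn
      hsub := by
        intro i x hx hp
        have hxo := HD_sub_OA a R e hx
        rw [S.W_lap he i hxo]
        simp_rw [S.hcU _ _ x hxo]
        refine fA S.hf (S.co hxo) (fun i j => S.mono i j _) (u := fun k => U k x) (v := fun k => U k (reflPt e x)) ?_
        unfold W at hp; linarith }
  rcases D.concl (S.coupc he) with h | h
  · exact Or.inl ⟨e, he, h⟩
  · have he' : ‖-e‖ = 1 := by rw [norm_neg, he]
    have h0 : ∀ i, ∀ x ∈ HD a R (-e), 0 ≤ W U (-e) i x := by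
      intro i x hx
      have := h i _ (HD_neg he hx)
      unfold W at *
      rw [refl_refl he] at this
      rw [refl_neg]; linarith
    rcases S.smpW he' h0 with h1 | h1
    · right
      have := S.sym_of_W he' h1
      intro i x hx
      have := this i x hx
      rwa [refl_neg] at this
    · exact Or.inl ⟨_, he', h1⟩

lemma caseA {e : EuclN N} (he : ‖e‖ = 1) (hQ : ∀ Ψ, IsTestFun (HD a R e) Ψ → 0 ≤ BF c Ψ Ψ) (hs : Sym a R U e) :
    (∀ b, ON e b → ∀ i, ∀ x ∈ HD a R e, VV a R U e b i x = 0) ∨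
      ∃ b, ON e b ∧ ∀ i, ∀ x ∈ HD a R e, 0 < VV a R U e b i x := by
  have D : ∀ b, ON e b → LS.Dat c (HD a R e) (HB a R e) (VV a R U e b) := fun b h =>
    { hc := S.hc, coop := S.ccoop, hO := HD_open a R e, hOc := HD_preconnected S.ha e, hB := HB_compact a R e
      hOB := HD_sub_HB a R e, hQ := hQ, hV := fun i => (S.V_C2 e b i).mono (HD_sub_OA a R e)
      hVB := fun i => (S.V_cont e b i).mono (HB_sub_CA a R e), hV0 := fun i x hx hn => S.V_zero_bd h hs i hx hn
      hsub := by
        intro i x hx hp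
        have hxo := HD_sub_OA a R e hx
        rw [S.V_lap h i hxo]
        refine Finset.sum_le_sum fun j _ => ?_
        by_cases hj : i = j
        · subst hj; rw [max_eq_right hp.le]
        · exact mul_le_mul_of_nonneg_left (le_max_right _ _) (S.ccoop i j hj x) }
  by_cases hex : ∃ b, ON e b ∧ ∀ i, ∀ x ∈ HD a R e, 0 < VV a R U e b i x
  · exact Or.inr hex
  · left
    push Not at hex
    have key : ∀ b, ON e b → ∀ i, ∀ x ∈ HD a R e, VV a R U e b i x ≤ 0 := by
      intro b hb
      rcases (D b hb).concl (S.coupc he) with h | h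
      · obtain ⟨i, x, hx, h1⟩ := hex b hb
        exact absurd (h i x hx) (not_lt.2 h1)
      · exact h
    intro b hb i x hx
    have h1 := key b hb i x hx
    have h2 := key (-b) hb.neg i x hx
    rw [S.V_neg] at h2
    linarith

end Sys
end RP

namespace RP
open Filter Topology QF LapC MP
variable {N m : ℕ}

noncomputable def dd (e b : EuclN N) (θ : ℝ) : EuclN N := cos θ • e + sin θ • b

lemma dd_cont (e b : EuclN N) : Continuous (dd e b) := by unfold dd; fun_prop

lemma dd_turn (e b : EuclN N) (θ s : ℝ) :
    dd e b (θ + s) = cos s • (cos θ • e + sin θ • b) + sin s • (-sin θ • e + cos θ • b) := by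
  unfold dd; rw [cos_add, sin_add]; module

lemma KD_sub_HD {a R δ : ℝ} (hδ : 0 < δ) (e : EuclN N) : KD a R δ e ⊆ HD a R e :=
  fun x hx => ⟨by linarith [hx.1], by linarith [hx.2.1], by linarith [hx.2.2]⟩

lemma refl_cont2 (e b : EuclN N) : Continuous fun q : EuclN N × ℝ => reflPt (dd e b q.2) q.1 := by
  have := dd_cont e b
  unfold reflPt; fun_prop

lemma deriv_nonpos {g : ℝ → ℝ} {g' : ℝ} (h : HasDerivAt g g' 0) (hg : ∀ᶠ s in 𝓝[>] (0:ℝ), g s ≤ g 0) : g' ≤ 0 := by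
  have h1 := (hasDerivAt_iff_tendsto_slope.1 h).mono_left
    (nhdsWithin_mono 0 (show Ioi (0:ℝ) ⊆ {0}ᶜ from fun x hx => (ne_of_gt hx)))
  refine le_of_tendsto h1 ?_
  filter_upwards [hg, self_mem_nhdsWithin] with s hs hs0
  rw [slope_def_field]
  exact div_nonpos_of_nonpos_of_nonneg (by linarith) (by simpa using (le_of_lt hs0))

namespace Sys
variable {a R : ℝ} {f : Fin m → ℝ → (Fin m → ℝ) → ℝ} {U : Fin m → EuclN N → ℝ} {c : Fin m → Fin m → EuclN N → ℝ}
variable (S : Sys a R f U c)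
include S

lemma HD_ne {e : EuclN N} (he : ‖e‖ = 1) : ∃ x, x ∈ HD a R e := by
  have := S.ha; have := S.haR
  refine ⟨((a+R)/2) • e, ?_, ?_, ?_⟩
  · rw [norm_smul, he, Real.norm_of_nonneg (by linarith)]; linarith
  · rw [norm_smul, he, Real.norm_of_nonneg (by linarith)]; linarith
  · rw [inner_smul_left, real_inner_self_eq_norm_sq, he]; simp; linarith

lemma V_all {e b : EuclN N} (h : ON e b) (hs : Sym a R U e) (h0 : ∀ i, ∀ x ∈ HD a R e, VV a R U e b i x = 0)
    (i) {x} (hx : x ∈ CA N a R) : VV a R U e b i x = 0 := by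
  have key : ∀ x ∈ HB a R e, VV a R U e b i x = 0 := by
    intro x hx
    by_cases h1 : x ∈ HD a R e
    · exact h0 i x h1
    · exact S.V_zero_bd h hs i hx h1
  rcases le_total 0 ⟪x, e⟫ with h1 | h1
  · exact key x ⟨hx.1, hx.2, h1⟩
  · have h2 := S.refl_CA h.e1 hx
    have := key _ ⟨h2.1, h2.2, by rw [inner_refl h.e1]; linarith⟩
    rw [S.V_refl h hs i hx] at this; linarith

lemma V_inv {e b : EuclN N} (h : ON e b) (hs : Sym a R U e) (h0 : ∀ i, ∀ x ∈ HD a R e, VV a R U e b i x = 0)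
    (i) {x} (hx : x ∈ CA N a R) (t) : U i (rot e b t x) = U i x := by
  have := is_const_of_deriv_eq_zero (f := fun t => U i (rot e b t x))
    (fun t => (S.V_deriv h hx i t).differentiableAt)
    (fun t => by rw [(S.V_deriv h hx i t).deriv, S.V_all h hs h0 i (S.rot_CA h hx t)]) t 0
  simpa [rot_zero] using this

lemma W_at2 {e b : EuclN N} (h : ON e b) (i) {x θ} (hx : x ∈ OA N a R) :
    ContinuousAt (fun q : EuclN N × ℝ => W U (dd e b q.2) i q.1) (x, θ) := by
  unfold W
  refine ContinuousAt.sub ?_ ?_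
  · exact (S.Uat i hx).continuousAt.comp_of_eq continuousAt_fst rfl
  · exact (S.Uat i (S.refl_OA (h.unit θ) hx)).continuousAt.comp_of_eq (refl_cont2 e b).continuousAt rfl

lemma open_neg {e b : EuclN N} (h : ON e b) {θ : ℝ} (hn : ¬ ∀ i, ∀ x ∈ HD a R (dd e b θ), 0 ≤ W U (dd e b θ) i x) :
    ∀ᶠ s in 𝓝 θ, ¬ ∀ i, ∀ x ∈ HD a R (dd e b s), 0 ≤ W U (dd e b s) i x := by
  push Not at hn
  obtain ⟨i, x, hx, hw⟩ := hn
  have h1 : ∀ᶠ s in 𝓝 θ, 0 < ⟪x, dd e b s⟫ :=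
    (continuous_const.inner (dd_cont e b)).continuousAt.eventually (lt_mem_nhds hx.2.2)
  have h2 : ∀ᶠ s in 𝓝 θ, W U (dd e b s) i x < 0 :=
    ((S.W_at2 h i (HD_sub_OA a R _ hx)).comp (f := fun s : ℝ => (x, s)) (by fun_prop)).eventually (gt_mem_nhds hw)
  filter_upwards [h1, h2] with s s1 s2 hc
  exact absurd (hc i x ⟨hx.1, hx.2.1, s1⟩) (not_le.2 s2)

lemma open_pos {e b : EuclN N} (h : ON e b) {θ : ℝ} (hp : ∀ i, ∀ x ∈ HD a R (dd e b θ), 0 < W U (dd e b θ) i x) :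
    ∀ᶠ s in 𝓝 θ, ∀ i, ∀ x ∈ HD a R (dd e b s), 0 ≤ W U (dd e b s) i x := by
  obtain ⟨δ, hδ, hnar⟩ := S.narrowW
  have key : ∀ᶠ s in 𝓝 θ, ∀ x ∈ CA N a R, x ∈ KD a R δ (dd e b s) → ∀ i, 0 ≤ W U (dd e b s) i x := by
    refine (CA_compact a R).eventually_forall_of_forall_eventually fun x hx => ?_
    by_cases hk : x ∈ KD a R δ (dd e b θ)
    · have hx' := KD_sub_HD hδ _ hk
      have : ∀ᶠ q : EuclN N × ℝ in 𝓝 (x, θ), ∀ i, 0 < W U (dd e b q.2) i q.1 := by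
        rw [eventually_all]
        intro i
        exact (S.W_at2 h i (HD_sub_OA a R _ hx')).eventually (lt_mem_nhds (hp i x hx'))
      have := (continuous_swap (X := ℝ) (Y := EuclN N)).continuousAt (x := (θ, x)) |>.eventually this
      filter_upwards [this] with q hq _ i using (hq i).le
    · have hcl : IsClosed {q : ℝ × EuclN N | q.2 ∈ KD a R δ (dd e b q.1)} := by
        have := dd_cont e b
        have h1 : IsClosed {q : ℝ × EuclN N | a + δ ≤ ‖q.2‖} := isClosed_le (by fun_prop) (by fun_prop)
        have h2 : IsClosed {q : ℝ × EuclN N | ‖q.2‖ ≤ R - δ} := isClosed_le (by fun_prop) (by fun_prop)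
        have h3 : IsClosed {q : ℝ × EuclN N | δ ≤ ⟪q.2, dd e b q.1⟫} := isClosed_le (by fun_prop) (by fun_prop)
        exact h1.inter (h2.inter h3)
      filter_upwards [hcl.isOpen_compl.mem_nhds (show (θ, x) ∈ _ from hk)] with q hq hq2
      exact absurd hq2 hq
  filter_upwards [key] with s hs
  exact hnar _ (h.unit s) fun i x hx hk => hs x (OA_sub a R (HD_sub_OA a R _ hx)) hk i

lemma caseB {e : EuclN N} (he : ‖e‖ = 1) (hp : ∀ i, ∀ x ∈ HD a R e, 0 < W U e i x) :
    ∃ e' b' : EuclN N, ON e' b' ∧ Sym a R U e' ∧ ∀ i, ∀ x ∈ HD a R e', 0 < VV a R U e' b' i x := by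
  obtain ⟨b, h⟩ := exists_perp S.hN he
  set P : ℝ → Prop := fun θ => ∀ i, ∀ x ∈ HD a R (dd e b θ), 0 ≤ W U (dd e b θ) i x with hP
  set T : Set ℝ := {θ | θ ∈ Icc 0 π ∧ ¬ P θ} with hT
  have d0 : dd e b 0 = e := by simp [dd]
  have dpi : dd e b π = -e := by simp [dd]
  have i0 : Fin m := ⟨0, S.hm⟩
  have hπ : π ∈ T := by
    refine ⟨⟨pi_pos.le, le_rfl⟩, fun hc => ?_⟩
    rw [hP] at hc
    simp only [dpi] at hc
    obtain ⟨x, hx⟩ := S.HD_ne (e := -e) (by rw [norm_neg, he])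
    have h1 := hc i0 x hx
    have h2 := hp i0 _ (HD_neg he hx)
    unfold W at h1 h2
    rw [refl_neg] at h1; rw [refl_refl he] at h2
    linarith
  have hbdd : BddBelow T := ⟨0, fun θ hθ => hθ.1.1⟩
  set θ₀ := sInf T with hθ
  have hθ0 : 0 ≤ θ₀ := le_csInf ⟨π, hπ⟩ fun θ hθ => hθ.1.1
  have hθπ : θ₀ ≤ π := csInf_le hbdd hπ
  have hlow : ∀ θ, 0 ≤ θ → θ < θ₀ → P θ := by
    intro θ h1 h2
    by_contra h3
    exact absurd (csInf_le hbdd (show θ ∈ T from ⟨⟨h1, by linarith⟩, h3⟩)) (not_le.2 h2)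
  have hP0 : P 0 := by rw [hP]; simp only [d0]; exact fun i x hx => (hp i x hx).le
  have hPθ : P θ₀ := by
    by_contra hn
    have hne : θ₀ ≠ 0 := fun h0 => hn (h0 ▸ hP0)
    have hpos : 0 < θ₀ := lt_of_le_of_ne hθ0 hne.symm
    obtain ⟨ε, hε, hb⟩ := Metric.eventually_nhds_iff_ball.1 (S.open_neg h hn)
    have h1 : max (θ₀/2) (θ₀ - ε/2) < θ₀ := max_lt (by linarith) (by linarith)
    have h2 := le_max_left (θ₀/2) (θ₀ - ε/2)
    have h3 := le_max_right (θ₀/2) (θ₀ - ε/2)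
    refine hb (max (θ₀/2) (θ₀ - ε/2)) ?_ (hlow _ (by linarith) h1)
    rw [Metric.mem_ball, Real.dist_eq, abs_lt]; constructor <;> linarith
  have hsym0 : ∀ i, ∀ x ∈ HD a R (dd e b θ₀), W U (dd e b θ₀) i x = 0 := by
    rcases S.smpW (h.unit θ₀) hPθ with h1 | h1
    · exact h1
    · exfalso
      obtain ⟨ε, hε, hb⟩ := Metric.eventually_nhds_iff_ball.1 (S.open_pos h h1)
      obtain ⟨θ, hθT, hlt⟩ := exists_lt_of_csInf_lt ⟨π, hπ⟩ (show sInf T < θ₀ + ε by linarith)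
      have hge : θ₀ ≤ θ := csInf_le hbdd hθT
      refine hθT.2 (hb θ ?_)
      rw [Metric.mem_ball, Real.dist_eq, abs_lt]; constructor <;> linarith
  have hne : θ₀ ≠ 0 := by
    intro h0
    rw [h0, d0] at hsym0
    obtain ⟨x, hx⟩ := S.HD_ne he
    exact absurd (hsym0 i0 x hx) (hp i0 x hx).ne'
  have hpos : 0 < θ₀ := lt_of_le_of_ne hθ0 hne.symm
  have h' := h.turn θ₀
  have hs : Sym a R U (cos θ₀ • e + sin θ₀ • b) := S.sym_of_W (h.unit θ₀) hsym0
  set e' := cos θ₀ • e + sin θ₀ • b with he'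
  set b' := -sin θ₀ • e + cos θ₀ • b with hb'
  refine ⟨e', -b', h'.neg, hs, ?_⟩
  have hnn : ∀ i, ∀ x ∈ HD a R e', 0 ≤ VV a R U e' (-b') i x := by
    intro i x hx
    rw [S.V_neg]
    have hxc := OA_sub a R (HD_sub_OA a R _ hx)
    have hd := S.V_deriv h' hxc i 0
    rw [rot_zero] at hd
    have : VV a R U e' b' i x ≤ 0 := by
      refine deriv_nonpos hd ?_
      have h1 : ∀ᶠ s in 𝓝 (0:ℝ), 0 < ⟪x, dd e b (θ₀ + -(s/2))⟫ := by
        have hc : Continuous fun s : ℝ => ⟪x, dd e b (θ₀ + -(s/2))⟫ :=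
          continuous_const.inner ((dd_cont e b).comp (by fun_prop))
        refine hc.continuousAt.eventually (lt_mem_nhds ?_)
        simp only [zero_div, neg_zero, add_zero]; exact hx.2.2
      have h2 : ∀ᶠ s in 𝓝 (0:ℝ), s < θ₀ := gt_mem_nhds hpos
      filter_upwards [h1.filter_mono nhdsWithin_le_nhds, h2.filter_mono nhdsWithin_le_nhds, self_mem_nhdsWithin] with s s1 s2 s3
      have s3 : 0 < s := s3
      have h4 := hlow (θ₀ + -(s/2)) (by linarith) (by linarith) i x ⟨hx.1, hx.2.1, s1⟩
      unfold W at h4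
      rw [dd_turn, h'.refl_comp] at h4
      have h5 : rot e' b' (2 * -(s/2)) (reflPt e' x) = reflPt e' (rot e' b' s x) := by
        rw [h'.refl_rot]; congr 1; ring
      rw [h5, hs i _ (S.rot_CA h' hxc s)] at h4
      rw [rot_zero]; linarith
    linarith
  rcases S.smpL h'.e1 (S.V_C2 e' (-b')) (fun i x hx => S.V_lap h'.neg i hx) hnn with h1 | h1
  · exfalso
    obtain ⟨x, hx⟩ := S.HD_ne he
    have h2 := hp i0 x hx
    have hxc := OA_sub a R (HD_sub_OA a R _ hx)
    unfold W at h2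
    have h3 : reflPt e x = rot e' b' (2 * (-θ₀)) (reflPt e' x) := by
      rw [← h'.refl_comp, he', hb', ← dd_turn, add_neg_cancel, d0]
    have h4 := S.V_inv h'.neg hs h1 i0 (S.refl_CA h'.e1 hxc) (-(2 * (-θ₀)))
    rw [rot_neg_b, neg_neg, ← h3, hs i0 x hxc] at h4
    linarith
  · exact h1

end Sys
end RP

namespace RP
open Filter Topology QF LapC MP
variable {N m : ℕ}

lemma KD_compact (a R δ : ℝ) (e : EuclN N) : IsCompact (KD a R δ e) := by
  have h1 : IsClosed {q : EuclN N | a + δ ≤ ‖q‖} := isClosed_le (by fun_prop) (by fun_prop)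
  have h2 : IsClosed {q : EuclN N | ‖q‖ ≤ R - δ} := isClosed_le (by fun_prop) (by fun_prop)
  have h3 : IsClosed {q : EuclN N | δ ≤ ⟪q, e⟫} := isClosed_le (by fun_prop) (by fun_prop)
  exact (isCompact_closedBall 0 (R - δ)).of_isClosed_subset (h1.inter (h2.inter h3)) (fun x hx => by simpa using hx.2.1)

lemma lt_bound {K : Set (EuclN N)} (hK : IsCompact K) {g : EuclN N → ℝ} (hg : ContinuousOn g K) {s : ℝ}
    (h : ∀ x ∈ K, g x < s) : ∃ M < s, ∀ x ∈ K, g x ≤ M := by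
  rcases K.eq_empty_or_nonempty with h0 | h0
  · exact ⟨s - 1, by linarith, by simp [h0]⟩
  · obtain ⟨x, hx, hm⟩ := hK.exists_isMaxOn h0 hg
    exact ⟨g x, h x hx, fun y hy => hm hy⟩

lemma exists_angle (p q : ℝ) : ∃ t, √(p^2+q^2) * cos t = p ∧ √(p^2+q^2) * sin t = q ∧ (0 ≤ p → t ∈ Icc (-(π/2)) (π/2)) := by
  have h : ‖(⟨p, q⟩ : ℂ)‖ = √(p^2+q^2) := by
    rw [Complex.norm_def, Complex.normSq_mk]; congr 1; ring
  refine ⟨Complex.arg ⟨p, q⟩, ?_, ?_, fun hp => ?_⟩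
  · rw [← h, Complex.norm_mul_cos_arg]
  · rw [← h, Complex.norm_mul_sin_arg]
  · exact abs_le.1 (Complex.abs_arg_le_pi_div_two_iff.2 hp)

namespace Sys
variable {a R : ℝ} {f : Fin m → ℝ → (Fin m → ℝ) → ℝ} {U : Fin m → EuclN N → ℝ} {c : Fin m → Fin m → EuclN N → ℝ}
variable (S : Sys a R f U c)
include S

lemma prop {e b₀ b : EuclN N} (h : ON e b₀) (hb : ON e b) (hs : Sym a R U e)
    (hp : ∀ i, ∀ x ∈ HD a R e, 0 < VV a R U e b₀ i x) :
    ∃ s : ℝ, ∀ i, ∀ x ∈ HD a R e, VV a R U e b i x = s * VV a R U e b₀ i x := by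
  haveI : Nonempty (Fin m) := ⟨⟨0, S.hm⟩⟩
  set Φ := VV a R U e b₀ with hΦ
  set V := VV a R U e b with hV
  obtain ⟨δ, hδ, hnar⟩ := S.narrowL
  have zC : ∀ s : ℝ, ∀ i, ContDiffOn ℝ 2 (fun x => s * Φ i x - V i x) (OA N a R) := fun s i =>
    (contDiffOn_const.mul (S.V_C2 e b₀ i)).sub (S.V_C2 e b i)
  have zL : ∀ s : ℝ, ∀ i, ∀ x ∈ OA N a R, - lap (fun x => s * Φ i x - V i x) x = ∑ j, c i j x * (s * Φ j x - V j x) := by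
    intro s i x hx
    have h1 : ContDiffAt ℝ 2 (Φ i) x := (S.V_C2 e b₀ i).contDiffAt ((OA_open a R).mem_nhds hx)
    have h2 : ContDiffAt ℝ 2 (V i) x := (S.V_C2 e b i).contDiffAt ((OA_open a R).mem_nhds hx)
    rw [lap_sub (contDiffAt_const.mul h1) h2, lap_smul s h1]
    have e1 := S.V_lap h i hx
    have e2 := S.V_lap hb i hx
    have e3 : ∑ j, c i j x * (s * Φ j x - V j x) = s * (∑ j, c i j x * Φ j x) - ∑ j, c i j x * V j x := by
      rw [Finset.mul_sum, ← Finset.sum_sub_distrib]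
      exact Finset.sum_congr rfl fun j _ => by ring
    rw [e3, ← e1, ← e2]; ring
  have core : ∀ s, (∀ i, ∀ x ∈ KD a R δ e, V i x / Φ i x ≤ s) → ∀ i, ∀ x ∈ HD a R e, V i x / Φ i x ≤ s := by
    intro s hk i x hx
    have := hnar e h.e1 (fun i x => s * Φ i x - V i x) (zC s)
      (fun i => (continuousOn_const.mul (S.V_cont e b₀ i)).sub (S.V_cont e b i))
      (fun i x hx hn => by simp only [hΦ, hV]; rw [S.V_zero_bd h hs i hx hn, S.V_zero_bd hb hs i hx hn]; ring)
      (zL s) (fun i x hx hxk => by have := hk i x hxk; rw [div_le_iff₀ (hp i x hx)] at this; linarith) i x hx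
    rw [div_le_iff₀ (hp i x hx)]; linarith
  have qc : ∀ i, ContinuousOn (fun x => V i x / Φ i x) (KD a R δ e) := fun i => by
    have hsub : KD a R δ e ⊆ CA N a R := (KD_sub_HD hδ e).trans ((HD_sub_OA a R e).trans (OA_sub a R))
    exact ((S.V_cont e b i).mono hsub).div ((S.V_cont e b₀ i).mono hsub) fun x hx => (hp i x (KD_sub_HD hδ e hx)).ne'
  set A : Set ℝ := {s | ∀ i, ∀ x ∈ HD a R e, V i x / Φ i x ≤ s} with hA
  have hAne : A.Nonempty := by
    choose M hM using fun i => (KD_compact a R δ e).exists_bound_of_continuousOn (qc i)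
    obtain ⟨i0, h0⟩ := Finite.exists_max M
    exact ⟨M i0, core _ fun i x hx => ((le_abs_self _).trans (hM i x hx)).trans (h0 i)⟩
  obtain ⟨x1, hx1⟩ := S.HD_ne h.e1
  have hbdd : BddBelow A := ⟨V ⟨0, S.hm⟩ x1 / Φ ⟨0, S.hm⟩ x1, fun s hs => hs _ _ hx1⟩
  have hin : sInf A ∈ A := fun i x hx => le_csInf hAne fun s hs => hs i x hx
  refine ⟨sInf A, ?_⟩
  rcases S.smpL h.e1 (zC (sInf A)) (zL (sInf A)) (fun i x hx => by
    have := hin i x hx; rw [div_le_iff₀ (hp i x hx)] at this; linarith) with h1 | h1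
  · intro i x hx; have := h1 i x hx; linarith
  · exfalso
    choose M hM hM2 using fun i => lt_bound (KD_compact a R δ e) (qc i) (s := sInf A) fun x hx => by
      have hx' := KD_sub_HD hδ e hx
      have := h1 i x hx'; rw [div_lt_iff₀ (hp i x hx')]; linarith
    obtain ⟨i0, h0⟩ := Finite.exists_max M
    have : M i0 ∈ A := core _ fun i x hx => (hM2 i x hx).trans (h0 i)
    exact absurd (csInf_le hbdd this) (not_le.2 (hM i0))

/-- the axis -/
lemma axis (hex : ∃ e : EuclN N, ‖e‖ = 1 ∧ ∀ Ψ, IsTestFun (HD a R e) Ψ → 0 ≤ BF c Ψ Ψ) :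
    ∃ e p : EuclN N, ON e p ∧ Sym a R U e ∧
      (∀ b, ON e b → ⟪p, b⟫ = 0 → ∀ i, ∀ x ∈ HD a R e, VV a R U e b i x = 0) ∧
      ((∀ i, ∀ x ∈ HD a R e, VV a R U e p i x = 0) ∨ ∀ i, ∀ x ∈ HD a R e, 0 < VV a R U e p i x) := by
  have good : ∃ e : EuclN N, ‖e‖ = 1 ∧ Sym a R U e ∧ ((∀ b, ON e b → ∀ i, ∀ x ∈ HD a R e, VV a R U e b i x = 0) ∨
      ∃ b, ON e b ∧ ∀ i, ∀ x ∈ HD a R e, 0 < VV a R U e b i x) := by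
    obtain ⟨e, he, hQ⟩ := hex
    rcases S.W_alt he hQ with ⟨e', he', hp⟩ | hs
    · obtain ⟨e₁, b₁, h1, h2, h3⟩ := S.caseB he' hp
      exact ⟨e₁, h1.e1, h2, Or.inr ⟨b₁, h1, h3⟩⟩
    · exact ⟨e, he, hs, S.caseA he hQ hs⟩
  obtain ⟨e, he, hs, h | ⟨b₀, h0, hp⟩⟩ := good
  · obtain ⟨p, hp⟩ := exists_perp S.hN he
    exact ⟨e, p, hp, hs, fun b hb _ => h b hb, Or.inl (h p hp)⟩
  · obtain ⟨x1, hx1⟩ := S.HD_ne he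
    set i0 : Fin m := ⟨0, S.hm⟩
    set D := fderivWithin ℝ (U i0) (CA N a R) x1 with hD
    set g := (InnerProductSpace.toDual ℝ (EuclN N)).symm D with hg
    have hgD : ∀ v, D v = ⟪g, v⟫ := fun v => by rw [hg, InnerProductSpace.toDual_symm_apply]
    set q := ⟪e, x1⟫ • g - ⟪g, e⟫ • x1 with hq
    have hl : ∀ b, VV a R U e b i0 x1 = ⟪q, b⟫ := by
      intro b
      unfold VV
      rw [← hD, hgD, ang_apply, hq]
      simp only [inner_sub_right, inner_sub_left, inner_smul_left, inner_smul_right, real_inner_comm x1 b]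
      simp; ring
    have hqe : ⟪e, q⟫ = 0 := by
      rw [hq]; simp only [inner_sub_right, inner_smul_right, real_inner_comm g e]; ring
    have hq0 : 0 < ‖q‖ := by
      rw [norm_pos_iff]
      intro h; have := hp i0 x1 hx1; rw [hl, h, inner_zero_left] at this; exact lt_irrefl _ this
    have hpp : ON e (‖q‖⁻¹ • q) := ⟨he, by rw [norm_smul, norm_inv, norm_norm, inv_mul_cancel₀ hq0.ne'],
      by rw [inner_smul_right, hqe, mul_zero]⟩
    refine ⟨e, ‖q‖⁻¹ • q, hpp, hs, ?_, Or.inr ?_⟩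
    · intro b hb hbp i x hx
      obtain ⟨s, hS⟩ := S.prop h0 hb hs hp
      have h1 := hS i0 x1 hx1
      have h2 : ⟪q, b⟫ = 0 := by
        rw [inner_smul_left] at hbp
        exact (mul_eq_zero.1 hbp).resolve_left (by simpa using norm_pos_iff.1 hq0)
      rw [hl, h2] at h1
      have : s = 0 := (mul_eq_zero.1 h1.symm).resolve_right (hp i0 x1 hx1).ne'
      rw [hS i x hx, this, zero_mul]
    · obtain ⟨s, hS⟩ := S.prop h0 hpp hs hp
      have h1 := hS i0 x1 hx1
      rw [hl, inner_smul_right, real_inner_self_eq_norm_sq] at h1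
      have h2 : 0 < s * VV a R U e b₀ i0 x1 := by rw [← h1]; positivity
      have hs0 : 0 < s := by
        by_contra hc
        have := mul_nonpos_of_nonpos_of_nonneg (not_lt.1 hc) (hp i0 x1 hx1).le
        linarith
      intro i x hx
      rw [hS i x hx]; exact mul_pos hs0 (hp i x hx)

lemma reduce {e p : EuclN N} (h : ON e p) (hs : Sym a R U e)
    (hb : ∀ b, ON e b → ⟪p, b⟫ = 0 → ∀ i, ∀ x ∈ HD a R e, VV a R U e b i x = 0) {x} (hx : x ∈ CA N a R) :
    ∃ φ ∈ Icc (-(π/2)) (π/2), ⟪x, p⟫ = ‖x‖ * sin φ ∧ ∀ i, U i x = U i (rot e p φ (‖x‖ • e)) := by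
  set w := x - ⟪x, p⟫ • p - ⟪x, e⟫ • e with hw
  have hxw : x = ⟪x, e⟫ • e + ⟪x, p⟫ • p + w := by rw [hw]; module
  have we : ⟪e, w⟫ = 0 := by
    rw [hw]; simp only [inner_sub_right, inner_smul_right, h.ee, h.eb, real_inner_comm x e]; ring
  have wp : ⟪p, w⟫ = 0 := by
    rw [hw]; simp only [inner_sub_right, inner_smul_right, h.bb, h.be, real_inner_comm x p]; ring
  have hn : ‖x‖^2 = ⟪x, e⟫^2 + ⟪x, p⟫^2 + ‖w‖^2 := by
    have : ⟪x, w⟫ = ‖w‖^2 := by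
      conv_lhs => rw [hxw]
      simp only [inner_add_left, inner_smul_left, we, wp, real_inner_self_eq_norm_sq]; simp
    have h2 : ⟪x, x⟫ = ⟪x, e⟫ * ⟪x, e⟫ + ⟪x, p⟫ * ⟪x, p⟫ + ⟪x, w⟫ := by
      have : ⟪x, x⟫ = ⟪x, ⟪x, e⟫ • e + ⟪x, p⟫ • p + w⟫ := by rw [← hxw]
      rw [this]; simp only [inner_add_right, inner_smul_right]
    rw [← real_inner_self_eq_norm_sq, h2, this]; ring
  set τ := √(⟪x, e⟫^2 + ‖w‖^2) with hτ
  have hτ0 : 0 ≤ τ := sqrt_nonneg _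
  have hτ2 : τ^2 = ⟪x, e⟫^2 + ‖w‖^2 := sq_sqrt (by positivity)
  have hρ : √(τ^2 + ⟪x, p⟫^2) = ‖x‖ := by
    rw [hτ2, ← sqrt_sq (norm_nonneg x), hn]; congr 1; ring
  obtain ⟨φ, f1, f2, f3⟩ := exists_angle τ ⟪x, p⟫
  rw [hρ] at f1 f2
  refine ⟨φ, f3 hτ0, f2.symm, fun i => ?_⟩
  have hy : rot e p φ (‖x‖ • e) = τ • e + ⟪x, p⟫ • p := by
    have e1 := h.inner_e φ (‖x‖ • e)
    rw [← f1, ← f2]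
    unfold rot
    simp only [inner_smul_right, h.ee, h.be]; module
  have hyn : ‖τ • e + ⟪x, p⟫ • p‖ = ‖x‖ := by
    rw [← hy, h.rot_norm, norm_smul, h.e1, norm_norm, mul_one]
  have hyc : τ • e + ⟪x, p⟫ • p ∈ CA N a R := by unfold CA at *; simpa [hyn] using hx
  rw [hy]
  by_cases hw0 : w = 0
  · rcases le_total 0 ⟪x, e⟫ with h1 | h1
    · have : τ = ⟪x, e⟫ := by rw [hτ, hw0]; simp [h1]
      rw [this]; conv_lhs => rw [hxw, hw0, add_zero]
    · have : τ = -⟪x, e⟫ := by rw [hτ, hw0]; simp [sqrt_sq_eq_abs, abs_of_nonpos h1]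
      rw [← hs i x hx]
      congr 1
      unfold reflPt
      rw [this]; conv_lhs => arg 1; rw [hxw, hw0]
      module
  · have hwn : 0 < ‖w‖ := norm_pos_iff.2 hw0
    have ob : ON e (‖w‖⁻¹ • w) := ⟨h.e1, by rw [norm_smul, norm_inv, norm_norm, inv_mul_cancel₀ hwn.ne'],
      by rw [inner_smul_right, we, mul_zero]⟩
    obtain ⟨t, t1, t2, -⟩ := exists_angle ⟪x, e⟫ ‖w‖
    rw [← hτ] at t1 t2
    have := S.V_inv ob hs (hb _ ob (by rw [inner_smul_right, wp, mul_zero])) i hyc t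
    rw [← this]; congr 1
    have e1 : ⟪e, τ • e + ⟪x, p⟫ • p⟫ = τ := by simp only [inner_add_right, inner_smul_right, h.ee, h.eb]; ring
    have e2 : ⟪‖w‖⁻¹ • w, τ • e + ⟪x, p⟫ • p⟫ = 0 := by
      simp only [inner_add_right, inner_smul_right, inner_smul_left, real_inner_comm e w, real_inner_comm p w, we, wp]; simp
    have e3 : w = (τ * sin t) • (‖w‖⁻¹ • w) := by rw [t2, smul_smul, mul_inv_cancel₀ hwn.ne', one_smul]
    unfold rot
    rw [e1, e2]
    conv_lhs => rw [hxw, ← t1, e3]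
    module

theorem final (hex : ∃ e : EuclN N, ‖e‖ = 1 ∧ ∀ Ψ, IsTestFun (HD a R e) Ψ → 0 ≤ BF c Ψ Ψ) :
    ∃ p : EuclN N, ‖p‖ = 1 ∧ (∀ i, ∀ x ∈ OA N a R, ∀ y ∈ OA N a R, ‖x‖ = ‖y‖ → ⟪y, p⟫ ≤ ⟪x, p⟫ → U i y ≤ U i x) ∧
      ((∀ i, ∀ x ∈ OA N a R, ∀ y ∈ OA N a R, ‖x‖ = ‖y‖ → U i x = U i y) ∨
        ∀ i, ∀ x ∈ OA N a R, ∀ y ∈ OA N a R, ‖x‖ = ‖y‖ → ⟪y, p⟫ < ⟪x, p⟫ → U i y < U i x) := by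
  obtain ⟨e, p, h, hs, hb, hal⟩ := S.axis hex
  have hin : ∀ ρ : ℝ, a < ρ → ρ < R → ∀ t ∈ Ioo (-(π/2)) (π/2), rot e p t (ρ • e) ∈ HD a R e := by
    intro ρ h1 h2 t ht
    have h0 : 0 < ρ := S.ha.trans_lt h1
    have hnm : ‖rot e p t (ρ • e)‖ = ρ := by
      rw [h.rot_norm, norm_smul, h.e1, mul_one, Real.norm_of_nonneg h0.le]
    refine ⟨by rwa [hnm], by rwa [hnm], ?_⟩
    rw [real_inner_comm, h.inner_e]
    simp only [inner_smul_right, h.ee, h.be]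
    have := mul_pos (cos_pos_of_mem_Ioo ht) h0
    linarith
  have hca : ∀ ρ : ℝ, a < ρ → ρ < R → ρ • e ∈ CA N a R := fun ρ h1 h2 => by
    have h0 : 0 < ρ := S.ha.trans_lt h1
    have : ‖ρ • e‖ = ρ := by rw [norm_smul, h.e1, mul_one, Real.norm_of_nonneg h0.le]
    exact ⟨by rw [this]; exact h1.le, by rw [this]; exact h2.le⟩
  have hle : ∀ x ∈ OA N a R, ∀ y ∈ OA N a R, ‖x‖ = ‖y‖ → ∃ φ ∈ Icc (-(π/2)) (π/2), ∃ ψ ∈ Icc (-(π/2)) (π/2),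
      (⟪y, p⟫ ≤ ⟪x, p⟫ ↔ ψ ≤ φ) ∧ (⟪y, p⟫ < ⟪x, p⟫ ↔ ψ < φ) ∧ (∀ i, U i x = U i (rot e p φ (‖x‖ • e))) ∧
      ∀ i, U i y = U i (rot e p ψ (‖x‖ • e)) := by
    intro x hx y hy hxy
    obtain ⟨φ, h1, h2, h3⟩ := S.reduce h hs hb (OA_sub a R hx)
    obtain ⟨ψ, g1, g2, g3⟩ := S.reduce h hs hb (OA_sub a R hy)
    have h0 : 0 < ‖x‖ := S.ha.trans_lt hx.1
    refine ⟨φ, h1, ψ, g1, ?_, ?_, h3, by rw [hxy]; exact g3⟩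
    · rw [h2, g2, ← hxy, mul_le_mul_iff_right₀ h0]; exact strictMonoOn_sin.le_iff_le g1 h1
    · rw [h2, g2, ← hxy, mul_lt_mul_iff_right₀ h0]; exact strictMonoOn_sin.lt_iff_lt g1 h1
  have hd : ∀ i (ρ : ℝ), a < ρ → ρ < R → ∀ t, HasDerivAt (fun t => U i (rot e p t (ρ • e))) (VV a R U e p i (rot e p t (ρ • e))) t :=
    fun i ρ h1 h2 t => S.V_deriv h (hca ρ h1 h2) i t
  refine ⟨p, h.b1, ?_⟩
  rcases hal with hz | hz
  · have key : ∀ i, ∀ x ∈ OA N a R, ∀ y ∈ OA N a R, ‖x‖ = ‖y‖ → U i x = U i y := by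
      intro i x hx y hy hxy
      obtain ⟨φ, -, ψ, -, -, -, h3, h4⟩ := hle x hx y hy hxy
      rw [h3, h4, S.V_inv h hs hz i (hca _ hx.1 hx.2), S.V_inv h hs hz i (hca _ hx.1 hx.2)]
    exact ⟨fun i x hx y hy hxy _ => (key i x hx y hy hxy).ge, Or.inl key⟩
  · have hm : ∀ i (ρ : ℝ), a < ρ → ρ < R → StrictMonoOn (fun t => U i (rot e p t (ρ • e))) (Icc (-(π/2)) (π/2)) := by
      intro i ρ h1 h2
      refine strictMonoOn_of_deriv_pos (convex_Icc _ _) (fun t _ => (hd i ρ h1 h2 t).continuousAt.continuousWithinAt) ?_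
      intro t ht
      rw [interior_Icc] at ht
      rw [(hd i ρ h1 h2 t).deriv]
      exact hz i _ (hin ρ h1 h2 t ht)
    constructor
    · intro i x hx y hy hxy hi
      obtain ⟨φ, h1, ψ, g1, k1, k2, h3, h4⟩ := hle x hx y hy hxy
      rw [h3, h4]
      exact (hm i ‖x‖ hx.1 hx.2).monotoneOn g1 h1 (k1.1 hi)
    · right
      intro i x hx y hy hxy hi
      obtain ⟨φ, h1, ψ, g1, k1, k2, h3, h4⟩ := hle x hx y hy hxy
      rw [h3, h4]
      exact hm i ‖x‖ hx.1 hx.2 g1 h1 (k2.1 hi)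

end Sys
end RP

namespace RP
open Filter Topology QF LapC MP
variable {N m : ℕ}

lemma closure_OA {a R : ℝ} (ha : 0 < a) (haR : a < R) : closure (OA N a R) = CA N a R := by
  refine subset_antisymm ((CA_closed a R).closure_subset_iff.2 (OA_sub a R)) fun x hx => ?_
  have hx0 : 0 < ‖x‖ := ha.trans_le hx.1
  have h1 : ‖x‖ ∈ closure (Ioo a R) := by rw [closure_Ioo haR.ne]; exact hx
  have h2 : Continuous fun s : ℝ => s • (‖x‖⁻¹ • x) := by fun_prop
  have := map_mem_closure h2 h1 (t := OA N a R) fun s hs => by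
    have : ‖s • (‖x‖⁻¹ • x)‖ = s := by
      rw [norm_smul, norm_smul, norm_inv, norm_norm, inv_mul_cancel₀ hx0.ne', mul_one, Real.norm_of_nonneg (ha.trans hs.1).le]
    exact ⟨by rw [this]; exact hs.1, by rw [this]; exact hs.2⟩
  simpa [smul_smul, mul_inv_cancel₀ hx0.ne'] using this

theorem main (hN : 2 ≤ N) (hm : 2 ≤ m) {Ω : Set (EuclN N)} {a R : ℝ} (ha : 0 ≤ a) (haR : a < R)
    (hΩo : IsOpen Ω) (hΩc : closure Ω = CA N a R)
    (hΩ : ∀ x, x ∈ Ω ↔ (a < ‖x‖ ∨ (a = 0 ∧ x = 0)) ∧ ‖x‖ < R)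
    (f : Fin m → ℝ → (Fin m → ℝ) → ℝ)
    (hf : ∀ i, ContDiff ℝ 1 (fun q : ℝ × (Fin m → ℝ) => f i q.1 q.2))
    (U : Fin m → EuclN N → ℝ)
    (hUreg : ∀ i, ContDiffOn ℝ 3 (U i) (closure Ω))
    (hsol : IsSolution Ω f U)
    (hMorse : ¬ NegDefFamily f U Ω (N + 1))
    (hcoup : ∀ e : EuclN N, ‖e‖ = 1 → FullyCoupledAlong f U (halfDom Ω e))
    (hmono : ∀ i j (r : ℝ) (s t : Fin m → ℝ), (∀ k, s k ≤ t k) →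
      pd (f i) j r s ≤ pd (f i) j r t) :
    ∃ p : EuclN N, FoliatedSchwarzWith Ω U p ∧
      (¬ IsRadial Ω U →
        ∀ i, ∀ x ∈ Ω, ∀ y ∈ Ω, ‖x‖ = ‖y‖ → |⟪x, p⟫| < ‖x‖ → |⟪y, p⟫| < ‖y‖ →
          ⟪y, p⟫ < ⟪x, p⟫ → U i y < U i x) := by
  classical
  have hhalf : ∀ e : EuclN N, halfDom Ω e = HD a R e := by
    intro e; ext x
    constructor
    · rintro ⟨h1, h2⟩
      obtain ⟨h3 | ⟨-, h3⟩, h4⟩ := (hΩ x).1 h1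
      · exact ⟨h3, h4, h2⟩
      · rw [h3, inner_zero_left] at h2; exact absurd h2 (lt_irrefl _)
    · rintro ⟨h1, h2, h3⟩
      exact ⟨(hΩ x).2 ⟨Or.inl h1, h2⟩, h3⟩
  have hsub : OA N a R ⊆ Ω := fun x hx => (hΩ x).2 ⟨Or.inl hx.1, hx.2⟩
  have hfr : ∀ x, x ∈ CA N a R → x ∉ Ω → ∀ i, U i x = 0 := fun x h1 h2 i =>
    hsol.2 i x (by rw [hΩo.frontier_eq, hΩc]; exact ⟨h1, h2⟩)
  rw [hΩc] at hUreg
  obtain ⟨e1, he1⟩ : ∃ e : EuclN N, ‖e‖ = 1 := ⟨EuclideanSpace.single ⟨0, by omega⟩ 1, by simp⟩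
  have coop : ∀ i j, i ≠ j → ∀ r, a < r → r < R → ∀ s, 0 ≤ pd (f i) j r s := by
    intro i j hij r h1 h2 s
    have h0 : 0 < r := ha.trans_lt h1
    have hn : ‖r • e1‖ = r := by rw [norm_smul, he1, mul_one, Real.norm_of_nonneg h0.le]
    have := (hcoup e1 he1).1 i j hij (r • e1) (by
      rw [hhalf]
      refine ⟨by rwa [hn], by rwa [hn], ?_⟩
      rw [inner_smul_left, real_inner_self_eq_norm_sq, he1]; simpa using h0) s
    rwa [hn] at this
  have coopΩ : ∀ i j, i ≠ j → ∀ x ∈ Ω, ∀ s, 0 ≤ pd (f i) j ‖x‖ s := by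
    intro i j hij x hx s
    obtain ⟨h3 | ⟨h3, h5⟩, h4⟩ := (hΩ x).1 hx
    · exact coop i j hij _ h3 h4 s
    · rw [h5, norm_zero]
      have hc : Continuous fun r : ℝ => pd (f i) j r s := (pd_cont hf i j).comp (by fun_prop : Continuous fun r : ℝ => (r, s))
      refine ge_of_tendsto ((hc.tendsto 0).mono_left (nhdsWithin_le_nhds (s := Ioi 0))) ?_
      have hR : 0 < R := h3 ▸ haR
      filter_upwards [self_mem_nhdsWithin, nhdsWithin_le_nhds (gt_mem_nhds hR)] with r r1 r2
      exact coop i j hij r (h3 ▸ r1) r2 s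
  have hext : ∀ i, ∃ g : C(EuclN N, ℝ), ∀ x ∈ CA N a R, g x = U i x := by
    intro i
    obtain ⟨g, hg⟩ := ContinuousMap.exists_restrict_eq (CA_closed (N := N) a R)
      ⟨(CA N a R).restrict (U i), (hUreg i).continuousOn.restrict⟩
    exact ⟨g, fun x hx => congrArg (fun k => k ⟨x, hx⟩) hg⟩
  choose g hg using hext
  set d : Fin m → Fin m → EuclN N → ℝ := fun i j x => pd (f i) j ‖x‖ (fun k => g k x) with hd
  have dc : ∀ i j, Continuous (d i j) := fun i j =>
    (pd_cont hf i j).comp (continuous_norm.prodMk (continuous_pi fun k => (g k).continuous))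
  set c : Fin m → Fin m → EuclN N → ℝ := fun i j x => if i = j then d i j x else max 0 (d i j x) with hcdef
  have hc : ∀ i j, Continuous (c i j) := by
    intro i j
    by_cases h : i = j
    · simp only [hcdef, h, if_true]; exact dc j j
    · simp only [hcdef, h, if_false]; exact continuous_const.max (dc i j)
  have ccoop : ∀ i j, i ≠ j → ∀ x, 0 ≤ c i j x := by
    intro i j h x; simp only [hcdef, h, if_false]; exact le_max_left _ _
  have hcU : ∀ i j, ∀ x ∈ Ω, c i j x = pd (f i) j ‖x‖ (fun k => U k x) := by
    intro i j x hx
    have hxc : x ∈ CA N a R := by rw [← hΩc]; exact subset_closure hx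
    have e1 : d i j x = pd (f i) j ‖x‖ (fun k => U k x) := by
      simp only [hd]; congr 1; funext k; exact hg k x hxc
    by_cases h : i = j
    · subst h; simp only [hcdef, if_true]; exact e1
    · simp only [hcdef, h, if_false]; rw [e1, max_eq_right (coopΩ i j h x hx _)]
  have S : Sys a R f U c :=
    { hN := hN, hm := by omega, ha := ha, haR := haR, hf := hf, hU := hUreg
      hsol := fun i x hx => hsol.1 i x (hsub hx)
      hbR := fun i x hx => hfr x ⟨by rw [hx]; exact haR.le, hx.le⟩ (fun h => by linarith [((hΩ x).1 h).2]) i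
      hba := fun h0 i x hx => hfr x ⟨hx.ge, by rw [hx]; exact haR.le⟩ (fun h => by
        rcases ((hΩ x).1 h).1 with h | ⟨h, -⟩ <;> linarith) i
      coop := coop
      coup := by
        intro e he I J hI hJ h1 h2
        obtain ⟨i, hi, j, hj, hv⟩ := (hcoup e he).2 I J hI hJ h1 h2
        obtain ⟨x, hx⟩ := nonempty_of_measure_ne_zero hv.ne'
        exact ⟨i, hi, j, hj, x, hhalf e ▸ hx.1, hx.2⟩
      mono := hmono, hc := hc, ccoop := ccoop, hcU := fun i j x hx => hcU i j x (hsub hx) }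
  obtain ⟨e, he, hQ⟩ := exists_dir hN hc ccoop hΩo.measurableSet hcU hMorse
  obtain ⟨p, hp, h1, h2⟩ := S.final ⟨e, he, by rw [← hhalf e]; exact hQ⟩
  have triv : ∀ x ∈ Ω, ∀ y ∈ Ω, ‖x‖ = ‖y‖ → (x ∈ OA N a R ∧ y ∈ OA N a R) ∨ x = y := by
    intro x hx y hy hxy
    obtain ⟨h3 | ⟨-, h3⟩, h4⟩ := (hΩ x).1 hx
    · exact Or.inl ⟨⟨h3, h4⟩, ⟨hxy ▸ h3, hxy ▸ h4⟩⟩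
    · right
      rw [h3, norm_zero] at hxy
      rw [h3, norm_eq_zero.1 hxy.symm]
  refine ⟨p, ⟨hp, ?_⟩, ?_⟩
  · intro i x hx y hy hxy hi
    rcases triv x hx y hy hxy with ⟨hx', hy'⟩ | rfl
    · exact h1 i x hx' y hy' hxy hi
    · exact le_rfl
  · intro hnr i x hx y hy hxy _ _ hi
    rcases triv x hx y hy hxy with ⟨hx', hy'⟩ | rfl
    · rcases h2 with h2 | h2
      · refine absurd ?_ hnr
        intro i x hx y hy hxy
        rcases triv x hx y hy hxy with ⟨hx', hy'⟩ | rfl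
        · exact h2 i x hx' y hy' hxy
        · rfl
      · exact h2 i x hx' y hy' hxy hi
    · exact absurd hi (lt_irrefl _)

end RP

/-- **Theorem (symmetry for low Morse index solutions).** Solutions of the cooperative system
with Morse index at most `N`, convex-type nonlinearity, fully coupled along the solution in each
half-domain, are foliated Schwarz symmetric, and strictly decreasing in the angle if not radial. -/
theorem statement0
    {N m : ℕ} (hN : 2 ≤ N) (hm : 2 ≤ m)
    (Ω : Set (EuclN N)) (hΩ : IsBallOrAnnulus Ω)
    (f : Fin m → ℝ → (Fin m → ℝ) → ℝ)
    (hf : ∀ i, ContDiff ℝ 1 (fun q : ℝ × (Fin m → ℝ) => f i q.1 q.2))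
    (U : Fin m → EuclN N → ℝ)
    (hUreg : ∀ i, ContDiffOn ℝ 3 (U i) (closure Ω))
    (hsol : IsSolution Ω f U)
    (hMorse : ¬ NegDefFamily f U Ω (N + 1))
    (hcoup : ∀ e : EuclN N, ‖e‖ = 1 → FullyCoupledAlong f U (halfDom Ω e))
    (hmono : ∀ i j (r : ℝ) (s t : Fin m → ℝ), (∀ k, s k ≤ t k) →
      pd (f i) j r s ≤ pd (f i) j r t)
    (hdecomp : 3 ≤ m → ∀ i, ∃ g : Fin m → ℝ → ℝ → ℝ → ℝ,
      (∀ k, ContDiff ℝ 1 (fun q : ℝ × ℝ × ℝ => g k q.1 q.2.1 q.2.2)) ∧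
      ∀ (r : ℝ) (s : Fin m → ℝ), f i r s = ∑ k ∈ Finset.univ.erase i, g k r (s i) (s k)) :
    ∃ p : EuclN N, FoliatedSchwarzWith Ω U p ∧
      (¬ IsRadial Ω U →
        ∀ i, ∀ x ∈ Ω, ∀ y ∈ Ω, ‖x‖ = ‖y‖ → |⟪x, p⟫| < ‖x‖ → |⟪y, p⟫| < ‖y‖ →
          ⟪y, p⟫ < ⟪x, p⟫ → U i y < U i x) := by
  rcases hΩ with ⟨R, hR, rfl⟩ | ⟨r, R, hr, hrR, rfl⟩
  · refine RP.main hN hm le_rfl hR Metric.isOpen_ball ?_ ?_ f hf U hUreg hsol hMorse hcoup hmono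
    · rw [closure_ball 0 hR.ne']; ext x; simp [RP.CA]
    · intro x
      rw [mem_ball_zero_iff]
      refine ⟨fun h => ⟨?_, h⟩, fun h => h.2⟩
      by_cases h0 : x = 0
      · exact Or.inr ⟨rfl, h0⟩
      · exact Or.inl (norm_pos_iff.2 h0)
  · refine RP.main hN hm hr.le hrR (RP.OA_open r R) (RP.closure_OA hr hrR) ?_ f hf U hUreg hsol hMorse hcoup hmono
    intro x
    refine ⟨fun h => ⟨Or.inl h.1, h.2⟩, fun h => ⟨?_, h.2⟩⟩
    rcases h.1 with h | ⟨h, -⟩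
    · exact h
    · linarith
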